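/- arXiv:2101.03145 — 3 statements merged into one kernel-verified Lean document; each statement's English description precedes it below -/
import Mathlib

section
/- Let p and q be distinct prime numbers with p ≡ q ≡ 1 (mod 4) and Legendre symbol (p/q) = −1, and let k = ℚ(√(pq)). Then the class number h of k satisfies h ≡ 2 (mod 4), and the fundamental unit ε of k has norm N(ε) = −1. -/
open NumberField

lemma sz_descent (p q : ℕ) (hp : p.Prime) (hq : q.Prime) (hpq : p ≠ q) [Fact q.Prime]
    (hq4 : q % 4 = 1) (hleg : legendreSym q p = -1) (s : ℤ) (hs : s = 1 ∨ s = -1) :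
    ∀ (n : ℕ) (X Y Z : ℤ), Z.natAbs = n → (p : ℤ) * X ^ 2 - q * Y ^ 2 = s * Z ^ 2 → Z = 0 := by
  have hqI : Prime (q : ℤ) := Nat.prime_iff_prime_int.mp hq
  have hqp : ¬ (q : ℤ) ∣ p := by
    rw [Int.natCast_dvd_natCast]
    intro h
    exact hpq ((Nat.prime_dvd_prime_iff_eq hq hp).mp h).symm
  intro n
  induction n using Nat.strong_induction_on with
  | _ n ih =>
    intro X Y Z hZ h
    by_contra hZ0
    have hqZ : (q : ℤ) ∣ Z := by
      by_contra hn
      have hz : (Z : ZMod q) ≠ 0 := by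
        rwa [Ne, ZMod.intCast_zmod_eq_zero_iff_dvd]
      have h1 : (p : ZMod q) * X ^ 2 = s * Z ^ 2 := by
        have := congrArg (Int.cast : ℤ → ZMod q) h
        push_cast at this
        simpa using this
      have hsq : IsSquare (s : ZMod q) := by
        rcases hs with rfl | rfl
        · simp
        · have := (ZMod.exists_sq_eq_neg_one_iff (p := q)).mpr (by omega)
          simpa using this
      obtain ⟨r, hr⟩ := hsq
      have hr0 : r ≠ 0 := by
        rintro rfl
        rcases hs with rfl | rfl <;> simp at hr
      have hX : (X : ZMod q) ≠ 0 := by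
        intro hX
        rw [hX, hr] at h1
        have : r * r * (Z : ZMod q) ^ 2 ≠ 0 := by positivity
        apply this; rw [← h1]; ring
      have : legendreSym q p ≠ -1 := by
        rw [Ne, legendreSym.eq_neg_one_iff]
        push Not
        refine ⟨r * Z / X, ?_⟩
        rw [hr] at h1
        push_cast
        field_simp
        rw [h1]; ring
      exact this hleg
    obtain ⟨Z1, rfl⟩ := hqZ
    have hqX : (q : ℤ) ∣ X := by
      have : (q : ℤ) ∣ p * X ^ 2 := ⟨Y ^ 2 + s * q * Z1 ^ 2, by linear_combination h⟩
      exact hqI.dvd_of_dvd_pow ((hqI.dvd_or_dvd this).resolve_left hqp)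
    obtain ⟨X1, rfl⟩ := hqX
    have hq0 : (q : ℤ) ≠ 0 := hqI.ne_zero
    have hqY : (q : ℤ) ∣ Y := by
      have : (q : ℤ) ∣ Y ^ 2 := ⟨p * X1 ^ 2 - s * Z1 ^ 2, by
        apply mul_left_cancel₀ hq0; linear_combination -h⟩
      exact hqI.dvd_of_dvd_pow this
    obtain ⟨Y1, rfl⟩ := hqY
    have hZ1 : Z1 ≠ 0 := by rintro rfl; simp at hZ0
    refine hZ1 (ih Z1.natAbs ?_ X1 Y1 Z1 rfl ?_)
    · rw [← hZ, Int.natAbs_mul, Int.natAbs_natCast]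
      have := Int.natAbs_pos.mpr hZ1
      nlinarith [hq.two_le]
    · apply mul_left_cancel₀ (pow_ne_zero 2 hq0); linear_combination h

lemma sz_nonorm (p q : ℕ) (hp : p.Prime) (hq : q.Prime) (hpq : p ≠ q) [Fact q.Prime]
    (hq4 : q % 4 = 1) (hleg : legendreSym q p = -1) (a b N n : ℤ)
    (h : 4 * N = a ^ 2 - p * q * b ^ 2) (hN : |N| = p * n ^ 2) : n = 0 := by
  have hpI : Prime (p : ℤ) := Nat.prime_iff_prime_int.mp hp
  have hN' : ∃ s : ℤ, (s = 1 ∨ s = -1) ∧ N = s * (p * n ^ 2) := by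
    rcases abs_choice N with h1 | h1
    · exact ⟨1, Or.inl rfl, by linarith⟩
    · exact ⟨-1, Or.inr rfl, by linarith⟩
  obtain ⟨s, hs, rfl⟩ := hN'
  have : (p : ℤ) ∣ a := by
    apply hpI.dvd_of_dvd_pow (n := 2)
    exact ⟨4 * s * n ^ 2 + q * b ^ 2, by linear_combination -h⟩
  obtain ⟨c, rfl⟩ := this
  have := sz_descent p q hp hq hpq hq4 hleg s hs _ c b (2 * n) rfl (by
    apply mul_left_cancel₀ hpI.ne_zero; linear_combination -h)
  omega

lemma sz_group (G : Type*) [CommGroup G] [Finite G] (c : G) (hc1 : c ≠ 1) (hc2 : c ^ 2 = 1)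
    (h2 : ∀ x : G, x ^ 2 = 1 → x = 1 ∨ x = c) (hns : ∀ x : G, x ^ 2 ≠ c) :
    Nat.card G % 4 = 2 := by
  have hord : orderOf c = 2 := orderOf_eq_prime hc2 hc1
  have hdvd : 2 ∣ Nat.card G := hord ▸ orderOf_dvd_natCard c
  by_contra hne
  have h4 : 2 ^ 2 ∣ Nat.card G := by omega
  have : Fact (Nat.Prime 2) := ⟨Nat.prime_two⟩
  obtain ⟨H, hH⟩ := Sylow.exists_subgroup_card_pow_prime 2 h4
  have key : ∀ x ∈ H, x ∈ ({1, c} : Set G) := by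
    intro x hx
    have h : x ^ 4 = 1 := by
      have := pow_card_eq_one' (x := (⟨x, hx⟩ : H))
      rw [hH] at this
      simpa using congrArg Subtype.val this
    have h' : (x ^ 2) ^ 2 = 1 := by rw [← pow_mul]; exact h
    rcases h2 _ h' with h3 | h3
    · exact h2 _ h3
    · exact absurd h3 (hns x)
  have : (H : Set G).ncard ≤ ({1, c} : Set G).ncard := Set.ncard_le_ncard key (Set.toFinite _)
  have h5 : ({1, c} : Set G).ncard ≤ 2 := by
    simpa using Set.ncard_insert_le (1 : G) {c}
  have h6 : (H : Set G).ncard = 4 := by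
    rw [← Nat.card_coe_set_eq]; simpa using hH
  omega

section
set_option linter.unusedSectionVars false
variable {O : Type*} [CommRing O] [IsDedekindDomain O] [CharZero O]

lemma sz_PP (p q : ℕ) (hco : Nat.Coprime p q) (A : O) (hA : A * A = p * q) :
    Ideal.span {(p : O), A} * Ideal.span {(p : O), A} = Ideal.span {(p : O)} := by
  rw [Ideal.span_pair_mul_span_pair]
  apply le_antisymm
  · rw [Ideal.span_le]
    rintro x (rfl | rfl | rfl | rfl) <;> simp only [SetLike.mem_coe, Ideal.mem_span_singleton]
    · exact dvd_mul_right _ _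
    · exact dvd_mul_right _ _
    · exact dvd_mul_left _ _
    · rw [hA]; exact dvd_mul_right _ _
  · rw [Ideal.span_singleton_le_iff_mem]
    obtain ⟨u, v, huv⟩ := (Nat.isCoprime_iff_coprime.mpr hco)
    have huv' : (u : O) * p + v * q = 1 := by exact_mod_cast congrArg (Int.cast : ℤ → O) huv
    have : (p : O) = u * (p * p) + v * (A * A) := by
      rw [hA]; linear_combination -(p : O) * huv'
    have hmem : u * (p * p) + v * (A * A) ∈
        Ideal.span {(p : O) * p, p * A, A * p, A * A} := by
      apply Ideal.add_mem <;> apply Ideal.mul_mem_left <;> apply Ideal.subset_span <;> simp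
    rwa [← this] at hmem

lemma sz_PQ (p q : ℕ) (hco : Nat.Coprime p q) (A : O) (hA : A * A = p * q) :
    Ideal.span {(p : O), A} * Ideal.span {(q : O), A} = Ideal.span {A} := by
  rw [Ideal.span_pair_mul_span_pair]
  apply le_antisymm
  · rw [Ideal.span_le]
    rintro x (rfl | rfl | rfl | rfl) <;> simp only [SetLike.mem_coe, Ideal.mem_span_singleton]
    · rw [← hA]; exact dvd_mul_right _ _
    · exact dvd_mul_left _ _
    · exact dvd_mul_right _ _
    · exact dvd_mul_right _ _
  · rw [Ideal.span_singleton_le_iff_mem]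
    obtain ⟨u, v, huv⟩ := (Nat.isCoprime_iff_coprime.mpr hco)
    have huv' : (u : O) * p + v * q = 1 := by exact_mod_cast congrArg (Int.cast : ℤ → O) huv
    have : A = u * (p * A) + v * (A * q) := by
      linear_combination -A * huv'
    have hmem : u * (p * A) + v * (A * q) ∈
        Ideal.span {(p : O) * q, p * A, A * q, A * A} := by
      apply Ideal.add_mem <;> apply Ideal.mul_mem_left <;> apply Ideal.subset_span <;> simp
    rwa [← this] at hmem

/-- key divisibility for elements of an ideal whose square is `(m)` -/
lemma sz_div (d : ℤ) (A : O) (hA : A * A = d)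
    (ind : ∀ a b : ℤ, (a : O) + b * A = 0 → a = 0 ∧ b = 0)
    (L : ∀ x : O, ∃ a b N : ℤ, 2 * x = a + b * A ∧ 4 * N = a ^ 2 - d * b ^ 2)
    (m : ℤ) (x : O) (hx : (m : O) ∣ x ^ 2) :
    ∃ a b N : ℤ, 2 * x = a + b * A ∧ 4 * N = a ^ 2 - d * b ^ 2 ∧ m ∣ N ∧ m ∣ a ^ 2 := by
  obtain ⟨a, b, N, h1, h2⟩ := L x
  obtain ⟨y, hy⟩ := hx
  obtain ⟨c, e, M, h3, h4⟩ := L y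
  have h5 : ((a ^ 2 + d * b ^ 2 - 2 * m * c : ℤ) : O) + ((2 * a * b - 2 * m * e : ℤ) : O) * A = 0 := by
    push_cast
    have : 4 * x ^ 2 = 2 * m * (2 * y) := by rw [hy]; ring
    rw [h3] at this
    have h6 : (2 * x) ^ 2 = (a + b * A) ^ 2 := by rw [h1]
    linear_combination this - h6 - (b : O) ^ 2 * hA
  obtain ⟨h6, h7⟩ := ind _ _ h5
  have h8 : N ^ 2 = m ^ 2 * M := by
    have h7' : a * b = m * e := by linarith
    have : 16 * N ^ 2 = 16 * (m ^ 2 * M) := by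
      have e1 : a ^ 2 + d * b ^ 2 = 2 * m * c := by linarith
      calc 16 * N ^ 2 = (4 * N) ^ 2 := by ring
        _ = (a ^ 2 + d * b ^ 2) ^ 2 - 4 * d * (a * b) ^ 2 := by rw [h2]; ring
        _ = 4 * m ^ 2 * (c ^ 2 - d * e ^ 2) := by rw [e1, h7']; ring
        _ = _ := by rw [← h4]; ring
    linarith
  have h9 : m ∣ N := (Int.pow_dvd_pow_iff two_ne_zero).mp ⟨M, h8⟩
  refine ⟨a, b, N, h1, h2, h9, ?_⟩
  have : a ^ 2 = m * c + 2 * N := by linarith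
  rw [this]
  exact dvd_add (dvd_mul_right _ _) (h9.mul_left _)

lemma sz_natdvd (d : ℤ) (A : O)
    (ind : ∀ a b : ℤ, (a : O) + b * A = 0 → a = 0 ∧ b = 0)
    (L : ∀ x : O, ∃ a b N : ℤ, 2 * x = a + b * A ∧ 4 * N = a ^ 2 - d * b ^ 2)
    (r m : ℕ) (hr : r ≠ 0) (h : (r : O) ∣ m) : r ∣ m := by
  obtain ⟨y, hy⟩ := h
  obtain ⟨c, e, N, h1, h2⟩ := L y
  obtain ⟨h3, h4⟩ := ind (2 * m - r * c) (-(r * e)) (by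
    push_cast
    linear_combination 2 * hy + (r : O) * h1)
  have he : e = 0 := by
    have : (r : ℤ) * e = 0 := by linarith
    rcases mul_eq_zero.mp this with h | h
    · exact absurd (by exact_mod_cast h) hr
    · exact h
  subst he
  have hc : Even c := by
    have : Even (c ^ 2) := ⟨2 * N, by linarith⟩
    exact (Int.even_pow.mp this).1
  obtain ⟨c1, rfl⟩ := hc
  have : (m : ℤ) = r * c1 := by linarith
  exact Int.natCast_dvd_natCast.mp ⟨c1, this⟩

lemma sz_unram (d : ℤ) (hd : d % 4 = 1) (A : O) (hA : A * A = d)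
    (ind : ∀ a b : ℤ, (a : O) + b * A = 0 → a = 0 ∧ b = 0)
    (L : ∀ x : O, ∃ a b N : ℤ, 2 * x = a + b * A ∧ 4 * N = a ^ 2 - d * b ^ 2)
    (L2 : ∀ a b N : ℤ, 4 * N = a ^ 2 - d * b ^ 2 → ∃ x : O, 2 * x = a + b * A)
    (m : ℤ) (l : ℕ) (hl : l.Prime) (hlm : (l : ℤ) ∣ m) (hld : ¬ (l : ℤ) ∣ d)
    (x : O) (hx : (m : O) ∣ x ^ 2) : (l : O) ∣ x := by
  obtain ⟨a, b, N, h1, h2, h3, h4⟩ := sz_div d A hA ind L m x hx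
  have hlI : Prime (l : ℤ) := Nat.prime_iff_prime_int.mp hl
  obtain ⟨a, rfl⟩ : (l : ℤ) ∣ a := hlI.dvd_of_dvd_pow (hlm.trans h4)
  obtain ⟨N, rfl⟩ : (l : ℤ) ∣ N := hlm.trans h3
  obtain ⟨b, rfl⟩ : (l : ℤ) ∣ b := by
    have : (l : ℤ) ∣ d * b ^ 2 := ⟨l * a ^ 2 - 4 * N, by linarith⟩
    exact hlI.dvd_of_dvd_pow ((hlI.dvd_or_dvd this).resolve_left hld)
  have hl0 : (l : ℤ) ≠ 0 := hlI.ne_zero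
  have h5 : 4 * N = l * (a ^ 2 - d * b ^ 2) := by
    apply mul_left_cancel₀ hl0; linarith
  have h6 : ∃ M : ℤ, 4 * M = a ^ 2 - d * b ^ 2 := by
    rcases hl.eq_two_or_odd' with rfl | hodd
    · have h7 : 2 * N = a ^ 2 - d * b ^ 2 := by push_cast at h5; linarith
      have hdm : d = 4 * (d / 4) + 1 := by omega
      rcases Int.even_or_odd' a with ⟨u, rfl | rfl⟩ <;> rcases Int.even_or_odd' b with ⟨v, rfl | rfl⟩
      · exact ⟨u ^ 2 - d * v ^ 2, by ring⟩
      · exfalso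
        have : 2 * (N - 2 * u ^ 2 + d * (2 * v ^ 2 + 2 * v) + 2 * (d / 4)) = -1 := by
          linear_combination h7 - hdm
        omega
      · exfalso
        have : 2 * (N - 2 * u ^ 2 - 2 * u + d * (2 * v ^ 2)) = 1 := by
          linear_combination h7
        omega
      · exact ⟨u ^ 2 + u - d * (v ^ 2 + v) - d / 4, by linear_combination hdm⟩
    · have hc : IsCoprime (4 : ℤ) l := by
        have : Nat.Coprime 4 l := by
          have : Nat.Coprime (2 ^ 2) l := Nat.Coprime.pow_left 2 (Nat.coprime_two_left.mpr hodd)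
          exact this
        exact_mod_cast Nat.isCoprime_iff_coprime.mpr this
      obtain ⟨M, hM⟩ := hc.dvd_of_dvd_mul_left ⟨N, h5.symm⟩
      exact ⟨M, hM.symm⟩
  obtain ⟨M, hM⟩ := h6
  obtain ⟨y, hy⟩ := L2 a b M hM
  refine ⟨y, ?_⟩
  have h2 : (2 : O) ≠ 0 := two_ne_zero
  apply mul_left_cancel₀ h2
  rw [h1]; push_cast
  linear_combination -(l : O) * hy

lemma sz_ram (d : ℤ) (A : O) (hA : A * A = d)
    (ind : ∀ a b : ℤ, (a : O) + b * A = 0 → a = 0 ∧ b = 0)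
    (L : ∀ x : O, ∃ a b N : ℤ, 2 * x = a + b * A ∧ 4 * N = a ^ 2 - d * b ^ 2)
    (m : ℤ) (l : ℕ) (hl : l.Prime) (hl4 : l % 4 = 1) (hlm : (l : ℤ) ∣ m)
    (x : O) (hx : (m : O) ∣ x ^ 2) : x ∈ Ideal.span {(l : O), A} := by
  obtain ⟨a, b, N, h1, h2, h3, h4⟩ := sz_div d A hA ind L m x hx
  have hlI : Prime (l : ℤ) := Nat.prime_iff_prime_int.mp hl
  obtain ⟨a, rfl⟩ : (l : ℤ) ∣ a := hlI.dvd_of_dvd_pow (hlm.trans h4)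
  obtain ⟨t, ht⟩ : ∃ t : ℕ, l = 2 * t + 1 := ⟨l / 2, by omega⟩
  rw [Ideal.mem_span_pair]
  have ht' : (l : O) = 2 * t + 1 := by rw [ht]; push_cast; ring
  refine ⟨x - t * a, - t * b, ?_⟩
  push_cast at h1
  linear_combination x * ht' + (t : O) * h1

lemma sz_cancel (d : ℤ) (A : O)
    (ind : ∀ a b : ℤ, (a : O) + b * A = 0 → a = 0 ∧ b = 0)
    (L : ∀ x : O, ∃ a b N : ℤ, 2 * x = a + b * A ∧ 4 * N = a ^ 2 - d * b ^ 2)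
    (P J : Ideal O) (r m : ℕ) (hr : 1 < r) (hm : 0 < m) (hP : P * P = Ideal.span {(r : O)})
    (hJ : J ^ 2 = Ideal.span {(m : O)}) (hle : J ≤ P) :
    ∃ (J1 : Ideal O) (m1 : ℕ), J = P * J1 ∧ 0 < m1 ∧ m1 < m ∧ J1 ^ 2 = Ideal.span {(m1 : O)} := by
  obtain ⟨J1, rfl⟩ := Ideal.dvd_iff_le.mpr hle
  have h1 : Ideal.span {(r : O)} * J1 ^ 2 = Ideal.span {(m : O)} := by rw [← hP, ← hJ]; ring
  have h2 : (r : O) ∣ m := by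
    rw [← Ideal.mem_span_singleton]
    have h3 : (m : O) ∈ Ideal.span {(m : O)} := Ideal.mem_span_singleton_self _
    rw [← h1] at h3
    have h4 : Ideal.span {(r : O)} * J1 ^ 2 ≤ Ideal.span {(r : O)} := Ideal.mul_le_left
    exact h4 h3
  obtain ⟨m1, rfl⟩ := sz_natdvd d A ind L r m (by omega) h2
  have hm1 : 0 < m1 := Nat.pos_of_ne_zero (by rintro rfl; simp at hm)
  refine ⟨J1, m1, rfl, hm1, by nlinarith, ?_⟩
  have hne : Ideal.span {(r : O)} ≠ 0 := by
    simp only [Ne, Ideal.zero_eq_bot, Ideal.span_singleton_eq_bot, Nat.cast_eq_zero]; omega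
  apply mul_left_cancel₀ hne
  rw [h1, Ideal.span_singleton_mul_span_singleton]; push_cast; rfl

lemma sz_struct (p q : ℕ) (hp : p.Prime) (hq : q.Prime) (hpq : p ≠ q)
    (hp4 : p % 4 = 1) (hq4 : q % 4 = 1) (A : O) (hA : A * A = p * q)
    (ind : ∀ a b : ℤ, (a : O) + b * A = 0 → a = 0 ∧ b = 0)
    (L : ∀ x : O, ∃ a b N : ℤ, 2 * x = a + b * A ∧ 4 * N = a ^ 2 - (p * q : ℤ) * b ^ 2)
    (L2 : ∀ a b N : ℤ, 4 * N = a ^ 2 - (p * q : ℤ) * b ^ 2 → ∃ x : O, 2 * x = a + b * A) :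
    ∀ (m : ℕ), 0 < m → ∀ (J : Ideal O), J ^ 2 = Ideal.span {(m : O)} →
      ∃ n : ℕ, 0 < n ∧ (J = Ideal.span {(n : O)} ∨
        J = Ideal.span {(n : O)} * Ideal.span {(p : O), A} ∨
        J = Ideal.span {(n : O)} * Ideal.span {(q : O), A} ∨
        J = Ideal.span {(n : O)} * Ideal.span {A}) := by
  have hco : Nat.Coprime p q := (Nat.coprime_primes hp hq).mpr hpq
  have hA' : A * A = ((p * q : ℤ) : O) := by rw [hA]; push_cast; rfl
  have hPP := sz_PP p q hco A hA
  have hQQ := sz_PP q p hco.symm A (by rw [hA, mul_comm])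
  have hPQ := sz_PQ p q hco A hA
  have hd : (p * q : ℤ) % 4 = 1 := by
    rw [Int.mul_emod]
    have : (p : ℤ) % 4 = 1 := by omega
    have : (q : ℤ) % 4 = 1 := by omega
    simp [*]
  intro m
  induction m using Nat.strong_induction_on with
  | _ m ih =>
    intro hm J hJ
    have hJx : ∀ x ∈ J, ((m : ℤ) : O) ∣ x ^ 2 := by
      intro x hx
      have := Ideal.pow_mem_pow hx 2
      rw [hJ, Ideal.mem_span_singleton] at this
      exact_mod_cast this
    by_cases hm1 : m = 1
    · refine ⟨1, one_pos, Or.inl ?_⟩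
      subst hm1
      have h1 : J ^ 2 = 1 := by rw [hJ]; simp
      rw [Nat.cast_one, Ideal.span_singleton_one]
      have : J ^ 2 ≤ J := Ideal.pow_le_self two_ne_zero
      rw [h1] at this
      exact top_le_iff.mp (by rwa [Ideal.one_eq_top] at this)
    obtain ⟨l, hl, hlm⟩ := Nat.exists_prime_and_dvd hm1
    have hlmI : (l : ℤ) ∣ m := by exact_mod_cast hlm
    by_cases hlp : l = p
    · subst hlp
      have hle : J ≤ Ideal.span {(l : O), A} := fun x hx =>
        sz_ram _ A hA' ind L m l hl hp4 hlmI x (hJx x hx)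
      obtain ⟨J1, m1, rfl, h1, h2, h3⟩ := sz_cancel _ A ind L _ J l m hl.one_lt hm hPP hJ hle
      obtain ⟨n, hn, rfl | rfl | rfl | rfl⟩ := ih m1 h2 h1 J1 h3
      · exact ⟨n, hn, Or.inr (Or.inl (mul_comm _ _))⟩
      · refine ⟨n * l, Nat.mul_pos hn hl.pos, Or.inl ?_⟩
        rw [Nat.cast_mul, ← Ideal.span_singleton_mul_span_singleton, ← hPP]; ring
      · refine ⟨n, hn, Or.inr (Or.inr (Or.inr ?_))⟩
        rw [← hPQ]; ring
      · refine ⟨n * l, Nat.mul_pos hn hl.pos, Or.inr (Or.inr (Or.inl ?_))⟩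
        rw [Nat.cast_mul, ← Ideal.span_singleton_mul_span_singleton, ← hPP, ← hPQ]; ring
    by_cases hlq : l = q
    · subst hlq
      have hle : J ≤ Ideal.span {(l : O), A} := fun x hx =>
        sz_ram _ A hA' ind L m l hl hq4 hlmI x (hJx x hx)
      obtain ⟨J1, m1, rfl, h1, h2, h3⟩ := sz_cancel _ A ind L _ J l m hl.one_lt hm hQQ hJ hle
      obtain ⟨n, hn, rfl | rfl | rfl | rfl⟩ := ih m1 h2 h1 J1 h3
      · exact ⟨n, hn, Or.inr (Or.inr (Or.inl (mul_comm _ _)))⟩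
      · refine ⟨n, hn, Or.inr (Or.inr (Or.inr ?_))⟩
        rw [← hPQ]; ring
      · refine ⟨n * l, Nat.mul_pos hn hl.pos, Or.inl ?_⟩
        rw [Nat.cast_mul, ← Ideal.span_singleton_mul_span_singleton, ← hQQ]; ring
      · refine ⟨n * l, Nat.mul_pos hn hl.pos, Or.inr (Or.inl ?_)⟩
        rw [Nat.cast_mul, ← Ideal.span_singleton_mul_span_singleton, ← hQQ, ← hPQ]; ring
    have hld : ¬ (l : ℤ) ∣ (p * q : ℤ) := by
      intro h
      have h' : l ∣ p * q := by exact_mod_cast h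
      rcases hl.dvd_mul.mp h' with h | h
      · exact hlp ((Nat.prime_dvd_prime_iff_eq hl hp).mp h)
      · exact hlq ((Nat.prime_dvd_prime_iff_eq hl hq).mp h)
    have hle : J ≤ Ideal.span {(l : O)} := fun x hx =>
      Ideal.mem_span_singleton.mpr
        (sz_unram _ hd A hA' ind L L2 m l hl hlmI hld x (hJx x hx))
    obtain ⟨J1, m1, rfl, h1, h2, h3⟩ := sz_cancel _ A ind L _ J (l * l) m
      (by nlinarith [hl.one_lt]) hm
      (by rw [Ideal.span_singleton_mul_span_singleton, Nat.cast_mul]) hJ hle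
    obtain ⟨n, hn, h⟩ := ih m1 h2 h1 J1 h3
    refine ⟨l * n, Nat.mul_pos hl.pos hn, ?_⟩
    rw [Nat.cast_mul, ← Ideal.span_singleton_mul_span_singleton]
    rcases h with rfl | rfl | rfl | rfl
    · exact Or.inl rfl
    · exact Or.inr (Or.inl (mul_assoc _ _ _).symm)
    · exact Or.inr (Or.inr (Or.inl (mul_assoc _ _ _).symm))
    · exact Or.inr (Or.inr (Or.inr (mul_assoc _ _ _).symm))

end
lemma sz_field (k : Type*) [Field k] [NumberField k] (hdeg : Module.finrank ℚ k = 2)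
    (α : k) (d : ℚ) (hα : α ^ 2 = (d : k)) (hd : ¬ IsSquare d) :
    (∀ r s : ℚ, (r : k) + s * α = 0 → r = 0 ∧ s = 0) ∧
    ∀ x : k, ∃ r s : ℚ, x = r + s * α ∧ Algebra.norm ℚ x = r ^ 2 - d * s ^ 2 ∧
      Algebra.trace ℚ k x = 2 * r := by
  have hli : ∀ r s : ℚ, (r : k) + s * α = 0 → r = 0 ∧ s = 0 := by
    intro r s h
    by_cases hs : s = 0
    · subst hs; simp at h; exact ⟨h, rfl⟩
    · exfalso
      apply hd
      refine ⟨r / s, ?_⟩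
      have hs' : (s : k) ≠ 0 := by exact_mod_cast hs
      have : α = - (r / s) := by field_simp; linear_combination h
      rw [this] at hα
      have : ((r / s * (r / s) : ℚ) : k) = (d : k) := by rw [← hα]; push_cast; ring
      exact_mod_cast this.symm
  refine ⟨hli, ?_⟩
  have hind : LinearIndependent ℚ ![(1 : k), α] := by
    rw [LinearIndependent.pair_iff]
    intro s t h
    apply hli
    simpa [Algebra.smul_def] using h
  let b := basisOfLinearIndependentOfCardEqFinrank hind (by simp [hdeg])
  have hb0 : b 0 = 1 := by simp [b]
  have hb1 : b 1 = α := by simp [b]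
  intro x
  obtain ⟨r, hr⟩ : ∃ r, r = b.repr x 0 := ⟨_, rfl⟩
  obtain ⟨s, hs⟩ : ∃ s, s = b.repr x 1 := ⟨_, rfl⟩
  have hx : x = r + s * α := by
    have := b.sum_repr x
    rw [Fin.sum_univ_two, hb0, hb1, ← hr, ← hs] at this
    simpa [Algebra.smul_def] using this.symm
  have hrep : ∀ u v : ℚ, b.repr ((u : k) + v * α) = Finsupp.single 0 u + Finsupp.single 1 v := by
    intro u v
    have : (u : k) + v * α = u • b 0 + v • b 1 := by
      rw [hb0, hb1]; simp [Algebra.smul_def]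
    rw [this, map_add, map_smul, map_smul, b.repr_self, b.repr_self]
    simp
  have hxa : x * α = (d * s : ℚ) + r * α := by
    rw [hx]; push_cast; linear_combination (s : k) * hα
  refine ⟨r, s, hx, ?_, ?_⟩
  · rw [Algebra.norm_eq_matrix_det b, Matrix.det_fin_two]
    simp only [Algebra.leftMulMatrix_eq_repr_mul, hb0, hb1, mul_one]
    rw [hxa, hrep, hx, hrep]
    simp; ring
  · rw [Algebra.trace_eq_matrix_trace b, Matrix.trace_fin_two]
    simp only [Algebra.leftMulMatrix_eq_repr_mul, hb0, hb1, mul_one]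
    rw [hxa, hrep, hx, hrep]
    simp; ring

lemma sz_ring (p q : ℕ) (hp : p.Prime) (hq : q.Prime) (hpq : p ≠ q)
    (k : Type*) [Field k] [NumberField k]
    (hdeg : Module.finrank ℚ k = 2)
    (α : k) (hα : α ^ 2 = (p : k) * q) :
    ∃ A : 𝓞 k, A * A = p * q ∧ 
    (∀ a b : ℤ, (a : 𝓞 k) + b * A = 0 → a = 0 ∧ b = 0) ∧
    (∀ x : 𝓞 k, ∃ a b N : ℤ, 2 * x = a + b * A ∧ 4 * N = a ^ 2 - (p * q : ℤ) * b ^ 2 ∧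
      Algebra.norm ℤ x = N) ∧
    (∀ a b N : ℤ, 4 * N = a ^ 2 - (p * q : ℤ) * b ^ 2 → ∃ x : 𝓞 k, 2 * x = a + b * A) := by
  have hpI : Prime (p : ℤ) := Nat.prime_iff_prime_int.mp hp
  have hqI : Prime (q : ℤ) := Nat.prime_iff_prime_int.mp hq
  have hco : IsCoprime (p : ℤ) q :=
    Nat.isCoprime_iff_coprime.mpr ((Nat.coprime_primes hp hq).mpr hpq)
  have hsf : Squarefree ((p : ℤ) * q) := by
    rw [squarefree_mul_iff]
    refine ⟨hco.isRelPrime, ?_⟩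
    exact ⟨hpI.squarefree, hqI.squarefree⟩
  have hsqZ : ¬ IsSquare ((p : ℤ) * q) := by
    rintro ⟨z, hz⟩
    have h1 : IsUnit z := hsf z ⟨1, by rw [hz, mul_one]⟩
    have h2 : IsUnit ((p : ℤ) * q) := by rw [hz]; exact h1.mul h1
    exact hpI.not_isUnit (isUnit_of_mul_isUnit_left h2)
  have hsqQ : ¬ IsSquare ((p * q : ℚ)) := by
    have : ((p * q : ℚ)) = (((p : ℤ) * q : ℤ) : ℚ) := by push_cast; rfl
    rw [this, Rat.isSquare_intCast_iff]; exact hsqZ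
  obtain ⟨hli, hK⟩ := sz_field k hdeg α (p * q : ℚ) (by rw [hα]; push_cast; rfl) hsqQ
  have hAint : IsIntegral ℤ α := by
    refine ⟨Polynomial.X ^ 2 - Polynomial.C ((p : ℤ) * q), Polynomial.monic_X_pow_sub_C _ two_ne_zero, ?_⟩
    simp [hα]
  obtain ⟨A, hA⟩ : ∃ A : 𝓞 k, algebraMap (𝓞 k) k A = α := ⟨⟨α, hAint⟩, rfl⟩
  refine ⟨A, ?_, ?_, ?_, ?_⟩
  · apply RingOfIntegers.coe_injective
    simp only [map_mul, map_natCast]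
    rw [hA, ← hα]; ring
  · intro a b h
    have := congrArg (algebraMap (𝓞 k) k) h
    simp only [map_mul, map_intCast, map_add, map_zero, hA] at this
    have := hli a b (by push_cast; simpa using this)
    exact_mod_cast this
  · intro x
    obtain ⟨r, s, h1, h2, h3⟩ := hK x
    have h2' := Algebra.coe_norm_int x
    have h3' := Algebra.coe_trace_int x
    rw [h2] at h2'
    rw [h3] at h3'
    set N := Algebra.norm ℤ x
    set a := Algebra.trace ℤ _ x
    have hs : (2 * s) ^ 2 * (p * q) = ((a ^ 2 - 4 * N : ℤ) : ℚ) := by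
      push_cast; rw [h2', h3']; ring
    have hden : (2 * s).den = 1 := by
      have hdvd : ((2 * s).den : ℤ) * (2 * s).den ∣ (p : ℤ) * q := by
        have h5 : (2 * s).num ^ 2 * ((p : ℤ) * q) = (a ^ 2 - 4 * N) * ((2 * s).den : ℤ) ^ 2 := by
          have hd0 : ((2 * s).den : ℚ) ≠ 0 := by exact_mod_cast (2 * s).den_nz
          rw [← Rat.num_div_den (2 * s), div_pow, div_mul_eq_mul_div, div_eq_iff (by positivity)] at hs
          exact_mod_cast hs
        have hc : IsCoprime (((2 * s).den : ℤ) ^ 2) ((2 * s).num ^ 2) := by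
          apply IsCoprime.pow
          rw [isCoprime_comm, Int.isCoprime_iff_nat_coprime]
          simpa using (2 * s).reduced
        rw [← sq]
        exact hc.dvd_of_dvd_mul_left ⟨a ^ 2 - 4 * N, by rw [h5]; ring⟩
      have := hsf _ hdvd
      simpa using Int.isUnit_iff_natAbs_eq.mp this
    obtain ⟨b, hb⟩ : ∃ b : ℤ, (b : ℚ) = 2 * s := ⟨(2 * s).num, Rat.coe_int_num_of_den_eq_one hden⟩
    refine ⟨a, b, N, ?_, ?_, rfl⟩
    · apply RingOfIntegers.coe_injective
      simp only [map_mul, map_intCast, map_add, map_ofNat, hA]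
      have h1' : algebraMap (𝓞 k) k x = r + s * α := h1
      rw [h1']
      have e1 : ((a : ℤ) : k) = ((2 * r : ℚ) : k) := by rw [← h3']; push_cast; rfl
      have e2 : ((b : ℤ) : k) = ((2 * s : ℚ) : k) := by rw [← hb]; push_cast; rfl
      rw [e1, e2]; push_cast; ring
    · rw [← hb] at hs
      have : b ^ 2 * (p * q : ℤ) = a ^ 2 - 4 * N := by exact_mod_cast hs
      linarith
  · intro a b N h
    have hint : IsIntegral ℤ (((a : k) + b * α) / 2) := by
      refine ⟨Polynomial.X ^ 2 - Polynomial.C a * Polynomial.X + Polynomial.C N, ?_, ?_⟩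
      · monicity!
      · have h' := congrArg (Int.cast : ℤ → k) h
        push_cast at h'
        simp only [Polynomial.eval₂_add, Polynomial.eval₂_sub, Polynomial.eval₂_mul,
          Polynomial.eval₂_pow, Polynomial.eval₂_X, Polynomial.eval₂_C]
        simp only [algebraMap_int_eq, eq_intCast]
        linear_combination (1/4 : k) * (b : k) ^ 2 * hα + (1/4 : k) * h'
    obtain ⟨x, hx⟩ : ∃ x : 𝓞 k, algebraMap (𝓞 k) k x = ((a : k) + b * α) / 2 := ⟨⟨_, hint⟩, rfl⟩
    refine ⟨x, ?_⟩
    apply RingOfIntegers.coe_injective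
    simp only [map_mul, map_intCast, map_add, map_ofNat, hA, hx]
    field_simp

lemma sz_inforder {O : Type*} [CommRing O] [IsDomain O] [CharZero O] (d : ℤ) (hd : 0 < d)
    (A : O) (hA : A * A = d)
    (ind : ∀ a b : ℤ, (a : O) + b * A = 0 → a = 0 ∧ b = 0)
    (ε : Oˣ) (hε : ∀ u : Oˣ, ∃ n : ℤ, u = ε ^ n ∨ u = -ε ^ n)
    (j : ℤ) (hj : j ≠ 0) : ε ^ j ≠ 1 := by
  intro hj1
  have hsq : ¬ IsSquare d := by
    rintro ⟨z, hz⟩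
    have : (A - z) * (A + z) = 0 := by
      have : (d : O) = z * z := by rw [hz]; push_cast; rfl
      linear_combination hA + this
    rcases mul_eq_zero.mp this with h | h
    · have := (ind (-z) 1 (by push_cast; linear_combination h)).2
      omega
    · have := (ind z 1 (by push_cast; linear_combination h)).2
      omega
  obtain ⟨x, y, hxy, hy⟩ := Pell.exists_of_not_isSquare hd hsq
  obtain ⟨x, y, hxy, hx, hy⟩ : ∃ x y : ℤ, x ^ 2 - d * y ^ 2 = 1 ∧ 0 < x ∧ 0 < y := by
    refine ⟨|x|, |y|, by simpa using hxy, ?_, abs_pos.mpr hy⟩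
    rw [abs_pos]
    rintro rfl
    have : 0 < y ^ 2 := by positivity
    nlinarith
  have hxyO : (x : O) ^ 2 - d * y ^ 2 = 1 := by exact_mod_cast congrArg (Int.cast : ℤ → O) hxy
  let u : Oˣ := ⟨x + y * A, x - y * A, by linear_combination hxyO - (y : O) ^ 2 * hA,
    by linear_combination hxyO - (y : O) ^ 2 * hA⟩
  have hpow : ∀ n : ℕ, ∃ X Y : ℤ, 0 < X ∧ 0 < Y ∧ ((u ^ (n + 1) : Oˣ) : O) = X + Y * A := by
    intro n
    induction n with
    | zero => exact ⟨x, y, hx, hy, by simp [u]⟩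
    | succ n ih =>
      obtain ⟨X, Y, hX, hY, h⟩ := ih
      refine ⟨X * x + d * Y * y, X * y + Y * x, by positivity, by positivity, ?_⟩
      rw [pow_succ, Units.val_mul, h]
      push_cast
      simp only [u]
      linear_combination (Y : O) * y * hA
  obtain ⟨i, hi⟩ := hε u
  have hu : u ^ 2 = (ε ^ i) ^ 2 := by
    rcases hi with h | h <;> rw [h]
    rw [neg_sq]
  have ht : ε ^ j.natAbs = 1 := by
    rcases Int.natAbs_eq j with h | h
    · rw [h, zpow_natCast] at hj1; exact hj1
    · rw [h, zpow_neg, inv_eq_one, zpow_natCast] at hj1; exact hj1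
  have hu1 : u ^ (2 * j.natAbs) = 1 := by
    rw [pow_mul, hu, ← pow_mul, ← zpow_natCast, ← zpow_mul, mul_comm i, zpow_mul, mul_comm 2,
      zpow_natCast, pow_mul, ht, one_pow, one_zpow]
  obtain ⟨X, Y, hX, hY, h⟩ := hpow (2 * j.natAbs - 1)
  have hjp : 0 < j.natAbs := Int.natAbs_pos.mpr hj
  rw [show 2 * j.natAbs - 1 + 1 = 2 * j.natAbs by omega, hu1] at h
  have := (ind (X - 1) Y (by push_cast; simp at h; linear_combination -h)).2
  omega

/-- Scholz: if `p ≡ q ≡ 1 mod 4` are distinct primes with `(p/q) = -1` and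
`k = ℚ(√(pq))`, then the class number of `k` is `≡ 2 mod 4` and the fundamental
unit has norm `-1`. -/
theorem scholz_case_1_mod_4_nonresidue
    (p q : ℕ) (hp : p.Prime) (hq : q.Prime) (hpq : p ≠ q)
    [Fact q.Prime]
    (hp4 : p % 4 = 1) (hq4 : q % 4 = 1)
    (hleg : legendreSym q p = -1)     -- `(p/q) = -1`
    (k : Type*) [Field k] [NumberField k]
    (hdeg : Module.finrank ℚ k = 2)
    (α : k) (hα : α ^ 2 = (p : k) * q)   -- `k = ℚ(√(pq))`
    (ε : (𝓞 k)ˣ)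
    (hε : ∀ u : (𝓞 k)ˣ, ∃ n : ℤ, u = ε ^ n ∨ u = -ε ^ n)  -- `ε` is a fundamental unit
    : NumberField.classNumber k % 4 = 2 ∧ Algebra.norm ℚ ((ε : 𝓞 k) : k) = -1 := by
  obtain ⟨A, hA, ind, L', L2⟩ := sz_ring p q hp hq hpq k hdeg α hα
  have L : ∀ x : 𝓞 k, ∃ a b N : ℤ, 2 * x = a + b * A ∧ 4 * N = a ^ 2 - (p * q : ℤ) * b ^ 2 := by
    intro x
    obtain ⟨a, b, N, h1, h2, -⟩ := L' x
    exact ⟨a, b, N, h1, h2⟩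
  have hstruct := sz_struct p q hp hq hpq hp4 hq4 A hA ind L L2
  have hA' : A * A = ((p * q : ℤ) : 𝓞 k) := by rw [hA]; push_cast; rfl
  have hd0 : (0 : ℤ) < p * q := by exact_mod_cast Nat.mul_pos hp.pos hq.pos
  have hinf := sz_inforder (p * q : ℤ) hd0 A hA' ind ε hε
  have hco : Nat.Coprime p q := (Nat.coprime_primes hp hq).mpr hpq
  have hPP := sz_PP p q hco A hA
  have hQQ := sz_PP q p hco.symm A (by rw [hA, mul_comm])
  have hPQ := sz_PQ p q hco A hA
  set P := Ideal.span {(p : 𝓞 k), A} with hPdef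
  set Q := Ideal.span {(q : 𝓞 k), A} with hQdef
  have hA0 : A ≠ 0 := by
    rintro rfl
    have := (ind 0 1 (by simp)).2
    omega
  have hp0 : (p : 𝓞 k) ≠ 0 := by exact_mod_cast hp.ne_zero
  -- norms
  have hconj : ∀ x : 𝓞 k, ∃ a : ℤ, x * (a - x) = (Algebra.norm ℤ x : ℤ) := by
    intro x
    obtain ⟨a, b, N, h1, h2, h3⟩ := L' x
    refine ⟨a, ?_⟩
    rw [h3]
    have h2' : (4 * N : 𝓞 k) = a ^ 2 - (p * q) * b ^ 2 := by
      exact_mod_cast congrArg (Int.cast : ℤ → 𝓞 k) h2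
    have h4 : (4 : 𝓞 k) ≠ 0 := OfNat.ofNat_ne_zero 4
    apply mul_left_cancel₀ h4
    rw [h2']
    have : 4 * (x * (a - x)) = (2 * x) * (2 * a - 2 * x) := by ring
    rw [this, h1]
    linear_combination -(b : 𝓞 k) ^ 2 * hA
  have hnn : ∀ n : ℤ, Algebra.norm ℤ (n : 𝓞 k) = n ^ 2 := by
    intro n
    obtain ⟨a, b, N, h1, h2, h3⟩ := L' n
    obtain ⟨e1, e2⟩ := ind (a - 2 * n) b (by push_cast; linear_combination -h1)
    rw [h3]
    subst e2
    have : a = 2 * n := by linarith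
    subst this
    linarith
  have habs : ∀ n : ℕ, Ideal.absNorm (Ideal.span {(n : 𝓞 k)}) = n ^ 2 := by
    intro n
    have := hnn n
    rw [Int.cast_natCast] at this
    rw [Ideal.absNorm_span_singleton, this, Int.natAbs_pow, Int.natAbs_natCast]
  have hnP : Ideal.absNorm P = p := by
    have := congrArg Ideal.absNorm hPP
    rw [map_mul, habs, ← sq] at this
    exact Nat.pow_left_injective two_ne_zero this
  have nonorm : ∀ (x : 𝓞 k) (n : ℕ), 0 < n → (Algebra.norm ℤ x).natAbs ≠ n ^ 2 * p := by
    intro x n hn h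
    obtain ⟨a, b, N, -, h2, h3⟩ := L' x
    rw [h3] at h
    have := sz_nonorm p q hp hq hpq hq4 hleg a b N n h2 (by
      rw [Int.abs_eq_natAbs, h]; push_cast; ring)
    omega
  have noP : ∀ (x : 𝓞 k) (n : ℕ), 0 < n → Ideal.span {x} ≠ Ideal.span {(n : 𝓞 k)} * P := by
    intro x n hn h
    have := congrArg Ideal.absNorm h
    rw [map_mul, habs, hnP, Ideal.absNorm_span_singleton] at this
    exact nonorm x n hn this
  have noQ : ∀ (x : 𝓞 k) (n : ℕ), 0 < n → Ideal.span {x} ≠ Ideal.span {(n : 𝓞 k)} * Q := by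
    intro x n hn h
    apply noP (x * A) (n * q) (Nat.mul_pos hn hq.pos)
    rw [← Ideal.span_singleton_mul_span_singleton, h, Nat.cast_mul,
      ← Ideal.span_singleton_mul_span_singleton, ← hQQ, ← hPQ]
    ring
  have hunit : ∀ u : (𝓞 k)ˣ, Algebra.norm ℤ (u : 𝓞 k) = 1 ∨ Algebra.norm ℤ (u : 𝓞 k) = -1 := by
    intro u
    exact Int.isUnit_iff.mp ((Units.isUnit u).map (Algebra.norm ℤ))
  -- the norm of ε
  have hεn : Algebra.norm ℤ (ε : 𝓞 k) = -1 := by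
    refine (hunit ε).resolve_left ?_
    intro h1
    obtain ⟨a, ha⟩ := hconj ε
    rw [h1, Int.cast_one] at ha
    have hβ : (1 + (ε : 𝓞 k)) ^ 2 = ε * ((2 + a : ℤ) : 𝓞 k) := by
      push_cast; linear_combination -ha
    have ha2 : (2 + a : ℤ) ≠ 0 := by
      intro h0
      rw [h0, Int.cast_zero, mul_zero] at hβ
      have h3 : (ε : 𝓞 k) = -1 := by
        have := pow_eq_zero_iff (two_ne_zero) |>.mp hβ
        linear_combination this
      apply hinf 2 two_ne_zero
      ext1
      rw [zpow_ofNat, Units.val_pow_eq_pow_val, h3]; simp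
    have hfin : ∀ (y : 𝓞 k) (M : ℕ), 0 < M → y ^ 2 = M →
        Ideal.span {1 + (ε : 𝓞 k)} ≠ Ideal.span {y} := by
      intro y M hM hy h
      rw [Ideal.span_singleton_eq_span_singleton] at h
      obtain ⟨u, hu⟩ := h
      have e1 : (ε : 𝓞 k) * ((2 + a : ℤ) : 𝓞 k) * u ^ 2 = ((M : ℤ) : 𝓞 k) := by
        rw [← hβ, Int.cast_natCast, ← hy, ← hu]; ring
      have e2 := congrArg (Algebra.norm ℤ) e1
      rw [map_mul, map_mul, map_pow, hnn, hnn, h1, one_mul] at e2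
      have e3 : (Algebra.norm ℤ (u : 𝓞 k)) ^ 2 = 1 := by
        rcases hunit u with h | h <;> rw [h] <;> norm_num
      rw [e3, mul_one] at e2
      have hM0 : ((M : ℤ) : 𝓞 k) ≠ 0 := by exact_mod_cast hM.ne'
      have e4 : (ε ^ 2 * u ^ 4 : (𝓞 k)ˣ) = 1 := by
        ext1
        push_cast
        have e5 : ((2 + a : ℤ) : 𝓞 k) ^ 2 = ((M : ℤ) : 𝓞 k) ^ 2 := by
          exact_mod_cast congrArg (Int.cast : ℤ → 𝓞 k) e2
        apply mul_left_cancel₀ (pow_ne_zero 2 hM0)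
        nth_rw 1 [← e5]
        rw [mul_one]
        rw [← e1]
        ring
      obtain ⟨j, hj⟩ := hε u
      have hu4 : u ^ 4 = ε ^ (4 * j) := by
        rcases hj with h | h <;> rw [h]
        · rw [mul_comm, zpow_mul]; norm_cast
        · rw [Even.neg_pow (by decide), mul_comm, zpow_mul]; norm_cast
      apply hinf (2 + 4 * j) (by omega)
      rw [zpow_add, ← hu4, ← e4]; norm_cast
    obtain ⟨n, hn, h | h | h | h⟩ := hstruct (2 + a).natAbs (Int.natAbs_pos.mpr ha2)
      (Ideal.span {1 + (ε : 𝓞 k)}) (by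
        rw [Ideal.span_singleton_pow, hβ, Ideal.span_singleton_eq_span_singleton]
        have t1 : Associated ((ε : 𝓞 k) * ((2 + a : ℤ) : 𝓞 k)) ((2 + a : ℤ) : 𝓞 k) :=
          associated_unit_mul_left _ _ ε.isUnit
        refine t1.trans ?_
        have t2 := Int.associated_natAbs (2 + a)
        have := t2.map (Int.castRingHom (𝓞 k))
        simpa using this)
    · exact hfin n (n ^ 2) (by positivity) (by push_cast; rfl) h
    · exact noP _ n hn h
    · exact noQ _ n hn h
    · rw [Ideal.span_singleton_mul_span_singleton] at h
      exact hfin _ (n ^ 2 * (p * q)) (Nat.mul_pos (by positivity) (Nat.mul_pos hp.pos hq.pos))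
        (by push_cast; rw [mul_pow, sq A, hA]) h
  refine ⟨?_, ?_⟩
  swap
  · have := Algebra.coe_norm_int (ε : 𝓞 k)
    rw [hεn] at this
    rw [← this]; norm_num
  -- class group
  have hPmem : P ∈ nonZeroDivisors (Ideal (𝓞 k)) := by
    rw [mem_nonZeroDivisors_iff_ne_zero]
    intro h
    rw [h, Ideal.zero_eq_bot, Ideal.absNorm_bot] at hnP
    exact hp.ne_zero hnP.symm
  have hcc : ClassGroup.mk0 ⟨P, hPmem⟩ ^ 2 = 1 := by
    rw [← map_pow, SubmonoidClass.mk_pow, ClassGroup.mk0_eq_one_iff, sq, hPP]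
    exact ⟨_, rfl⟩
  rw [NumberField.classNumber, ← Nat.card_eq_fintype_card]
  refine sz_group _ (ClassGroup.mk0 ⟨P, hPmem⟩) ?_ hcc ?_ ?_
  · rw [Ne, ClassGroup.mk0_eq_one_iff]
    rintro ⟨x, hx⟩
    exact noP x 1 one_pos (by simpa using hx.symm)
  · intro c hc
    obtain ⟨⟨I, hI⟩, rfl⟩ := ClassGroup.mk0_surjective c
    rw [← map_pow, SubmonoidClass.mk_pow, ClassGroup.mk0_eq_one_iff] at hc
    obtain ⟨γ, hγ⟩ := hc
    replace hγ : I ^ 2 = Ideal.span {γ} := hγ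
    have hI0 : I ≠ 0 := mem_nonZeroDivisors_iff_ne_zero.mp hI
    obtain ⟨n, hn⟩ : ∃ n, n = Ideal.absNorm I := ⟨_, rfl⟩
    have hn0 : 0 < n := by
      rw [hn]; exact Nat.pos_of_ne_zero (fun h => hI0 (Ideal.absNorm_eq_zero_iff.mp h))
    have hnγ : (Algebra.norm ℤ γ).natAbs = n ^ 2 := by
      rw [← Ideal.absNorm_span_singleton, ← hγ, map_pow, hn]
    obtain ⟨γ, hγ, hnγ⟩ : ∃ γ : 𝓞 k, I ^ 2 = Ideal.span {γ} ∧ Algebra.norm ℤ γ = n ^ 2 := by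
      rcases Int.natAbs_eq (Algebra.norm ℤ γ) with h | h
      · exact ⟨γ, hγ, by rw [h, hnγ]; push_cast; rfl⟩
      · refine ⟨γ * ε, ?_, ?_⟩
        · rw [hγ, Ideal.span_singleton_eq_span_singleton]
          exact ⟨ε, rfl⟩
        · rw [map_mul, hεn, h, hnγ]; push_cast; ring
    obtain ⟨a, ha⟩ := hconj γ
    rw [hnγ] at ha
    push_cast at ha
    have hnO : (n : 𝓞 k) ≠ 0 := by exact_mod_cast hn0.ne'
    have hγ0 : γ ≠ 0 := by
      rintro rfl
      rw [zero_mul] at ha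
      exact pow_ne_zero 2 hnO ha.symm
    have key : ∃ (y : 𝓞 k) (m : ℕ), y ≠ 0 ∧ 0 < m ∧
        (Ideal.span {y} * I) ^ 2 = Ideal.span {(m : 𝓞 k)} := by
      have hb : ((a : 𝓞 k) - γ + n) ^ 2 * γ = ((n ^ 2 * (a + 2 * n) : ℤ) : 𝓞 k) := by
        push_cast
        linear_combination ((a : 𝓞 k) - γ + 2 * n) * ha
      by_cases hy : (a : 𝓞 k) - γ + n = 0
      · refine ⟨1, n, one_ne_zero, hn0, ?_⟩
        have : γ = -n := by
          apply mul_left_cancel₀ hnO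
          linear_combination -ha + γ * hy
        rw [Ideal.span_singleton_one, Ideal.top_mul, hγ, this, Ideal.span_singleton_neg]
      · refine ⟨_, (n ^ 2 * (a + 2 * n) : ℤ).natAbs, hy, ?_, ?_⟩
        · rw [Int.natAbs_pos]
          intro h0
          rw [h0, Int.cast_zero] at hb
          exact mul_ne_zero (pow_ne_zero 2 hy) hγ0 hb
        · rw [mul_pow, hγ, Ideal.span_singleton_pow, Ideal.span_singleton_mul_span_singleton, hb,
            Ideal.span_singleton_eq_span_singleton]
          have t2 := Int.associated_natAbs (n ^ 2 * (a + 2 * n))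
          have := t2.map (Int.castRingHom (𝓞 k))
          simpa only [eq_intCast, Int.cast_natCast] using this
    obtain ⟨y, m, hy, hm, hJ⟩ := key
    have fin1 : ∀ z : 𝓞 k, z ≠ 0 → Ideal.span {y} * I = Ideal.span {z} →
        ClassGroup.mk0 ⟨I, hI⟩ = 1 := by
      intro z hz h
      rw [← map_one ClassGroup.mk0, ClassGroup.mk0_eq_mk0_iff]
      exact ⟨y, z, hy, hz, by simpa using h⟩
    have fin2 : ∀ x z : 𝓞 k, x ≠ 0 → z ≠ 0 → Ideal.span {x} * I = Ideal.span {z} * P →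
        ClassGroup.mk0 ⟨I, hI⟩ = ClassGroup.mk0 ⟨P, hPmem⟩ := by
      intro x z hx hz h
      rw [ClassGroup.mk0_eq_mk0_iff]
      exact ⟨x, z, hx, hz, h⟩
    obtain ⟨r, hr, h | h | h | h⟩ := hstruct m hm _ hJ
    · exact Or.inl (fin1 r (by exact_mod_cast hr.ne') h)
    · exact Or.inr (fin2 y r hy (by exact_mod_cast hr.ne') h)
    · refine Or.inr (fin2 (p * y) (r * A) (mul_ne_zero hp0 hy)
        (mul_ne_zero (by exact_mod_cast hr.ne') hA0) ?_)
      rw [← Ideal.span_singleton_mul_span_singleton, mul_assoc, h, ← hPP,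
        ← Ideal.span_singleton_mul_span_singleton, ← hPQ]
      ring
    · rw [Ideal.span_singleton_mul_span_singleton] at h
      exact Or.inl (fin1 _ (mul_ne_zero (by exact_mod_cast hr.ne') hA0) h)
  · intro c hc
    obtain ⟨⟨I, hI⟩, rfl⟩ := ClassGroup.mk0_surjective c
    have h1 : ClassGroup.mk0 (⟨I, hI⟩ ^ 2 * ⟨P, hPmem⟩) = 1 := by
      rw [map_mul, map_pow, hc, ← sq, hcc]
    rw [SubmonoidClass.mk_pow, MulMemClass.mk_mul_mk, ClassGroup.mk0_eq_one_iff] at h1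
    obtain ⟨γ, hγ⟩ := h1
    replace hγ : I ^ 2 * P = Ideal.span {γ} := hγ
    have hI0 : I ≠ 0 := mem_nonZeroDivisors_iff_ne_zero.mp hI
    have := congrArg Ideal.absNorm hγ
    rw [map_mul, map_pow, hnP, Ideal.absNorm_span_singleton] at this
    exact nonorm γ _ (Nat.pos_of_ne_zero (fun h => hI0 (Ideal.absNorm_eq_zero_iff.mp h))) this.symm
end

section
/- Let p and q be distinct primes with p ≡ q ≡ 1 (mod 4) and Legendre symbol (p/q) = +1 (equivalently (q/p) = +1, so q splits in ℚ(√p) and p splits in ℚ(√q)). Let ε_p and ε_q be the fundamental units of ℚ(√p) and ℚ(√q). Then for any prime ideal 𝔮 of ℚ(√p) above q and any prime ideal 𝔭 of ℚ(√q) above p, the quadratic residue symbols satisfy [ε_p/𝔮] = [ε_q/𝔭]; in particular these symbols do not depend on the choice of the prime ideal above q resp. p, and one may write (ε_p/q) = (ε_q/p) (the Schönemann–Scholz reciprocity law). -/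
open NumberField
open scoped Classical

/-- The quadratic residue symbol `[α/𝔭] ∈ {±1}`, determined by Euler's congruence
`[α/𝔭] ≡ α^((N𝔭 - 1)/2) (mod 𝔭)`. -/
noncomputable def quadResSym (F : Type*) [Field F] [NumberField F]
    (𝔭 : Ideal (𝓞 F)) (α : 𝓞 F) : ℤ :=
  if α ^ ((Ideal.absNorm 𝔭 - 1) / 2) - 1 ∈ 𝔭 then 1 else -1

theorem jac_aux (Q : ℕ) (x y : ℤ) (hQ : Q % 4 = 1) (h : (Q : ℤ) = x ^ 2 + y ^ 2) (hx : Odd x)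
    (hc : IsCoprime x (Q : ℤ)) : jacobiSym x Q = 1 := by
  have hQo : Odd Q := Nat.odd_iff.mpr (by omega)
  have h1 : jacobiSym (-1) Q = 1 := by
    rw [jacobiSym.at_neg_one hQo]; exact ZMod.χ₄_nat_one_mod_four hQ
  have h2 : jacobiSym x Q = jacobiSym (x.natAbs : ℤ) Q := by
    rcases Int.natAbs_eq x with h' | h'
    · rw [← h']
    · conv_lhs => rw [h', neg_eq_neg_one_mul, jacobiSym.mul_left, h1, one_mul]
  have hxo : Odd x.natAbs := Int.natAbs_odd.mpr hx
  rw [h2, jacobiSym.quadratic_reciprocity_one_mod_four' hxo hQ]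
  have h3 : jacobiSym (Q : ℤ) x.natAbs = jacobiSym (y ^ 2) x.natAbs := by
    apply jacobiSym.mod_left'
    rw [h]
    apply Int.ModEq.symm
    rw [Int.modEq_iff_dvd]
    simp
  rw [h3]
  apply jacobiSym.sq_one'
  rw [show y.gcd (x.natAbs : ℤ) = y.gcd x by simp only [Int.gcd, Int.natAbs_natCast], ← Int.isCoprime_iff_gcd_eq_one]
  rw [h] at hc
  have : IsCoprime x (y ^ 2) := by
    have := hc.add_mul_left_right (-x)
    rwa [show x ^ 2 + y ^ 2 + x * -x = y ^ 2 by ring] at this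
  exact ((IsCoprime.pow_right_iff two_pos).mp this).symm

theorem pell_neg (p : ℕ) (hp : p.Prime) (hp4 : p % 4 = 1) :
    ∃ t u : ℤ, t ^ 2 + 1 = p * u ^ 2 := by
  have hpi : Prime (p : ℤ) := Nat.prime_iff_prime_int.mp hp
  obtain ⟨f, hf1, hf2, hf3⟩ := Pell.IsFundamental.exists_of_not_isSquare (d := (p : ℤ))
    (by exact_mod_cast hp.pos) hpi.not_isSquare
  have hprop := f.prop
  set x := f.x
  set y := f.y
  have hpm : (p : ℤ) % 4 = 1 := by omega
  obtain ⟨k, hk⟩ : ∃ k : ℤ, (p : ℤ) = 4 * k + 1 := ⟨p / 4, by omega⟩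
  obtain ⟨w, hw⟩ : ∃ w, y = 2 * w := by
    rcases Int.even_or_odd' y with ⟨w, h | h⟩
    · exact ⟨w, h⟩
    · exfalso
      rcases Int.even_or_odd' x with ⟨g, h' | h'⟩
      · rw [h, h', hk] at hprop
        have : 4 * (g ^ 2 - k * (2 * w + 1) ^ 2 - w ^ 2 - w) = 2 := by linear_combination hprop
        omega
      · rw [h, h', hk] at hprop
        have : 4 * (g ^ 2 + g - k * (2 * w + 1) ^ 2 - w ^ 2 - w) = 1 := by linear_combination hprop
        omega
  obtain ⟨g, hg⟩ : ∃ g, x = 2 * g + 1 := by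
    rcases Int.even_or_odd' x with ⟨g, h' | h'⟩
    · exfalso
      rw [hw, h'] at hprop
      have : 4 * (g ^ 2 - p * w ^ 2) = 1 := by linear_combination hprop
      omega
    · exact ⟨g, h'⟩
  have hgw : g * (g + 1) = p * w ^ 2 := by
    rw [hw, hg] at hprop
    have : 4 * (g * (g + 1)) = 4 * (p * w ^ 2) := by linear_combination hprop
    omega
  have hg0 : 0 < g := by omega
  have hp0 : (0 : ℤ) < p := by exact_mod_cast hp.pos
  have hcop : IsCoprime g (g + 1) := ⟨-1, 1, by ring⟩
  rcases hpi.dvd_or_dvd (Dvd.intro _ hgw.symm) with ⟨h, hh⟩ | ⟨h, hh⟩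
  · exfalso
    have hh0 : 0 < h := by
      by_contra hcon; push Not at hcon; nlinarith
    have e : h * (g + 1) = w ^ 2 := by
      apply mul_left_cancel₀ hp0.ne'; rw [← hgw]; linear_combination -(g + 1) * hh
    have hc : IsCoprime h (g + 1) := hcop.of_isCoprime_of_dvd_left ⟨p, by rw [hh]; ring⟩
    obtain ⟨r, hr⟩ := Int.sq_of_isCoprime hc e
    obtain ⟨s, hs⟩ := Int.sq_of_isCoprime hc.symm (by rw [mul_comm]; exact e)
    have hr' : h = r ^ 2 := by rcases hr with hr | hr; exact hr; nlinarith [sq_nonneg r]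
    have hs' : g + 1 = s ^ 2 := by rcases hs with hs | hs; exact hs; nlinarith [sq_nonneg s]
    have hab : |s| ^ 2 = g + 1 := by rw [sq_abs, hs']
    have hs1 : 1 < |s| := by
      by_contra hcon; push Not at hcon; nlinarith [abs_nonneg s]
    have := hf3 (b := Pell.Solution₁.mk |s| r (by rw [hab, hh, hr']; ring)) (by simpa using hs1)
    simp only [Pell.Solution₁.x_mk] at this
    change x ≤ |s| at this
    nlinarith
  · have hh0 : 0 < h := by
      by_contra hcon; push Not at hcon; nlinarith
    have e : g * h = w ^ 2 := by
      apply mul_left_cancel₀ hp0.ne'; rw [← hgw]; linear_combination -g * hh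
    have hc : IsCoprime g h := hcop.of_isCoprime_of_dvd_right ⟨p, by rw [hh]; ring⟩
    obtain ⟨s, hs⟩ := Int.sq_of_isCoprime hc e
    obtain ⟨r, hr⟩ := Int.sq_of_isCoprime hc.symm (by rw [mul_comm]; exact e)
    have hr' : h = r ^ 2 := by rcases hr with hr | hr; exact hr; nlinarith [sq_nonneg r]
    have hs' : g = s ^ 2 := by rcases hs with hs | hs; exact hs; nlinarith [sq_nonneg s]
    exact ⟨s, r, by rw [← hs', ← hr', hh]⟩

theorem param (p : ℕ) (hp : p.Prime) (hp4 : p % 4 = 1) (t u : ℤ) (h : t ^ 2 + 1 = p * u ^ 2) :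
    ∃ a b m n : ℤ, Odd a ∧ (p : ℤ) = a ^ 2 + b ^ 2 ∧
      a * (m ^ 2 - n ^ 2) + b * (2 * m * n) = 1 ∧
      a * (2 * m * n) - b * (m ^ 2 - n ^ 2) = t ∧
      (u = m ^ 2 + n ^ 2 ∨ u = -(m ^ 2 + n ^ 2)) := by
  have hpi : Prime (p : ℤ) := Nat.prime_iff_prime_int.mp hp
  have := Fact.mk hp
  obtain ⟨k, hk⟩ : ∃ k : ℤ, (p : ℤ) = 4 * k + 1 := ⟨p / 4, by omega⟩
  have hp0 : (p : ℤ) ≠ 0 := hpi.ne_zero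
  -- representation with `a` odd
  obtain ⟨a, b, ha, hb, hab⟩ : ∃ a b : ℤ, Odd a ∧ Even b ∧ (p : ℤ) = a ^ 2 + b ^ 2 := by
    obtain ⟨a, b, hab⟩ := Nat.Prime.sq_add_sq (p := p) (by omega)
    have hab' : (p : ℤ) = (a : ℤ) ^ 2 + (b : ℤ) ^ 2 := by exact_mod_cast hab.symm
    have hodd : Odd ((a : ℤ) ^ 2 + (b : ℤ) ^ 2) := by
      rw [← hab', hk]; exact ⟨2 * k, by ring⟩
    rcases Int.even_or_odd (a : ℤ) with h1 | h1
    · refine ⟨b, a, ?_, h1, by rw [hab']; ring⟩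
      rcases Int.even_or_odd (b : ℤ) with h2 | h2
      · exact absurd ((h1.pow_of_ne_zero two_ne_zero).add (h2.pow_of_ne_zero two_ne_zero)) (Int.not_even_iff_odd.mpr hodd)
      · exact h2
    · refine ⟨a, b, h1, ?_, hab'⟩
      rcases Int.even_or_odd (b : ℤ) with h2 | h2
      · exact h2
      · exact absurd (h1.pow.add_odd h2.pow) (Int.not_even_iff_odd.mpr hodd)
  have hte : Even t := by
    rcases Int.even_or_odd' t with ⟨s, h1 | h1⟩
    · exact ⟨s, by omega⟩
    · exfalso
      rw [h1, hk] at h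
      rcases Int.even_or_odd' u with ⟨v, h2 | h2⟩
      · rw [h2] at h
        have : 4 * (s ^ 2 + s - (4 * k + 1) * v ^ 2) = -2 := by linear_combination h
        omega
      · rw [h2] at h
        have : 4 * (s ^ 2 + s - (4 * k + 1) * (v ^ 2 + v) - k) = -1 := by linear_combination h
        omega
  -- fix sign of b
  obtain ⟨b, hb, hab, B, hB⟩ : ∃ b : ℤ, Even b ∧ (p : ℤ) = a ^ 2 + b ^ 2 ∧ (p : ℤ) ∣ a - t * b := by
    have : (p : ℤ) ∣ (a - t * b) * (a - t * (-b)) :=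
      ⟨1 - b ^ 2 * u ^ 2, by linear_combination (-b ^ 2) * h - hab⟩
    rcases hpi.dvd_or_dvd this with h1 | h1
    · exact ⟨b, hb, hab, h1⟩
    · exact ⟨-b, hb.neg, by rw [hab]; ring, h1⟩
  obtain ⟨A, hA⟩ : (p : ℤ) ∣ t * a + b := by
    apply hpi.dvd_of_dvd_pow (n := 2)
    refine ⟨p * u ^ 2 - p * B ^ 2, ?_⟩
    linear_combination (-(a - t * b) - p * B) * hB + p * h - (t ^ 2 + 1) * hab
  have h1 : a * B + b * A = 1 := by
    apply mul_left_cancel₀ hp0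
    linear_combination -a * hB - b * hA - hab
  have h2 : a * A - b * B = t := by
    apply mul_left_cancel₀ hp0
    linear_combination -a * hA + b * hB - t * hab
  have h3 : A * A + B * B = u * u := by
    apply mul_left_cancel₀ hp0
    have : (p : ℤ) * (u * u) = (a * A - b * B) ^ 2 + (a * B + b * A) ^ 2 := by
      rw [h1, h2]; linear_combination -h
    rw [this, hab]; ring
  have hcop : Int.gcd A B = 1 := Int.isCoprime_iff_gcd_eq_one.mp ⟨b, a, by linarith⟩
  obtain ⟨m, n, hmn, hu, -, -⟩ := PythagoreanTriple.coprime_classification.mp ⟨h3, hcop⟩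
  rcases hmn with ⟨hA', hB'⟩ | ⟨hA', hB'⟩
  · exfalso
    have hBe : Even B := ⟨m * n, by rw [hB']; ring⟩
    have : Odd (1 : ℤ) := odd_one
    rw [← h1] at this
    have h4 : Even (a * B + b * A) := (hBe.mul_left a).add (hb.mul_right A)
    exact (Int.not_even_iff_odd.mpr this) h4
  · exact ⟨a, b, m, n, ha, hab, by rw [← hA', ← hB']; exact h1, by rw [← hA', ← hB']; exact h2, hu⟩

/-- field identity -/
theorem field_sq {F : Type*} [Field F] (h2 : (2 : F) ≠ 0) (a b c d m n s i : F)
    (hi : i ^ 2 = -1) (hic : i * c = d) (hs : s ^ 2 = a ^ 2 + b ^ 2) :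
    IsSquare ((a * c + b * d) * c *
      (a * (2 * m * n) - b * (m ^ 2 - n ^ 2) + (m ^ 2 + n ^ 2) * s)) := by
  obtain ⟨U, hU⟩ : ∃ U, U = a * m + b * n + n * s := ⟨_, rfl⟩
  obtain ⟨V, hV⟩ : ∃ V, V = b * m - a * n - m * s := ⟨_, rfl⟩
  obtain ⟨e, he⟩ : ∃ e, e = a * (2 * m * n) - b * (m ^ 2 - n ^ 2) + (m ^ 2 + n ^ 2) * s := ⟨_, rfl⟩
  have e1 : -(U * V) = a * e := by
    rw [hU, hV, he]; linear_combination (m * n) * hs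
  have e2 : U ^ 2 - V ^ 2 = 2 * b * e := by
    rw [hU, hV, he]; linear_combination (n ^ 2 - m ^ 2) * hs
  rw [← he]
  refine ⟨(1 + i) * c * (U + i * V) / 2, ?_⟩
  rw [← hic]
  field_simp
  have key : ((1 + i) * (U + i * V)) ^ 2 = 4 * ((a + b * i) * e) := by
    linear_combination (U^2 - V^2 + 2*i*U*V + V^2*(i^2+1) + 2*i*V^2 + 4*U*V) * hi
      + 4 * e1 + 2 * i * e2
  linear_combination (-c^2) * key

theorem isSquare_mul_iff {F : Type*} [Field F] {x y : F} (hx : x ≠ 0) (hxs : IsSquare x) :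
    IsSquare (x * y) ↔ IsSquare y := by
  constructor
  · intro h
    have := h.div hxs
    rwa [mul_div_cancel_left₀ _ hx] at this
  · exact fun h => hxs.mul h

theorem isSquare_iff_of_mul {F : Type*} [Field F] {x y : F} (hx : x ≠ 0) (hy : y ≠ 0)
    (h : IsSquare (x * y)) : IsSquare x ↔ IsSquare y := by
  constructor
  · exact fun h' => (isSquare_mul_iff hx h').mp h
  · exact fun h' => (isSquare_mul_iff hy h').mp (by rwa [mul_comm])

/-- the local computation -/
theorem loc (q : ℕ) [Fact q.Prime] (hq4 : q % 4 = 1) (a b c d m n : ℤ) (s : ZMod q)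
    (hq : (q : ℤ) = c ^ 2 + d ^ 2) (hc : Odd c)
    (hs : s ^ 2 = (a : ZMod q) ^ 2 + (b : ZMod q) ^ 2)
    (hp : (a : ZMod q) ^ 2 + (b : ZMod q) ^ 2 ≠ 0)
    (e : ZMod q) (he : e = a * (2 * m * n) - b * (m ^ 2 - n ^ 2) + (m ^ 2 + n ^ 2) * s)
    (he0 : e ≠ 0) :
    (a * c + b * d : ZMod q) ≠ 0 ∧
    (IsSquare e ↔ legendreSym q (a * c + b * d) = 1) := by
  have hqp : q.Prime := Fact.out
  have hqi : Prime (q : ℤ) := Nat.prime_iff_prime_int.mp hqp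
  have hq5 : 2 < q := by have := hqp.two_le; omega
  have h2 : (2 : ZMod q) ≠ 0 := by
    have : ((2 : ℕ) : ZMod q) ≠ 0 := by
      rw [Ne, ZMod.natCast_eq_zero_iff]
      exact fun h => absurd (Nat.le_of_dvd two_pos h) (by omega)
    exact_mod_cast this
  have hqF : (c : ZMod q) ^ 2 + (d : ZMod q) ^ 2 = 0 := by
    have : (((q : ℤ)) : ZMod q) = 0 := by simp
    rw [hq] at this
    exact_mod_cast this
  have hndvd : ¬ (q : ℤ) ∣ c := by
    rintro ⟨k, hk⟩
    have hc0 : c ≠ 0 := by rintro rfl; simp at hc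
    have hk0 : k ≠ 0 := by rintro rfl; simp at hk; exact hc0 hk
    have hk1 : 1 ≤ k ^ 2 := by have := sq_pos_of_ne_zero hk0; omega
    have : (q : ℤ) ^ 2 * k ^ 2 ≤ q := by
      conv_rhs => rw [hq, hk]
      nlinarith [sq_nonneg d]
    have hq5' : (2 : ℤ) < q := by exact_mod_cast hq5
    nlinarith
  have hc0 : (c : ZMod q) ≠ 0 := by
    rwa [Ne, ZMod.intCast_zmod_eq_zero_iff_dvd]
  have hcs : IsSquare (c : ZMod q) := by
    rw [← legendreSym.eq_one_iff q hc0, jacobiSym.legendreSym.to_jacobiSym]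
    exact jac_aux q c d hq4 hq hc ((hqi.coprime_iff_not_dvd.mpr hndvd).symm)
  have hN : (a * c + b * d : ZMod q) ≠ 0 := by
    intro h
    have : (c : ZMod q) ^ 2 * ((a : ZMod q) ^ 2 + (b : ZMod q) ^ 2) = 0 := by
      linear_combination (a * c - b * d : ZMod q) * h + (b : ZMod q) ^ 2 * hqF
    exact (mul_ne_zero (pow_ne_zero 2 hc0) hp) this
  refine ⟨hN, ?_⟩
  rw [legendreSym.eq_one_iff q (by push_cast; exact hN)]
  push_cast
  have := field_sq h2 (a : ZMod q) b c d m n s (d / c)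
    (by field_simp; linear_combination hqF) (by field_simp) hs
  rw [← he] at this
  have h3 : IsSquare ((c : ZMod q) * (((a * c + b * d : ZMod q)) * e)) := by
    convert this using 1; ring
  rw [isSquare_mul_iff hc0 hcs] at h3
  exact (isSquare_iff_of_mul hN he0 h3).symm

section fieldpart
variable {K : Type*} [Field K] [NumberField K]

theorem indep_aux (p : ℕ) (hp : p.Prime) (α : K) (hα : α ^ 2 = (p : K)) (r s : ℚ)
    (h : (r : K) + (s : K) * α = 0) : r = 0 ∧ s = 0 := by
  have hs : s = 0 := by
    by_contra hs
    have hsK : (s : K) ≠ 0 := by exact_mod_cast hs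
    have h1 : ((r ^ 2 : ℚ) : K) = ((s ^ 2 * p : ℚ) : K) := by
      push_cast; rw [← hα]; linear_combination ((r : K) - s * α) * h
    have h2 : r ^ 2 = s ^ 2 * p := by exact_mod_cast h1
    have h3 : IsSquare ((p : ℤ) : ℚ) := ⟨r / s, by push_cast; field_simp; linarith⟩
    rw [Rat.isSquare_intCast_iff] at h3
    exact (Nat.prime_iff_prime_int.mp hp).not_isSquare h3
  subst hs
  simpa using h

theorem rep_aux (p : ℕ) (hp : p.Prime) (hdeg : Module.finrank ℚ K = 2) (α : K)
    (hα : α ^ 2 = (p : K)) (x : 𝓞 K) :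
    ∃ v w : ℤ, 2 * (p : K) * (x : K) = v + w * α := by
  have hli : LinearIndependent ℚ ![(1 : K), α] := by
    rw [LinearIndependent.pair_iff]
    intro s t hst
    apply indep_aux p hp α hα
    simpa [Algebra.smul_def] using hst
  let b := basisOfLinearIndependentOfCardEqFinrank hli (by simp [hdeg])
  have hb0 : b 0 = 1 := by simp [b]
  have hb1 : b 1 = α := by simp [b]
  have htr : Algebra.trace ℚ K α = 0 := by
    rw [Algebra.trace_eq_matrix_trace b, Matrix.trace_fin_two, Algebra.leftMulMatrix_eq_repr_mul,
      Algebra.leftMulMatrix_eq_repr_mul, hb0, hb1, mul_one, ← hb1, b.repr_self, hb1, ← sq, hα]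
    have : (p : K) = (p : ℚ) • b 0 := by rw [hb0, Algebra.smul_def]; simp
    rw [this, map_smul, b.repr_self]
    simp
  have htr1 : ∀ r : ℚ, Algebra.trace ℚ K (r : K) = 2 * r := by
    intro r
    have := Algebra.trace_algebraMap (S := K) r
    rw [hdeg] at this
    simpa using this
  have hsum := b.sum_repr (x : K)
  rw [Fin.sum_univ_two, hb0, hb1] at hsum
  set r := b.repr (x : K) 0
  set s := b.repr (x : K) 1
  have hx : (x : K) = (r : K) + (s : K) * α := by
    rw [← hsum]; simp [Algebra.smul_def]
  have htra : ∀ r s : ℚ, Algebra.trace ℚ K ((r : K) + (s : K) * α) = 2 * r := by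
    intro r s
    have : (s : K) * α = s • α := by simp [Algebra.smul_def]
    rw [map_add, htr1, this, map_smul, htr]; simp
  have hαi : IsIntegral ℤ α := by
    refine IsIntegral.of_pow two_pos ?_
    rw [hα]
    simpa using isIntegral_algebraMap (R := ℤ) (A := K) (x := (p : ℤ))
  have i1 : IsIntegral ℤ (Algebra.trace ℚ K (x : K)) := Algebra.isIntegral_trace x.isIntegral_coe
  have i2 : IsIntegral ℤ (Algebra.trace ℚ K (α * (x : K))) :=
    Algebra.isIntegral_trace (hαi.mul x.isIntegral_coe)
  obtain ⟨v, hv⟩ := IsIntegrallyClosed.isIntegral_iff.mp i1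
  obtain ⟨w, hw⟩ := IsIntegrallyClosed.isIntegral_iff.mp i2
  rw [hx, htra] at hv
  have : α * (x : K) = ((s * p : ℚ) : K) + (r : K) * α := by
    rw [hx]; push_cast; rw [← hα]; ring
  rw [this, htra] at hw
  have hv' : (v : K) = 2 * (r : K) := by
    have := congrArg (fun z : ℚ => (z : K)) hv
    simpa using this
  have hw' : (w : K) = 2 * ((s : K) * p) := by
    have := congrArg (fun z : ℚ => (z : K)) hw
    simpa using this
  refine ⟨p * v, w, ?_⟩
  push_cast
  rw [hv', hw', hx]; ring

theorem hom_aux (p q : ℕ) [Fact q.Prime] (hp : p.Prime) (hpq : p ≠ q) (hq2 : 2 < q)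
    (hsq : IsSquare (p : ZMod q))
    (hdeg : Module.finrank ℚ K = 2) (A : 𝓞 K)
    (hA : A ^ 2 = (p : 𝓞 K)) (𝔮 : Ideal (𝓞 K)) (h𝔮 : 𝔮.IsPrime) (h𝔮q : (q : 𝓞 K) ∈ 𝔮) :
    Ideal.absNorm 𝔮 = q ∧ ∃ φ : 𝓞 K →+* ZMod q, ∀ x, φ x = 0 ↔ x ∈ 𝔮 := by
  have hqp : q.Prime := Fact.out
  let R := 𝓞 K ⧸ 𝔮
  have hq0 : ((q : ℕ) : R) = 0 := by
    have := Ideal.Quotient.eq_zero_iff_mem.mpr h𝔮q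
    simpa using this
  have hchar : CharP R q := ringChar.of_eq (CharP.ringChar_of_prime_eq_zero hqp hq0)
  let f : ZMod q →+* R := ZMod.castHom dvd_rfl R
  have hinj : Function.Injective f := f.injective
  have hAr : ∃ z : ZMod q, f z = Ideal.Quotient.mk 𝔮 A := by
    obtain ⟨m, hm⟩ := hsq
    have : (Ideal.Quotient.mk 𝔮 A - f m) * (Ideal.Quotient.mk 𝔮 A + f m) = 0 := by
      have h1 : f m * f m = (p : R) := by rw [← map_mul, ← hm, map_natCast]
      have h2 : Ideal.Quotient.mk 𝔮 A ^ 2 = (p : R) := by rw [← map_pow, hA, map_natCast]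
      linear_combination h2 - h1
    rcases mul_eq_zero.mp this with h | h
    · exact ⟨m, (sub_eq_zero.mp h).symm⟩
    · exact ⟨-m, by rw [map_neg]; linear_combination -h⟩
  have hDq : ((2 * p : ℕ) : ZMod q) ≠ 0 := by
    rw [Ne, ZMod.natCast_eq_zero_iff, hqp.dvd_mul]
    rintro (h | h)
    · exact absurd (Nat.le_of_dvd two_pos h) (by omega)
    · exact hpq ((Nat.prime_dvd_prime_iff_eq hqp hp).mp h).symm
  have hsurj : Function.Surjective f := by
    intro y
    obtain ⟨x, rfl⟩ := Ideal.Quotient.mk_surjective y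
    obtain ⟨v, w, hvw⟩ := rep_aux p hp hdeg (A : K) (by
      rw [← map_pow, hA, map_natCast]) x
    have h1 : ((2 * p : ℕ) : 𝓞 K) * x = v + w * A := by
      apply FaithfulSMul.algebraMap_injective (𝓞 K) K
      rw [map_mul, map_add, map_mul, map_natCast, map_intCast, map_intCast, ← hvw]
      push_cast; ring
    obtain ⟨z, hz⟩ := hAr
    refine ⟨((2 * p : ℕ) : ZMod q)⁻¹ * (v + w * z), ?_⟩
    have h2 := congrArg (Ideal.Quotient.mk 𝔮) h1
    rw [map_mul, map_add, map_mul, map_natCast, map_intCast, map_intCast, ← hz] at h2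
    rw [map_mul, map_add, map_mul, map_intCast, map_intCast]
    change _ = (Ideal.Quotient.mk 𝔮) x
    rw [← h2, ← mul_assoc, ← map_natCast f, ← map_mul, inv_mul_cancel₀ hDq, map_one, one_mul]
  let e := RingEquiv.ofBijective f ⟨hinj, hsurj⟩
  refine ⟨?_, (e.symm : R →+* ZMod q).comp (Ideal.Quotient.mk 𝔮), fun x => ?_⟩
  · rw [Ideal.absNorm_apply, Submodule.cardQuot_apply]
    have := Nat.card_congr e.toEquiv
    rw [Nat.card_zmod] at this
    exact this.symm
  · rw [← Ideal.Quotient.eq_zero_iff_mem]; simp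

theorem odd_aux (p : ℕ) (hp : p.Prime) (hdeg : Module.finrank ℚ K = 2) (A : 𝓞 K)
    (hA : A ^ 2 = (p : 𝓞 K)) (t u : ℤ) (htu : t ^ 2 + 1 = p * u ^ 2) (δ : 𝓞 K) (σ : ℤ)
    (hσ : σ ^ 2 = 1) (h : (t : 𝓞 K) + u * A = σ * δ ^ 2) : False := by
  have hA' : (A : K) ^ 2 = (p : K) := by rw [← map_pow, hA, map_natCast]
  obtain ⟨v, w, hvw⟩ := rep_aux p hp hdeg (A : K) hA' δ
  have h' : (t : K) + u * (A : K) = σ * (δ : K) ^ 2 := by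
    have := congrArg (algebraMap (𝓞 K) K) h
    simpa using this
  have h1 := indep_aux p hp (A : K) hA' ((4 * p ^ 2 * t - σ * (v ^ 2 + p * w ^ 2) : ℚ))
    ((4 * p ^ 2 * u - σ * (2 * v * w) : ℚ)) (by
      push_cast
      linear_combination 4 * (p : K) ^ 2 * h' + σ * w ^ 2 * hA' +
        (σ : K) * (2 * p * δ + (v + w * (A : K))) * hvw)
  obtain ⟨e1, e2⟩ := h1
  have e1' : 4 * (p : ℤ) ^ 2 * t = σ * (v ^ 2 + p * w ^ 2) := by
    exact_mod_cast sub_eq_zero.mp e1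
  have e2' : 4 * (p : ℤ) ^ 2 * u = σ * (2 * v * w) := by
    exact_mod_cast sub_eq_zero.mp e2
  have e3 : (v ^ 2 - p * w ^ 2) ^ 2 = - (4 * (p : ℤ) ^ 2) ^ 2 := by
    have f1 : (4 * (p : ℤ) ^ 2) ^ 2 * t ^ 2 = (v ^ 2 + p * w ^ 2) ^ 2 := by
      rw [← mul_pow, e1', mul_pow, hσ, one_mul]
    have f2 : (4 * (p : ℤ) ^ 2) ^ 2 * u ^ 2 = (2 * v * w) ^ 2 := by
      rw [← mul_pow, e2', mul_pow, hσ, one_mul]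
    linear_combination (4 * (p : ℤ) ^ 2) ^ 2 * htu - f1 + p * f2
  have hp0 : (0 : ℤ) < p := by exact_mod_cast hp.pos
  have : 0 < (4 * (p : ℤ) ^ 2) ^ 2 := by positivity
  nlinarith [sq_nonneg (v ^ 2 - p * w ^ 2)]

theorem half (p q : ℕ) [Fact q.Prime] (hp : p.Prime) (hpq : p ≠ q)
    (hp4 : p % 4 = 1) (hq4 : q % 4 = 1) (hleg : legendreSym q p = 1)
    (hdeg : Module.finrank ℚ K = 2) (α : K) (hα : α ^ 2 = (p : K))
    (ε : (𝓞 K)ˣ) (hε : ∀ u : (𝓞 K)ˣ, ∃ n : ℤ, u = ε ^ n ∨ u = -ε ^ n)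
    (𝔮 : Ideal (𝓞 K)) (h𝔮 : 𝔮.IsPrime) (h𝔮q : (q : 𝓞 K) ∈ 𝔮) :
    ∃ a b : ℤ, Odd a ∧ (p : ℤ) = a ^ 2 + b ^ 2 ∧ ∀ c d : ℤ, Odd c → (q : ℤ) = c ^ 2 + d ^ 2 →
      ((a * c + b * d : ℤ) : ZMod q) ≠ 0 ∧
      (quadResSym K 𝔮 (ε : 𝓞 K) = 1 ↔ legendreSym q (a * c + b * d) = 1) := by
  have hqp : q.Prime := Fact.out
  have hq2 : 2 < q := by have := hqp.two_le; omega
  obtain ⟨A, hA⟩ : ∃ A : 𝓞 K, A ^ 2 = (p : 𝓞 K) := by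
    have hαi : IsIntegral ℤ α := by
      refine IsIntegral.of_pow two_pos ?_
      rw [hα]
      simpa using isIntegral_algebraMap (R := ℤ) (A := K) (x := (p : ℤ))
    obtain ⟨A, hAα⟩ : ∃ A : 𝓞 K, algebraMap (𝓞 K) K A = α := ⟨⟨α, hαi⟩, rfl⟩
    refine ⟨A, ?_⟩
    apply FaithfulSMul.algebraMap_injective (𝓞 K) K
    rw [map_pow, map_natCast, hAα]
    exact hα
  have hpq0 : (p : ZMod q) ≠ 0 := by
    rw [Ne, ZMod.natCast_eq_zero_iff]
    exact fun h => hpq ((Nat.prime_dvd_prime_iff_eq hqp hp).mp h).symm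
  have hsq : IsSquare (p : ZMod q) := (legendreSym.eq_one_iff' q hpq0).mp hleg
  obtain ⟨hnorm, φ, hφ⟩ := hom_aux p q hp hpq hq2 hsq hdeg A hA 𝔮 h𝔮 h𝔮q
  have hunit : ∀ x : (𝓞 K)ˣ, φ x ≠ 0 := fun x => (x.isUnit.map φ).ne_zero
  have hsym : quadResSym K 𝔮 (ε : 𝓞 K) = 1 ↔ IsSquare (φ ε) := by
    rw [ZMod.euler_criterion q (hunit ε)]
    unfold quadResSym
    rw [hnorm, ← hφ, map_sub, map_pow, map_one, sub_eq_zero,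
      show (q - 1) / 2 = q / 2 by omega]
    split_ifs with h <;> simp [h]
  obtain ⟨t, u, htu⟩ := pell_neg p hp hp4
  obtain ⟨a, b, m, n, ha, hab, -, ht, hu⟩ := param p hp hp4 t u htu
  refine ⟨a, b, ha, hab, fun c d hc hcd => ?_⟩
  have htu' : (t : 𝓞 K) ^ 2 + 1 = p * (u : 𝓞 K) ^ 2 := by exact_mod_cast congrArg (Int.cast (R := 𝓞 K)) htu
  have hinv : ((t : 𝓞 K) + u * A) * (-t + u * A) = 1 := by
    linear_combination (u : 𝓞 K) ^ 2 * hA - htu'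
  let η : (𝓞 K)ˣ := ⟨t + u * A, -t + u * A, hinv, by rw [mul_comm]; exact hinv⟩
  have hη : (η : 𝓞 K) = t + u * A := rfl
  obtain ⟨k, hk⟩ := hε η
  obtain ⟨σ, hσ, hησ⟩ : ∃ σ : ℤ, (σ = 1 ∨ σ = -1) ∧ (η : 𝓞 K) = σ * ((ε ^ k : (𝓞 K)ˣ) : 𝓞 K) := by
    rcases hk with hk | hk
    · exact ⟨1, Or.inl rfl, by rw [← hk]; simp⟩
    · exact ⟨-1, Or.inr rfl, by rw [hk]; simp⟩
  have hσ2 : σ ^ 2 = 1 := by rcases hσ with rfl | rfl <;> rfl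
  rcases Int.even_or_odd' k with ⟨l, hl | hl⟩
  · exfalso
    refine odd_aux p hp hdeg A hA t u htu ((ε ^ l : (𝓞 K)ˣ) : 𝓞 K) σ hσ2 ?_
    rw [← hη, hησ, hl, mul_comm 2 l, zpow_mul]; rfl
  · have hησ' : (η : 𝓞 K) = σ * ((ε ^ l : (𝓞 K)ˣ) : 𝓞 K) ^ 2 * ε := by
      rw [hησ, hl, zpow_add, mul_comm 2 l, zpow_mul, zpow_one, Units.val_mul, ← mul_assoc]; rfl
    have hneg : IsSquare (-1 : ZMod q) := ZMod.exists_sq_eq_neg_one_iff.mpr (by omega)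
    have hσs : IsSquare ((σ : ZMod q) * (φ ((ε ^ l : (𝓞 K)ˣ) : 𝓞 K)) ^ 2) := by
      refine IsSquare.mul ?_ (IsSquare.sq _)
      rcases hσ with rfl | rfl
      · simp
      · simpa using hneg
    have hφη : φ η = ((σ : ZMod q) * (φ ((ε ^ l : (𝓞 K)ˣ) : 𝓞 K)) ^ 2) * φ ε := by
      rw [hησ']; simp
    have hne : ((σ : ZMod q) * (φ ((ε ^ l : (𝓞 K)ˣ) : 𝓞 K)) ^ 2) ≠ 0 := by
      intro h0
      rw [h0, zero_mul] at hφη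
      exact hunit η hφη
    have hiff : IsSquare (φ η) ↔ IsSquare (φ ε) := by
      rw [hφη]; exact isSquare_mul_iff hne hσs
    rw [hsym, ← hiff]
    have habq : (p : ZMod q) = (a : ZMod q) ^ 2 + (b : ZMod q) ^ 2 := by
      exact_mod_cast congrArg (Int.cast (R := ZMod q)) hab
    have hAq : (φ A) ^ 2 = (a : ZMod q) ^ 2 + (b : ZMod q) ^ 2 := by
      rw [← map_pow, hA, map_natCast, habq]
    have htq : (t : ZMod q) = a * (2 * m * n) - b * (m ^ 2 - n ^ 2) := by
      rw [← ht]; push_cast; ring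
    have hφη2 : φ η = t + u * φ A := by rw [hη]; simp
    have key : ∃ s : ZMod q, s ^ 2 = (a : ZMod q) ^ 2 + (b : ZMod q) ^ 2 ∧
        φ η = a * (2 * m * n) - b * (m ^ 2 - n ^ 2) + (m ^ 2 + n ^ 2) * s := by
      rcases hu with hu | hu
      · refine ⟨φ A, hAq, ?_⟩
        rw [hφη2, htq, hu]; push_cast; ring
      · refine ⟨-φ A, by rw [neg_sq, hAq], ?_⟩
        rw [hφη2, htq, hu]; push_cast; ring
    obtain ⟨s, hs, hse⟩ := key
    obtain ⟨r1, r2⟩ := loc q hq4 a b c d m n s hcd hc hs (habq ▸ hpq0) (φ η) hse (hunit η)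
    exact ⟨by push_cast; exact r1, r2⟩

end fieldpart

/-- The Schönemann–Scholz reciprocity law: for distinct primes
`p ≡ q ≡ 1 mod 4` with `(p/q) = 1`, and any prime `𝔮` of `ℚ(√p)` above `q` and
any prime `𝔭` of `ℚ(√q)` above `p`, one has `[ε_p/𝔮] = [ε_q/𝔭]`; in particular
these symbols are independent of the choice of `𝔮` and `𝔭`. -/
theorem schoenemann_scholz_reciprocity
    (p q : ℕ) (hp : p.Prime) (hq : q.Prime) (hpq : p ≠ q)
    [Fact p.Prime] [Fact q.Prime]
    (hp4 : p % 4 = 1) (hq4 : q % 4 = 1)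
    (hleg : legendreSym q p = 1)     -- `(p/q) = +1`
    (Kp : Type*) [Field Kp] [NumberField Kp]
    (hdegp : Module.finrank ℚ Kp = 2)
    (αp : Kp) (hαp : αp ^ 2 = (p : Kp))   -- `Kp = ℚ(√p)`
    (Kq : Type*) [Field Kq] [NumberField Kq]
    (hdegq : Module.finrank ℚ Kq = 2)
    (αq : Kq) (hαq : αq ^ 2 = (q : Kq))   -- `Kq = ℚ(√q)`
    (εp : (𝓞 Kp)ˣ)
    (hεp : ∀ u : (𝓞 Kp)ˣ, ∃ n : ℤ, u = εp ^ n ∨ u = -εp ^ n)  -- fundamental unit of `ℚ(√p)`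
    (εq : (𝓞 Kq)ˣ)
    (hεq : ∀ u : (𝓞 Kq)ˣ, ∃ n : ℤ, u = εq ^ n ∨ u = -εq ^ n)  -- fundamental unit of `ℚ(√q)`
    (𝔮 : Ideal (𝓞 Kp)) (h𝔮 : 𝔮.IsPrime) (h𝔮q : (q : 𝓞 Kp) ∈ 𝔮)  -- `𝔮` lies above `q`
    (𝔭 : Ideal (𝓞 Kq)) (h𝔭 : 𝔭.IsPrime) (h𝔭p : (p : 𝓞 Kq) ∈ 𝔭)  -- `𝔭` lies above `p`
    : quadResSym Kp 𝔮 (εp : 𝓞 Kp) = quadResSym Kq 𝔭 (εq : 𝓞 Kq) := by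
  obtain ⟨a, b, ha, hab, H1⟩ := half p q hp hpq hp4 hq4 hleg hdegp αp hαp εp hεp 𝔮 h𝔮 h𝔮q
  have hp2 : p ≠ 2 := by omega
  have hleg' : legendreSym p q = 1 := by
    rw [legendreSym.quadratic_reciprocity_one_mod_four hq4 hp2]; exact hleg
  obtain ⟨c, d, hc, hcd, H2⟩ := half q p hq hpq.symm hq4 hp4 hleg' hdegq αq hαq εq hεq 𝔭 h𝔭 h𝔭p
  obtain ⟨n1, e1⟩ := H1 c d hc hcd
  obtain ⟨n2, e2⟩ := H2 a b ha hab
  have hN : c * a + d * b = a * c + b * d := by ring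
  rw [hN] at n2 e2
  have hb : Even b := by
    rcases Int.even_or_odd b with h | h
    · exact h
    · exfalso
      have h1 : Even (a ^ 2 + b ^ 2) := ha.pow.add_odd h.pow
      rw [← hab] at h1
      have : Odd (p : ℤ) := by exact_mod_cast Nat.odd_iff.mpr (by omega)
      exact (Int.not_even_iff_odd.mpr this) h1
  have hodd : Odd (a * c + b * d) := (ha.mul hc).add_even (hb.mul_right d)
  have hJ : jacobiSym (a * c + b * d) (p * q) = 1 := by
    apply jac_aux (p * q) (a * c + b * d) (a * d - b * c)
    · rw [Nat.mul_mod, hp4, hq4]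
    · push_cast; rw [hab, hcd]; ring
    · exact hodd
    · rw [Ne, ZMod.intCast_zmod_eq_zero_iff_dvd] at n1 n2
      push_cast
      exact (((Nat.prime_iff_prime_int.mp hp).coprime_iff_not_dvd.mpr n2).symm).mul_right
        (((Nat.prime_iff_prime_int.mp hq).coprime_iff_not_dvd.mpr n1).symm)
  rw [jacobiSym.mul_right' _ hp.ne_zero hq.ne_zero, ← jacobiSym.legendreSym.to_jacobiSym,
    ← jacobiSym.legendreSym.to_jacobiSym] at hJ
  have hiff : legendreSym q (a * c + b * d) = 1 ↔ legendreSym p (a * c + b * d) = 1 := by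
    constructor <;> intro h <;> simpa [h] using hJ
  have hfin : quadResSym Kp 𝔮 (εp : 𝓞 Kp) = 1 ↔ quadResSym Kq 𝔭 (εq : 𝓞 Kq) = 1 := by
    rw [e1, e2, hiff]
  unfold quadResSym at hfin ⊢
  split_ifs at hfin ⊢ <;> simp_all
end

section
/- Let p and q be distinct primes with p ≡ q ≡ 1 (mod 4) and Legendre symbol (p/q) = +1, let ε_p be the fundamental unit of ℚ(√p), let (ε_p/q) = [ε_p/𝔮] for a prime ideal 𝔮 of ℚ(√p) above q, and let h be the class number and ε the fundamental unit of k = ℚ(√(pq)). If (ε_p/q) = −1, then h ≡ 2 (mod 4) and N(ε) = +1. If (ε_p/q) = +1, then h ≡ 0 (mod 4). -/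
open NumberField
open scoped Classical

theorem aux_sq_mul {m n N p : ℕ} (hp : p.Prime) (hmn : Nat.Coprime m n) (h : m * n = p * N ^ 2) :
    (∃ r s, m = r ^ 2 ∧ n = p * s ^ 2) ∨ (∃ r s, m = p * s ^ 2 ∧ n = r ^ 2) := by
  have hd : p ∣ m * n := ⟨_, h⟩
  rcases (Nat.Prime.dvd_mul hp).1 hd with ⟨t, rfl⟩ | ⟨t, rfl⟩
  · right
    have h' : t * n = N ^ 2 := by
      have : p * (t * n) = p * N ^ 2 := by rw [← h]; ring
      exact Nat.eq_of_mul_eq_mul_left hp.pos this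
    have hc : Nat.Coprime t n := Nat.Coprime.coprime_mul_left hmn
    obtain ⟨a, ha⟩ := exists_eq_pow_of_mul_eq_pow (Nat.isUnit_iff.2 hc) h'
    obtain ⟨b, hb⟩ := exists_eq_pow_of_mul_eq_pow (Nat.isUnit_iff.2 hc.symm) ((mul_comm _ _).trans h')
    exact ⟨b, a, by rw [ha], hb⟩
  · left
    have h' : m * t = N ^ 2 := by
      have : p * (m * t) = p * N ^ 2 := by rw [← h]; ring
      exact Nat.eq_of_mul_eq_mul_left hp.pos this
    have hc : Nat.Coprime m t := Nat.Coprime.coprime_mul_left_right hmn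
    obtain ⟨a, ha⟩ := exists_eq_pow_of_mul_eq_pow (Nat.isUnit_iff.2 hc) h'
    obtain ⟨b, hb⟩ := exists_eq_pow_of_mul_eq_pow (Nat.isUnit_iff.2 hc.symm) ((mul_comm _ _).trans h')
    exact ⟨a, b, ha, by rw [hb]⟩

theorem aux_neg_pell_descent {p : ℕ} (hp : p.Prime) (hp4 : p % 4 = 1) :
    ∀ y x : ℕ, 0 < y → x ^ 2 = p * y ^ 2 + 1 → ∃ a b : ℕ, a ^ 2 + 1 = p * b ^ 2 := by
  intro y
  induction y using Nat.strong_induction_on with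
  | _ y ih =>
  intro x hy hx
  have hmod : x ^ 2 % 4 = (y ^ 2 + 1) % 4 := by
    rw [hx, Nat.add_mod, Nat.mul_mod, hp4]; simp [Nat.add_mod]
  have hxy : x % 2 = 1 ∧ y % 2 = 0 := by
    have h1 : x % 4 < 4 := Nat.mod_lt _ (by norm_num)
    have h2 : y % 4 < 4 := Nat.mod_lt _ (by norm_num)
    rw [Nat.pow_mod, Nat.add_mod, Nat.pow_mod y] at hmod
    have e1 : x % 2 = x % 4 % 2 := by omega
    have e2 : y % 2 = y % 4 % 2 := by omega
    rw [e1, e2]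
    generalize x % 4 = X at *
    generalize y % 4 = Y at *
    interval_cases X <;> interval_cases Y <;> omega
  obtain ⟨m, hm⟩ : ∃ m, x = 2 * m + 1 := ⟨x / 2, by omega⟩
  obtain ⟨n, hn⟩ : ∃ n, y = 2 * n := ⟨y / 2, by omega⟩
  subst hm hn
  have hk : m * (m + 1) = p * n ^ 2 := by nlinarith
  have hn0 : 0 < n := by omega
  rcases aux_sq_mul hp (by simp) hk with ⟨r, s, h1, h2⟩ | ⟨r, s, h1, h2⟩
  · exact ⟨r, s, by rw [← h1, h2]⟩
  · have hs : 0 < s := by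
      rcases Nat.eq_zero_or_pos s with rfl | h
      · have : m = 0 := by simpa using h1
        subst this
        have : 0 < p * n ^ 2 := by have := hp.pos; positivity
        omega
      · exact h
    refine ih s ?_ r hs (by rw [← h2, h1])
    have h3 : (p * s ^ 2) * r ^ 2 = p * n ^ 2 := by rw [← hk, h2, h1]
    have h4 : (s * r) ^ 2 = n ^ 2 := by
      apply Nat.eq_of_mul_eq_mul_left hp.pos; rw [← h3]; ring
    have h5 : s * r = n := by
      exact Nat.pow_left_injective (by norm_num : 2 ≠ 0) h4
    have hr : 0 < r := by
      rcases Nat.eq_zero_or_pos r with rfl | h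
      · simp at h5; omega
      · exact h
    nlinarith

theorem aux_neg_pell {p : ℕ} (hp : p.Prime) (hp4 : p % 4 = 1) :
    ∃ a b : ℕ, a ^ 2 + 1 = p * b ^ 2 := by
  have hns : ¬ IsSquare (p : ℤ) := by
    rw [Int.isSquare_natCast_iff]
    exact fun h => (Nat.Prime.prime hp).not_isSquare h
  obtain ⟨x, y, h, hy⟩ := Pell.exists_of_not_isSquare (d := (p : ℤ)) (by exact_mod_cast hp.pos) hns
  refine aux_neg_pell_descent hp hp4 y.natAbs x.natAbs (Int.natAbs_pos.2 hy) ?_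
  zify
  simp only [sq_abs]
  linarith

theorem aux_descent {p q : ℕ} [Fact q.Prime] (hq4 : q % 4 = 1) (hpq : ¬ (q ∣ p)) :
    ∀ n : ℕ, ∀ (y A B : ℤ), n ≠ 0 → ¬ ((q : ℤ) ∣ y) →
      (4 * (y * n ^ 2) = A ^ 2 - p * q * B ^ 2 ∨ 4 * (y * n ^ 2) = -(A ^ 2 - p * q * B ^ 2)) →
      IsSquare (y : ZMod q) := by
  intro n
  have hq : q.Prime := Fact.out
  have hqz : Prime (q : ℤ) := Nat.prime_iff_prime_int.1 hq
  have hm1 : IsSquare (-1 : ZMod q) := by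
    rw [ZMod.exists_sq_eq_neg_one_iff]; omega
  induction n using Nat.strong_induction_on with
  | _ n ih =>
  intro y A B hn hy h
  by_cases hqn : q ∣ n
  · obtain ⟨n', rfl⟩ := hqn
    have hA : (q : ℤ) ∣ A := by
      apply hqz.dvd_of_dvd_pow (n := 2)
      push_cast at h
      rcases h with h | h
      · exact ⟨4 * y * q * n' ^ 2 + p * B ^ 2, by linear_combination -h⟩
      · exact ⟨-4 * y * q * n' ^ 2 + p * B ^ 2, by linear_combination h⟩
    obtain ⟨A, rfl⟩ := hA
    have hB : (q : ℤ) ∣ p * B ^ 2 := by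
      push_cast at h
      have hq0 : (q : ℤ) ≠ 0 := hqz.ne_zero
      rcases h with h | h
      · refine ⟨A ^ 2 - 4 * y * n' ^ 2, mul_left_cancel₀ hq0 ?_⟩
        linear_combination h
      · refine ⟨A ^ 2 + 4 * y * n' ^ 2, mul_left_cancel₀ hq0 ?_⟩
        linear_combination -h
    have hB : (q : ℤ) ∣ B := by
      rcases hqz.dvd_or_dvd hB with h | h
      · exact absurd (by exact_mod_cast h) hpq
      · exact hqz.dvd_of_dvd_pow h
    obtain ⟨B, rfl⟩ := hB
    have hn' : n' ≠ 0 := by rintro rfl; simp at hn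
    refine ih n' ?_ y A B hn' hy ?_
    · have := hq.two_le
      nlinarith [Nat.pos_of_ne_zero hn']
    · have hq0 : (q : ℤ) ^ 2 ≠ 0 := pow_ne_zero _ hqz.ne_zero
      push_cast at h
      rcases h with h | h
      · left; apply mul_left_cancel₀ hq0; linear_combination h
      · right; apply mul_left_cancel₀ hq0; linear_combination h
  · have hn0 : (n : ZMod q) ≠ 0 := by
      rwa [Ne, ZMod.natCast_eq_zero_iff]
    have h2 : (2 : ZMod q) ≠ 0 := by
      have : ((2 : ℕ) : ZMod q) ≠ 0 := by
        rw [Ne, ZMod.natCast_eq_zero_iff]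
        intro h; have := Nat.le_of_dvd (by norm_num) h
        have := hq.two_le
        have : q = 2 := by omega
        omega
      simpa using this
    rcases h with h | h
    · have h' := congrArg (Int.cast : ℤ → ZMod q) h
      push_cast at h'
      simp at h'
      refine ⟨A / (2 * n), ?_⟩
      field_simp
      linear_combination h'
    · have h' := congrArg (Int.cast : ℤ → ZMod q) h
      push_cast at h'
      simp at h'
      obtain ⟨i, hi⟩ := hm1
      refine ⟨i * A / (2 * n), ?_⟩
      field_simp
      linear_combination h' + (A : ZMod q) ^ 2 * hi

theorem aux_odd_leg_isSquare {q : ℕ} [Fact q.Prime] (hq4 : q % 4 = 1) (c d : ℕ)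
    (h : c ^ 2 + d ^ 2 = q) (hc : c % 2 = 1) : IsSquare (c : ZMod q) := by
  have hq : q.Prime := Fact.out
  have hcop : Nat.Coprime c d := by
    by_contra hne
    obtain ⟨l, hl, h1, h2⟩ := Nat.Prime.not_coprime_iff_dvd.1 hne
    obtain ⟨c, rfl⟩ := h1
    obtain ⟨d, rfl⟩ := h2
    have hd : l ^ 2 ∣ q := ⟨c ^ 2 + d ^ 2, by rw [← h]; ring⟩
    have := (Nat.squarefree_iff_prime_squarefree.1 hq.prime.squarefree) l hl
    exact this (by rwa [← sq])
  have h0 : (c : ZMod q) ≠ 0 := by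
    rw [Ne, ZMod.natCast_eq_zero_iff]
    intro hd
    have hpos : 0 < c := by omega
    have := Nat.le_of_dvd hpos hd
    have := hq.two_le
    nlinarith
  have h1 : jacobiSym c q = 1 := by
    rw [← jacobiSym.quadratic_reciprocity_one_mod_four hq4 (Nat.odd_iff.2 hc)]
    have : jacobiSym (q : ℤ) c = jacobiSym ((d : ℤ) ^ 2) c := by
      rw [jacobiSym.mod_left, jacobiSym.mod_left ((d : ℤ) ^ 2)]
      congr 1
      rw [← h]; push_cast
      rw [sq (c : ℤ)]
      simp [Int.add_emod]
    rw [this]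
    exact jacobiSym.sq_one' (by simpa using hcop.symm)
  have h2 := (legendreSym.eq_one_iff q (a := (c : ℤ)) (by simpa using h0)).1 (by
    rw [jacobiSym.legendreSym.to_jacobiSym]; exact h1)
  simpa using h2

/-- main elementary part 1 -/
theorem aux_part_one {p q : ℕ} [Fact q.Prime] (hq4 : q % 4 = 1) (a b : ℕ) (hp4 : p % 4 = 1)
    (hab : a ^ 2 + 1 = p * b ^ 2) (e : ZMod q) (he : e ^ 2 = 2 * a * e + 1) :
    ∃ x y : ℤ, x ^ 2 + y ^ 2 = p * q * b ^ 2 ∧ IsCoprime y (2 * x) ∧ ¬ ((q : ℤ) ∣ y) ∧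
      (IsSquare e ↔ IsSquare (y : ZMod q)) := by
  have hq : q.Prime := Fact.out
  have h2 : (2 : ZMod q) ≠ 0 := by
    have : ((2 : ℕ) : ZMod q) ≠ 0 := by
      rw [Ne, ZMod.natCast_eq_zero_iff]
      intro h; have := Nat.le_of_dvd (by norm_num) h
      have := hq.two_le
      have : q = 2 := by omega
      omega
    simpa using this
  have ha : a % 2 = 0 := by
    by_contra ha
    have h1 := congrArg (· % 4) hab
    rw [Nat.mul_mod, hp4, Nat.add_mod, Nat.pow_mod, Nat.pow_mod b] at h1
    have h1' : a % 4 = 1 ∨ a % 4 = 3 := by omega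
    have h2 : b % 4 < 4 := Nat.mod_lt _ (by norm_num)
    generalize b % 4 = Y at *
    rcases h1' with h3 | h3 <;> rw [h3] at h1 <;> interval_cases Y <;> omega
  obtain ⟨c, d, hcd, hc⟩ : ∃ c d : ℕ, c ^ 2 + d ^ 2 = q ∧ c % 2 = 1 := by
    obtain ⟨c, d, h⟩ := Nat.Prime.sq_add_sq (p := q) (by omega)
    rcases Nat.mod_two_eq_zero_or_one c with hc | hc
    · refine ⟨d, c, by rw [← h]; ring, ?_⟩
      rcases Nat.mod_two_eq_zero_or_one d with hd | hd
      · exfalso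
        obtain ⟨c, rfl⟩ : 2 ∣ c := Nat.dvd_of_mod_eq_zero hc
        obtain ⟨d, rfl⟩ : 2 ∣ d := Nat.dvd_of_mod_eq_zero hd
        ring_nf at h; omega
      · exact hd
    · exact ⟨c, d, h, hc⟩
  have hd : d % 2 = 0 := by
    rcases Nat.mod_two_eq_zero_or_one d with hd | hd
    · exact hd
    · exfalso
      obtain ⟨c, rfl⟩ : ∃ m, c = 2 * m + 1 := ⟨c / 2, by omega⟩
      obtain ⟨d, rfl⟩ : ∃ m, d = 2 * m + 1 := ⟨d / 2, by omega⟩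
      ring_nf at hcd; omega
  have hcsq := aux_odd_leg_isSquare hq4 c d hcd hc
  have hc0 : (c : ZMod q) ≠ 0 := by
    rw [Ne, ZMod.natCast_eq_zero_iff]
    intro hd
    have hpos : 0 < c := by omega
    have := Nat.le_of_dvd hpos hd
    have := hq.two_le
    nlinarith
  have hcdq : (c : ZMod q) ^ 2 + (d : ZMod q) ^ 2 = 0 := by
    have := congrArg (Nat.cast : ℕ → ZMod q) hcd
    push_cast at this
    simpa using this
  have he0 : e ≠ 0 := by rintro rfl; simp at he
  -- choose sign of d
  obtain ⟨D, hD2, hDe⟩ : ∃ D : ℤ, D ^ 2 = (d : ℤ) ^ 2 ∧ (D : ZMod q) ≠ c * e := by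
    by_cases hh : (d : ZMod q) = c * e
    · refine ⟨-d, by ring, ?_⟩
      push_cast
      intro h3
      have : 2 * (c * e) = 0 := by linear_combination -h3 - hh
      simp [h2, hc0, he0] at this
    · exact ⟨d, rfl, by simpa using hh⟩
  have hDm : D % 2 = 0 := by
    have : Even (D ^ 2) := by rw [hD2]; exact (Int.even_pow' (by norm_num)).2 (by exact_mod_cast Nat.even_iff.2 hd)
    exact Int.even_iff.1 ((Int.even_pow' (by norm_num)).1 this)
  have hcD : (c : ℤ) ^ 2 + D ^ 2 = q := by rw [hD2]; exact_mod_cast hcd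
  have hab' : (a : ℤ) ^ 2 + 1 = p * b ^ 2 := by exact_mod_cast hab
  have hcDq : (c : ZMod q) ^ 2 + (D : ZMod q) ^ 2 = 0 := by
    have := congrArg (Int.cast : ℤ → ZMod q) hcD
    push_cast at this
    simpa using this
  set i : ZMod q := D / c with hi
  have hDi : (D : ZMod q) = i * c := by rw [hi]; field_simp
  have hi2 : i ^ 2 = -1 := by
    rw [hDi] at hcDq
    have : (c : ZMod q) ^ 2 * (i ^ 2 + 1) = 0 := by linear_combination hcDq
    have := (mul_eq_zero.1 this).resolve_left (pow_ne_zero _ hc0)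
    linear_combination this
  have hei : e - i ≠ 0 := by
    intro h; apply hDe; rw [hDi]; linear_combination -(c : ZMod q) * h
  have hi1 : 1 + i ≠ 0 := by
    intro h
    have : (2 : ZMod q) = 0 := by linear_combination (1 - i) * h + hi2
    exact h2 this
  have key : ((a * D + c : ℤ) : ZMod q) * (4 * e) = ((1 + i) * (e - i)) ^ 2 * c := by
    push_cast; rw [hDi]
    linear_combination (-2 * i * c) * he + (4 * c * e - c * (e - i) ^ 2 - 2 * i * c) * hi2
  have hy0 : ((a * D + c : ℤ) : ZMod q) ≠ 0 := by
    intro h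
    rw [h, zero_mul] at key
    have := mul_ne_zero (pow_ne_zero 2 (mul_ne_zero hi1 hei)) hc0
    exact this key.symm
  have hqy : ¬ ((q : ℤ) ∣ (a * D + c : ℤ)) := by
    rwa [← ZMod.intCast_zmod_eq_zero_iff_dvd]
  refine ⟨a * c - D, a * D + c, ?_, ?_, hqy, ?_⟩
  · linear_combination ((a : ℤ) ^ 2 + 1) * hcD + (q : ℤ) * hab'
  · have hodd : IsCoprime ((a * D + c : ℤ)) 2 := by
      apply Int.isCoprime_iff_gcd_eq_one.2
      have : Odd ((a : ℤ) * D + c) := by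
        apply Even.add_odd
        · exact Even.mul_left (Int.even_iff.2 hDm) _
        · exact_mod_cast Nat.odd_iff.2 hc
      have := Int.isCoprime_iff_gcd_eq_one.1 (Int.isCoprime_two_right.2 this)
      exact this
    refine IsCoprime.mul_right hodd ?_
    have hyq : IsCoprime ((a * D + c : ℤ)) (q : ℤ) := by
      exact ((Nat.prime_iff_prime_int.1 hq).coprime_iff_not_dvd.2 hqy).symm
    have : (q : ℤ) = -D * (a * c - D) + c * (a * D + c) := by linear_combination -hcD
    rw [this] at hyq
    have h3 := (IsCoprime.add_mul_left_right_iff (x := ((a * D + c : ℤ))) (y := -D * (a * c - D)) (z := (c : ℤ))).1 (by rwa [mul_comm (c : ℤ)] at hyq)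
    exact IsCoprime.of_mul_right_right h3
  · generalize hyy : ((a * D + c : ℤ) : ZMod q) = Y at *
    obtain ⟨w, hw⟩ := hcsq
    have hw0 : w ≠ 0 := by rintro rfl; simp at hw; exact hc0 hw
    constructor
    · rintro ⟨t, ht⟩
      have ht0 : t ≠ 0 := by rintro rfl; simp at ht; exact he0 ht
      refine ⟨(1 + i) * (e - i) * w / (2 * t), ?_⟩
      field_simp
      linear_combination key - 4 * Y * ht + ((1 + i) * (e - i)) ^ 2 * hw
    · rintro ⟨t, ht⟩
      have ht0 : t ≠ 0 := by rintro rfl; simp at ht; exact hy0 ht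
      refine ⟨(1 + i) * (e - i) * w / (2 * t), ?_⟩
      field_simp
      linear_combination key - 4 * e * ht + ((1 + i) * (e - i)) ^ 2 * hw

theorem aux_rat_not_sq {D : ℤ} (hD : ¬ IsSquare D) (r : ℚ) : r ^ 2 ≠ D := by
  intro h
  apply hD
  have h1 : IsSquare ((D : ℚ)) := ⟨r, by rw [← h, sq]⟩
  exact_mod_cast h1

theorem aux_quad_norm {K : Type*} [Field K] [NumberField K] (hdeg : Module.finrank ℚ K = 2)
    {D : ℤ} (hD : ¬ IsSquare D) {α : K} (hα : α ^ 2 = D) :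
    (∀ r s : ℚ, (r : K) + s * α = 0 → r = 0 ∧ s = 0) ∧
    ∀ u : K, ∃ r s : ℚ, u = r + s * α ∧ Algebra.norm ℚ u = r ^ 2 - D * s ^ 2 ∧
      Algebra.trace ℚ K u = 2 * r := by
  have hind : ∀ r s : ℚ, (r : K) + s * α = 0 → r = 0 ∧ s = 0 := by
    intro r s h
    by_cases hs : s = 0
    · subst hs; simp at h; exact ⟨h, rfl⟩
    · exfalso
      have hs' : (s : K) ≠ 0 := by exact_mod_cast hs
      apply aux_rat_not_sq hD (r / s)
      have : ((r / s : ℚ) : K) ^ 2 = D := by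
        rw [← hα]
        push_cast
        have : (r : K) = - s * α := by linear_combination h
        rw [this]; field_simp
      exact_mod_cast this
  refine ⟨hind, ?_⟩
  have hli : LinearIndependent ℚ ![(1 : K), α] := by
    rw [LinearIndependent.pair_iff]
    intro s t h
    apply hind
    simpa [Algebra.smul_def] using h
  let b := basisOfLinearIndependentOfCardEqFinrank hli (by simp [hdeg])
  have hb0 : b 0 = 1 := by simp [b]
  have hb1 : b 1 = α := by simp [b]
  intro u
  have hu := b.sum_repr u
  rw [Fin.sum_univ_two, hb0, hb1] at hu
  set r := b.repr u 0 with hr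
  set s := b.repr u 1 with hs
  have hu' : u = r + s * α := by rw [← hu]; simp [Algebra.smul_def]
  have huα : u * α = (D * s : ℚ) • b 0 + r • b 1 := by
    rw [hb0, hb1, hu']
    simp only [Algebra.smul_def]
    simp
    linear_combination (s : K) * hα
  have hu1 : u * 1 = r • b 0 + s • b 1 := by rw [mul_one, hb0, hb1, hu]
  have e00 : b.repr (u * b 0) 0 = r := by
    rw [hb0, hu1]
    simp only [map_add, map_smul, Module.Basis.repr_self, Finsupp.add_apply, Finsupp.smul_apply]
    simp
  have e10 : b.repr (u * b 0) 1 = s := by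
    rw [hb0, hu1]
    simp only [map_add, map_smul, Module.Basis.repr_self, Finsupp.add_apply, Finsupp.smul_apply]
    simp
  have e01 : b.repr (u * b 1) 0 = D * s := by
    rw [hb1, huα]
    simp only [map_add, map_smul, Module.Basis.repr_self, Finsupp.add_apply, Finsupp.smul_apply]
    simp
  have e11 : b.repr (u * b 1) 1 = r := by
    rw [hb1, huα]
    simp only [map_add, map_smul, Module.Basis.repr_self, Finsupp.add_apply, Finsupp.smul_apply]
    simp
  refine ⟨r, s, hu', ?_, ?_⟩
  · rw [Algebra.norm_eq_matrix_det b, Matrix.det_fin_two]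
    simp only [Algebra.leftMulMatrix_eq_repr_mul]
    rw [e00, e11]; try rw [e01, e10]
    ring
  · rw [Algebra.trace_eq_matrix_trace b, Matrix.trace_fin_two]
    simp only [Algebra.leftMulMatrix_eq_repr_mul]
    rw [e00, e11]; try rw [e01, e10]
    ring

/-- integers of a quadratic field -/
theorem aux_quad_int {K : Type*} [Field K] [NumberField K] (hdeg : Module.finrank ℚ K = 2)
    {D : ℤ} (hD : ¬ IsSquare D) (hsf : Squarefree D) {ω : 𝓞 K} (hω : ω ^ 2 = D) (u : 𝓞 K) :
    ∃ A B : ℤ, 2 * u = A + B * ω ∧ 4 * Algebra.norm ℤ u = A ^ 2 - D * B ^ 2 := by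
  have hα : (ω : K) ^ 2 = D := by
    have := congrArg (algebraMap (𝓞 K) K) hω
    simpa only [map_pow, map_intCast] using this
  obtain ⟨r, s, hu, hn, ht⟩ := (aux_quad_norm hdeg hD hα).2 (u : K)
  rw [← Algebra.coe_norm_int] at hn
  rw [← Algebra.coe_trace_int] at ht
  set A := Algebra.trace ℤ _ u
  set N := Algebra.norm ℤ u
  -- 2 s is an integer
  have h1 : D * (2 * s) ^ 2 = ((A ^ 2 - 4 * N : ℤ) : ℚ) := by
    push_cast; rw [ht, hn]; ring
  obtain ⟨B, hB⟩ : ∃ B : ℤ, (B : ℚ) = 2 * s := by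
    generalize 2 * s = t at h1
    generalize A ^ 2 - 4 * N = M at h1
    have hden : (t.den : ℤ) ^ 2 ∣ D := by
      have h2 : D * t.num ^ 2 = M * (t.den : ℤ) ^ 2 := by
        have : (t.den : ℚ) ≠ 0 := by exact_mod_cast t.den_nz
        have h3 : (D : ℚ) * t.num ^ 2 = M * (t.den : ℚ) ^ 2 := by
          rw [← h1]
          have : (t.num : ℚ) = t * t.den := (Rat.mul_den_eq_num t).symm
          rw [this]; ring
        exact_mod_cast h3
      have hc : IsCoprime ((t.den : ℤ) ^ 2) (t.num ^ 2) := by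
        apply IsCoprime.pow
        rw [Int.isCoprime_iff_gcd_eq_one]
        have := t.reduced
        rw [Int.gcd_comm]
        simpa [Int.gcd] using this
      exact hc.dvd_of_dvd_mul_right ⟨M, by rw [h2]; ring⟩
    have hu := hsf (t.den : ℤ) (by rwa [← sq])
    have : t.den = 1 := by simpa [Int.isUnit_iff_natAbs_eq] using hu
    exact ⟨t.num, by conv_rhs => rw [← Rat.num_div_den t, this]
                     simp⟩
  refine ⟨A, B, ?_, ?_⟩
  · apply RingOfIntegers.ext
    have hA' : (A : K) = 2 * r := by exact_mod_cast ht
    have hB' : (B : K) = 2 * s := by exact_mod_cast hB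
    simp only [map_mul, map_add, map_intCast, map_ofNat]
    have hu2 : algebraMap (𝓞 K) K u = r + s * algebraMap (𝓞 K) K ω := hu
    rw [hu2, hA', hB']; ring
  · have : (4 * N : ℚ) = A ^ 2 - D * B ^ 2 := by rw [hn, ht, hB]; ring
    exact_mod_cast this

theorem aux_quad_norm_of {K : Type*} [Field K] [NumberField K] (hdeg : Module.finrank ℚ K = 2)
    {D : ℤ} (hD : ¬ IsSquare D) {ω : 𝓞 K} (hω : ω ^ 2 = D) (a b : ℤ) :
    Algebra.norm ℤ ((a : 𝓞 K) + b * ω) = a ^ 2 - D * b ^ 2 := by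
  have hα : (ω : K) ^ 2 = D := by
    have := congrArg (algebraMap (𝓞 K) K) hω
    simpa only [map_pow, map_intCast] using this
  obtain ⟨hi, h⟩ := aux_quad_norm hdeg hD hα
  obtain ⟨r, s, hu, hn, ht⟩ := h (((a : 𝓞 K) + b * ω : 𝓞 K) : K)
  rw [← Algebra.coe_norm_int] at hn
  have h0 := hi (r - a) (s - b) (by
    push_cast
    simp only [map_mul, map_add, map_intCast] at hu
    linear_combination -hu)
  have e1 : r = a := by linarith [h0.1]
  have e2 : s = b := by linarith [h0.2]
  rw [e1, e2] at hn
  exact_mod_cast hn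

theorem aux_quad_indep {K : Type*} [Field K] [NumberField K] (hdeg : Module.finrank ℚ K = 2)
    {D : ℤ} (hD : ¬ IsSquare D) {ω : 𝓞 K} (hω : ω ^ 2 = D) (a b c d : ℤ)
    (h : (a : 𝓞 K) + b * ω = c + d * ω) : a = c ∧ b = d := by
  have hα : (ω : K) ^ 2 = D := by
    have := congrArg (algebraMap (𝓞 K) K) hω
    simpa only [map_pow, map_intCast] using this
  have h' := congrArg (algebraMap (𝓞 K) K) h
  simp only [map_mul, map_add, map_intCast] at h'
  have := (aux_quad_norm hdeg hD hα).1 (a - c) (b - d) (by push_cast; linear_combination h')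
  constructor
  · have := this.1; have : (a : ℚ) = c := by linarith
    exact_mod_cast this
  · have := this.2; have : (b : ℚ) = d := by linarith
    exact_mod_cast this

theorem aux_radical {K : Type*} [Field K] [NumberField K] (hdeg : Module.finrank ℚ K = 2)
    {D : ℤ} (hD : ¬ IsSquare D) (hsf : Squarefree D) (hD4 : D % 4 = 1)
    {ω : 𝓞 K} (hω : ω ^ 2 = D) {l : ℕ} (hl : l.Prime) (hlD : ¬ ((l : ℤ) ∣ D))
    (u : 𝓞 K) (h : (l : 𝓞 K) ∣ u ^ 2) : (l : 𝓞 K) ∣ u := by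
  have hlz : Prime (l : ℤ) := Nat.prime_iff_prime_int.1 hl
  obtain ⟨v, hv⟩ := h
  obtain ⟨A, B, hu, hN⟩ := aux_quad_int hdeg hD hsf hω u
  obtain ⟨A₂, B₂, hv2, -⟩ := aux_quad_int hdeg hD hsf hω v
  set N := Algebra.norm ℤ u with hNdef
  have hlN : (l : ℤ) ∣ N := by
    have h1 : N ^ 2 = (l : ℤ) ^ 2 * Algebra.norm ℤ v := by
      have := congrArg (Algebra.norm ℤ) hv
      rw [map_pow, map_mul] at this
      have h2 := aux_quad_norm_of hdeg hD hω (l : ℤ) 0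
      simp only [Int.cast_zero, zero_mul, add_zero, Int.cast_natCast] at h2
      rw [h2] at this
      rw [this]; ring
    exact (Int.pow_dvd_pow_iff two_ne_zero).1 ⟨_, h1⟩
  have hA2 : A ^ 2 + D * B ^ 2 = 2 * l * A₂ := by
    refine (aux_quad_indep hdeg hD hω (A ^ 2 + D * B ^ 2) (2 * A * B) (2 * l * A₂) (2 * l * B₂) ?_).1
    push_cast
    linear_combination (-(B : 𝓞 K) ^ 2) * hω + 4 * hv - (2 * u + A + B * ω) * hu + 2 * l * hv2
  have hlA : (l : ℤ) ∣ A := by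
    obtain ⟨M, hM⟩ := hlN
    refine hlz.dvd_of_dvd_pow (n := 2) ⟨A₂ + 2 * M, ?_⟩
    have : 2 * A ^ 2 = 2 * (l * (A₂ + 2 * M)) := by
      rw [hM] at hN; linear_combination hA2 - hN
    linarith
  have hlN2 : (l : ℤ) ^ 2 ∣ N := by
    obtain ⟨A, rfl⟩ := hlA
    obtain ⟨M, hM⟩ := hlN
    rw [hM] at hN ⊢
    have hB : (l : ℤ) ∣ B := by
      have : (l : ℤ) ∣ D * B ^ 2 := ⟨l * A ^ 2 - 4 * M, by linear_combination hN⟩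
      rcases hlz.dvd_or_dvd this with h | h
      · exact absurd h hlD
      · exact hlz.dvd_of_dvd_pow h
    obtain ⟨B, rfl⟩ := hB
    have hl0 := hlz.ne_zero
    have h4 : 4 * M = l * (A ^ 2 - D * B ^ 2) := by
      apply mul_left_cancel₀ hl0; linear_combination hN
    rw [sq]
    apply mul_dvd_mul_left
    by_cases h2 : l = 2
    · subst h2
      push_cast at *
      have hE : 2 * M = A ^ 2 - D * B ^ 2 := by linarith
      obtain ⟨D', hD'⟩ : ∃ D', D = 4 * D' + 1 := ⟨D / 4, by omega⟩
      subst hD'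
      have hp : (A - B) % 2 = 0 ∨ (A - B) % 2 = 1 := by omega
      have hAB : ∃ c, A = B + 2 * c := by
        rcases hp with h | h
        · exact ⟨(A - B) / 2, by omega⟩
        · exfalso
          obtain ⟨c, hc⟩ : ∃ c, A = B + 2 * c + 1 := ⟨(A - B) / 2, by omega⟩
          subst hc
          have : 2 * (M - (2 * c ^ 2 + 2 * c + B + 2 * B * c - 2 * D' * B ^ 2)) = 1 := by
            linear_combination hE
          omega
      obtain ⟨c, rfl⟩ := hAB
      exact ⟨c ^ 2 + B * c - D' * B ^ 2, by linarith⟩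
    · have hodd : IsCoprime (l : ℤ) 4 := by
        have : Nat.Coprime l 4 := by
          have := (Nat.coprime_primes hl Nat.prime_two).2 h2
          exact Nat.Coprime.pow_right 2 this
        exact_mod_cast Nat.isCoprime_iff_coprime.2 this
      exact hodd.dvd_of_dvd_mul_left ⟨_, h4⟩
  obtain ⟨T, hT⟩ := hlA
  obtain ⟨M, hM⟩ := hlN2
  have hq : u ^ 2 - A * u + N = 0 := by
    have h4 : (4 : 𝓞 K) ≠ 0 := by norm_num
    apply (mul_eq_zero.1 _).resolve_left h4
    have hN' : (4 * N : 𝓞 K) = A ^ 2 - D * B ^ 2 := by exact_mod_cast congrArg (Int.cast : ℤ → 𝓞 K) hN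
    linear_combination (2 * u - A + B * ω) * hu + hN' + (B : 𝓞 K) ^ 2 * hω
  have hl0 : (l : K) ≠ 0 := by exact_mod_cast hl.ne_zero
  have hint : IsIntegral ℤ ((u : K) / l) := by
    refine ⟨Polynomial.X ^ 2 - Polynomial.C T * Polynomial.X + Polynomial.C M, by monicity!, ?_⟩
    rw [Polynomial.eval₂_add, Polynomial.eval₂_sub, Polynomial.eval₂_mul, Polynomial.eval₂_pow,
      Polynomial.eval₂_X, Polynomial.eval₂_C, Polynomial.eval₂_C]
    · simp only [eq_intCast]
      have hq' := congrArg (algebraMap (𝓞 K) K) hq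
      rw [hT, hM] at hq'
      simp only [map_mul, map_add, map_sub, map_pow, map_natCast, map_intCast, map_zero, Int.cast_mul, Int.cast_pow, Int.cast_natCast] at hq'
      field_simp
      linear_combination hq'
  obtain ⟨w, hw⟩ : ∃ w : 𝓞 K, algebraMap (𝓞 K) K w = algebraMap (𝓞 K) K u / l :=
    ⟨⟨(u : K) / l, hint⟩, rfl⟩
  refine ⟨w, FaithfulSMul.algebraMap_injective (𝓞 K) K ?_⟩
  rw [map_mul, map_natCast, hw]
  field_simp

theorem aux_residue_hom {q : ℕ} [Fact q.Prime] (hq2 : q ≠ 2)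
    {D : ℤ} (hns : ¬ IsSquare D) (hsf : Squarefree D)
    {K : Type*} [Field K] [NumberField K] (hdeg : Module.finrank ℚ K = 2)
    {ω : 𝓞 K} (hω : ω ^ 2 = (D : 𝓞 K)) (𝔮 : Ideal (𝓞 K)) (h𝔮 : 𝔮.IsPrime) (h𝔮q : (q : 𝓞 K) ∈ 𝔮)
    (hsq : IsSquare (D : ZMod q)) :
    ∃ φ : 𝓞 K →+* ZMod q, (∀ x, φ x = 0 ↔ x ∈ 𝔮) ∧ Ideal.absNorm 𝔮 = q := by
  have hq : q.Prime := Fact.out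
  have hnt : Nontrivial (𝓞 K ⧸ 𝔮) := Ideal.Quotient.nontrivial_iff.2 h𝔮.ne_top
  have hdom : IsDomain (𝓞 K ⧸ 𝔮) := Ideal.Quotient.isDomain 𝔮
  have hq0 : ((q : ℕ) : 𝓞 K ⧸ 𝔮) = 0 := by
    have := Ideal.Quotient.eq_zero_iff_mem.2 h𝔮q
    simpa using this
  have hchar : CharP (𝓞 K ⧸ 𝔮) q := by
    exact (CharP.charP_iff_prime_eq_zero hq).2 hq0
  let f : ZMod q →+* (𝓞 K ⧸ 𝔮) := ZMod.castHom (dvd_refl q) _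
  have h2 : (2 : ZMod q) ≠ 0 := by
    have : ((2 : ℕ) : ZMod q) ≠ 0 := by
      rw [Ne, ZMod.natCast_eq_zero_iff]
      intro h; have := Nat.le_of_dvd (by norm_num) h
      have := hq.two_le
      have : q = 2 := by omega
      omega
    simpa using this
  have hinj : Function.Injective f := f.injective
  obtain ⟨s, hs⟩ := hsq
  obtain ⟨t, ht⟩ : ∃ t : ZMod q, Ideal.Quotient.mk 𝔮 ω = f t := by
    have h1 : (Ideal.Quotient.mk 𝔮 ω - f s) * (Ideal.Quotient.mk 𝔮 ω + f s) = 0 := by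
      have e1 : (Ideal.Quotient.mk 𝔮 ω) ^ 2 = (D : 𝓞 K ⧸ 𝔮) := by
        rw [← map_pow, hω]; simp
      have e2 : f s * f s = (D : 𝓞 K ⧸ 𝔮) := by
        rw [← map_mul, ← hs]; simp
      linear_combination e1 - e2
    rcases mul_eq_zero.1 h1 with h | h
    · exact ⟨s, by linear_combination h⟩
    · exact ⟨-s, by rw [map_neg]; linear_combination h⟩
  have hsurj : Function.Surjective f := by
    intro x
    obtain ⟨u, rfl⟩ := Ideal.Quotient.mk_surjective x
    obtain ⟨A, B, hu, -⟩ := aux_quad_int hdeg hns hsf hω u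
    refine ⟨(A + B * t) / 2, ?_⟩
    have h2' : f 2 ≠ 0 := by rwa [Ne, map_eq_zero_iff f hinj]
    apply mul_left_cancel₀ h2'
    rw [← map_mul, mul_div_cancel₀ _ h2]
    have := congrArg (Ideal.Quotient.mk 𝔮) hu
    simp only [map_mul, map_add, map_intCast, map_ofNat] at this
    rw [map_add, map_mul, map_intCast, map_intCast, map_ofNat, this, ht]
  let e := RingEquiv.ofBijective f ⟨hinj, hsurj⟩
  refine ⟨e.symm.toRingHom.comp (Ideal.Quotient.mk 𝔮), ?_, ?_⟩
  · intro x
    simp [Ideal.Quotient.eq_zero_iff_mem]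
  · rw [Ideal.absNorm_apply, Submodule.cardQuot_apply]
    rw [← Nat.card_congr e.toEquiv]
    simp

theorem aux_Kp {p q : ℕ} (hp : p.Prime) [Fact q.Prime]
    (hp4 : p % 4 = 1) (hq4 : q % 4 = 1)
    (hsq : IsSquare ((p : ℕ) : ZMod q))
    (Kp : Type*) [Field Kp] [NumberField Kp]
    (hdegp : Module.finrank ℚ Kp = 2)
    (αp : Kp) (hαp : αp ^ 2 = (p : Kp))
    (εp : (𝓞 Kp)ˣ)
    (hεp : ∀ u : (𝓞 Kp)ˣ, ∃ n : ℤ, u = εp ^ n ∨ u = -εp ^ n)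
    (𝔮 : Ideal (𝓞 Kp)) (h𝔮 : 𝔮.IsPrime) (h𝔮q : (q : 𝓞 Kp) ∈ 𝔮) :
    ∃ x y b : ℤ, x ^ 2 + y ^ 2 = p * q * b ^ 2 ∧ IsCoprime y (2 * x) ∧ ¬ ((q : ℤ) ∣ y) ∧
      (quadResSym Kp 𝔮 (εp : 𝓞 Kp) = 1 ↔ IsSquare (y : ZMod q)) := by
  have hq : q.Prime := Fact.out
  have hns : ¬ IsSquare (p : ℤ) := by
    rw [Int.isSquare_natCast_iff]
    exact fun h => (Nat.Prime.prime hp).not_isSquare h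
  obtain ⟨ω, hω⟩ : ∃ ω : 𝓞 Kp, ω ^ 2 = ((p : ℤ) : 𝓞 Kp) := by
    have : IsIntegral ℤ αp := by
      refine IsIntegral.of_pow (n := 2) (by norm_num) ?_
      rw [hαp]
      have h := isIntegral_algebraMap (R := ℤ) (A := Kp) (x := (p : ℤ))
      simpa using h
    obtain ⟨w, hw⟩ : ∃ w : 𝓞 Kp, algebraMap (𝓞 Kp) Kp w = αp := ⟨⟨αp, this⟩, rfl⟩
    refine ⟨w, FaithfulSMul.algebraMap_injective (𝓞 Kp) Kp ?_⟩
    rw [map_pow, hw, hαp]; simp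
  obtain ⟨a, b, hab⟩ := aux_neg_pell hp hp4
  obtain ⟨φ, hφ, hN⟩ := aux_residue_hom (by omega) hns (Nat.prime_iff_prime_int.1 hp).squarefree hdegp hω 𝔮 h𝔮 h𝔮q (by simpa using hsq)
  have hab' : (a : 𝓞 Kp) ^ 2 + 1 = p * b ^ 2 := by exact_mod_cast congrArg (Nat.cast : ℕ → 𝓞 Kp) hab
  have hω' : ω ^ 2 = (p : 𝓞 Kp) := by simpa using hω
  let η : (𝓞 Kp)ˣ := ⟨a + b * ω, -a + b * ω, by linear_combination (b : 𝓞 Kp) ^ 2 * hω' - hab',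
    by linear_combination (b : 𝓞 Kp) ^ 2 * hω' - hab'⟩
  have hηv : (η : 𝓞 Kp) = a + b * ω := rfl
  have hηn : Algebra.norm ℤ (η : 𝓞 Kp) = -1 := by
    have := aux_quad_norm_of hdegp hns hω a b
    simp only [Int.cast_natCast] at this
    rw [hηv, this]
    have : (a : ℤ) ^ 2 + 1 = p * b ^ 2 := by exact_mod_cast hab
    linear_combination this
  have hη2 : (η : 𝓞 Kp) ^ 2 = 2 * a * η + 1 := by
    rw [hηv]; linear_combination (b : 𝓞 Kp) ^ 2 * hω' - hab'
  have hm1 : IsSquare (-1 : ZMod q) := by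
    rw [ZMod.exists_sq_eq_neg_one_iff]; omega
  have hneg : ∀ z : ZMod q, IsSquare (-z) ↔ IsSquare z := by
    intro z
    constructor
    · intro h; have := hm1.mul h; simpa using this
    · intro h; have := hm1.mul h; simpa using this
  have hn1 : Algebra.norm ℤ (-1 : 𝓞 Kp) = 1 := by
    have := aux_quad_norm_of hdegp hns hω (-1) 0
    simpa using this
  have hiff : IsSquare (φ (η : 𝓞 Kp)) ↔ IsSquare (φ (εp : 𝓞 Kp)) := by
    obtain ⟨n, hn⟩ := hεp η
    have hodd : Odd n := by
      rw [← Int.not_even_iff_odd]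
      rintro ⟨m, rfl⟩
      have h1 : Algebra.norm ℤ (η : 𝓞 Kp) = (Algebra.norm ℤ ((εp ^ m : (𝓞 Kp)ˣ) : 𝓞 Kp)) ^ 2 := by
        rcases hn with hn | hn
        · rw [hn, zpow_add, Units.val_mul, map_mul, sq]
        · rw [hn, zpow_add, Units.val_neg, Units.val_mul, neg_eq_neg_one_mul, map_mul, map_mul, hn1, one_mul, sq]
      rw [hηn] at h1
      nlinarith [sq_nonneg (Algebra.norm ℤ ((εp ^ m : (𝓞 Kp)ˣ) : 𝓞 Kp))]
    obtain ⟨m, rfl⟩ := hodd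
    set v : (𝓞 Kp)ˣ := εp ^ m
    have hv : εp ^ (2 * m + 1) = v ^ 2 * εp := by
      rw [zpow_add, zpow_one, mul_comm 2 m, zpow_mul]; rfl
    rw [hv] at hn
    have hv0 : φ (v : 𝓞 Kp) ≠ 0 := (v.isUnit.map φ).ne_zero
    have h3 : IsSquare (φ (v : 𝓞 Kp) ^ 2 * φ (εp : 𝓞 Kp)) ↔ IsSquare (φ (εp : 𝓞 Kp)) := by
      constructor
      · rintro ⟨w, hw⟩
        refine ⟨w / φ (v : 𝓞 Kp), ?_⟩
        field_simp; linear_combination hw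
      · intro h
        exact (IsSquare.sq _).mul h
    rcases hn with hn | hn
    · rw [hn, Units.val_mul, Units.val_pow_eq_pow_val, map_mul, map_pow, h3]
    · rw [hn, Units.val_neg, Units.val_mul, Units.val_pow_eq_pow_val, map_neg, hneg, map_mul, map_pow, h3]
  obtain ⟨x, y, h1, h2, h3, h4⟩ := aux_part_one hq4 a b hp4 hab (φ (η : 𝓞 Kp)) (by
    rw [← map_pow, hη2, map_add, map_mul, map_mul, map_one, map_natCast, map_ofNat])
  refine ⟨x, y, b, by exact_mod_cast h1, h2, h3, ?_⟩
  rw [← h4, hiff]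
  have hε0 : φ (εp : 𝓞 Kp) ≠ 0 := (εp.isUnit.map φ).ne_zero
  rw [ZMod.euler_criterion q hε0]
  have hq2 : (q - 1) / 2 = q / 2 := by omega
  unfold quadResSym
  rw [hN, hq2, ← hφ, map_sub, map_pow, map_one, sub_eq_zero]
  split_ifs with h <;> simp [h]

theorem aux_group {G : Type*} [CommGroup G] [Finite G] (h4 : 4 ∣ Nat.card G) (j : G)
    (hj : ∀ c : G, c ^ 2 = 1 → c = 1 ∨ c = j) : ∃ g : G, g ^ 2 = j := by
  let f : G →* G := powMonoidHom 2
  have h1 : Nat.card f.ker * Nat.card f.range = Nat.card G := by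
    rw [← Subgroup.index_ker f]; exact Subgroup.card_mul_index _
  have hk : Nat.card f.ker ≤ 2 := by
    have : (f.ker : Set G) ⊆ ({1, j} : Set G) := by
      intro c hc
      have : c ^ 2 = 1 := by simpa [f] using hc
      simpa using hj c this
    calc Nat.card f.ker = (f.ker : Set G).ncard := rfl
      _ ≤ ({1, j} : Set G).ncard := Set.ncard_le_ncard this (Set.toFinite _)
      _ ≤ 2 := (Set.ncard_insert_le _ _).trans (by simp)
  have hk0 : 0 < Nat.card f.ker := Nat.card_pos
  have h2 : 2 ∣ Nat.card f.range := by
    obtain h | h : Nat.card f.ker = 1 ∨ Nat.card f.ker = 2 := by omega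
    · rw [h] at h1; omega
    · rw [h] at h1; omega
  have : Fact (Nat.Prime 2) := ⟨Nat.prime_two⟩
  obtain ⟨c, hc⟩ := exists_prime_orderOf_dvd_card' 2 h2
  have hc2 : c ^ 2 = 1 := by rw [← hc]; exact pow_orderOf_eq_one c
  have hc1 : c ≠ 1 := by rintro rfl; simp at hc
  obtain ⟨g, hg⟩ := c.2
  refine ⟨g, ?_⟩
  have hg' : g ^ 2 = (c : G) := hg
  rcases hj (c : G) (by exact_mod_cast congrArg Subtype.val hc2) with h | h
  · exact absurd (Subtype.ext h) hc1
  · rw [hg', h]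

theorem aux_ideal_dvd {R : Type*} [CommRing R] [IsDedekindDomain R] {a b : Ideal R}
    (h : a ^ 2 ∣ b ^ 2) : a ∣ b := (UniqueFactorizationMonoid.pow_dvd_pow_iff_dvd two_ne_zero).1 h

theorem aux_ideal_sq {R : Type*} [CommRing R] [IsDedekindDomain R] {a b : Ideal R}
    (h : a ^ 2 = b ^ 2) : a = b :=
  dvd_antisymm (aux_ideal_dvd (dvd_of_eq h)) (aux_ideal_dvd (dvd_of_eq h.symm))

theorem aux_mk0_span {R : Type*} [CommRing R] [IsDedekindDomain R] {I : nonZeroDivisors (Ideal R)}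
    {z : R} (h : (I : Ideal R) = Ideal.span {z}) : ClassGroup.mk0 I = 1 := by
  have := (ClassGroup.mk0_eq_one_iff I.2).2 ⟨z, by rw [h]⟩
  exact this

theorem aux_mk0_exists {R : Type*} [CommRing R] [IsDedekindDomain R] {I : nonZeroDivisors (Ideal R)}
    (h : ClassGroup.mk0 I = 1) : ∃ z : R, (I : Ideal R) = Ideal.span {z} := by
  have := (ClassGroup.mk0_eq_one_iff I.2).1 h
  exact ⟨_, (@Ideal.span_singleton_generator _ _ (I : Ideal R) this).symm⟩

section
variable {K : Type*} [Field K] [NumberField K]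

theorem aux_F (hdeg : Module.finrank ℚ K = 2)
    {D : ℕ} (hD : ¬ IsSquare (D : ℤ)) (hsf : Squarefree (D : ℤ)) (hD4 : (D : ℤ) % 4 = 1)
    {ω : 𝓞 K} (hω : ω ^ 2 = ((D : ℤ) : 𝓞 K)) {B : Ideal (𝓞 K)} {m : ℤ} (hm : m ≠ 0)
    (hB : B ^ 2 = Ideal.span {(m : 𝓞 K)}) :
    ∃ (r e : ℕ) (C : Ideal (𝓞 K)), r ≠ 0 ∧ B = Ideal.span {(r : 𝓞 K)} * C ∧
      C ^ 2 = Ideal.span {(e : 𝓞 K)} ∧ m.natAbs = r ^ 2 * e ∧ e ∣ D := by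
  obtain ⟨e, r, he, hesf⟩ := Nat.sq_mul_squarefree m.natAbs
  have hm0 : m.natAbs ≠ 0 := by simpa using hm
  have hr : r ≠ 0 := by rintro rfl; simp at he; exact hm0 he.symm
  have hr0 : (r : 𝓞 K) ≠ 0 := by exact_mod_cast hr
  have hB' : B ^ 2 = Ideal.span {(r : 𝓞 K)} ^ 2 * Ideal.span {(e : 𝓞 K)} := by
    rw [hB, Ideal.span_singleton_pow, Ideal.span_singleton_mul_span_singleton]
    have : ((m.natAbs : ℕ) : 𝓞 K) = (r : 𝓞 K) ^ 2 * e := by rw [← he]; push_cast; ring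
    rw [← this]
    rcases Int.natAbs_eq m with h | h
    · conv_lhs => rw [h]
      simp
    · conv_lhs => rw [h]
      simp [Ideal.span_singleton_neg]
  obtain ⟨C, hC⟩ := aux_ideal_dvd (Dvd.intro _ hB'.symm)
  have hrI : Ideal.span {(r : 𝓞 K)} ≠ 0 := by simpa using hr0
  have hC2 : C ^ 2 = Ideal.span {(e : 𝓞 K)} := by
    apply mul_left_cancel₀ (pow_ne_zero 2 hrI)
    rw [← hB', hC]; ring
  refine ⟨r, e, C, hr, hC, hC2, he.symm, ?_⟩
  have hDsf : Squarefree D := by exact_mod_cast (Int.squarefree_natCast.1 hsf)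
  have hD0 : D ≠ 0 := hDsf.ne_zero
  rw [← Nat.prod_primeFactors_of_squarefree hesf, Nat.prod_primeFactors_dvd_iff hD0]
  intro l hl
  have hlp := Nat.prime_of_mem_primeFactors hl
  have hle := Nat.dvd_of_mem_primeFactors hl
  rw [Nat.mem_primeFactors]
  refine ⟨hlp, ?_, hD0⟩
  by_contra hlD
  have h1 : C ≤ Ideal.span {(l : 𝓞 K)} := by
    intro u hu
    rw [Ideal.mem_span_singleton]
    refine aux_radical hdeg hD hsf hD4 hω hlp (fun h => hlD (by exact_mod_cast h)) u ?_
    have h2 : u ^ 2 ∈ C ^ 2 := Ideal.pow_mem_pow hu 2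
    rw [hC2, Ideal.mem_span_singleton] at h2
    exact dvd_trans (by exact_mod_cast (Nat.cast_dvd_cast (α := 𝓞 K) hle)) h2
  have h2 : Ideal.span {(l : 𝓞 K)} ^ 2 ∣ Ideal.span {(e : 𝓞 K)} := by
    rw [← hC2]
    exact pow_dvd_pow_of_dvd (Ideal.dvd_iff_le.2 h1) 2
  rw [Ideal.span_singleton_pow, Ideal.dvd_iff_le, Ideal.span_singleton_le_span_singleton] at h2
  have h3 := map_dvd (Algebra.norm ℤ) h2
  have h4 : ∀ n : ℕ, Algebra.norm ℤ (n : 𝓞 K) = (n : ℤ) ^ 2 := by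
    intro n
    have := aux_quad_norm_of hdeg hD hω n 0
    simpa using this
  rw [map_pow, h4, h4, ← pow_mul, mul_comm, pow_mul] at h3
  have h5 : ((l : ℤ) ^ 2) ∣ (e : ℤ) := (Int.pow_dvd_pow_iff two_ne_zero).1 h3
  have h6 : l * l ∣ e := by rw [← sq]; exact_mod_cast h5
  exact hlp.one_lt.ne' (Nat.isUnit_iff.1 (hesf l h6))
end

section
variable {K : Type*} [Field K] [NumberField K]

theorem aux_G0 (hdeg : Module.finrank ℚ K = 2) {p q : ℕ} (hp : p.Prime) (hq : q.Prime)
    (hD : ¬ IsSquare ((p * q : ℕ) : ℤ)) (hsf : Squarefree ((p * q : ℕ) : ℤ))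
    (hD4 : ((p * q : ℕ) : ℤ) % 4 = 1)
    {ω : 𝓞 K} (hω : ω ^ 2 = (((p * q : ℕ) : ℤ) : 𝓞 K)) {B : Ideal (𝓞 K)} {m : ℤ} (hm : m ≠ 0)
    (hB : B ^ 2 = Ideal.span {(m : 𝓞 K)}) :
    ∃ (r e : ℕ) (C : Ideal (𝓞 K)), r ≠ 0 ∧ B = Ideal.span {(r : 𝓞 K)} * C ∧
      C ^ 2 = Ideal.span {(e : 𝓞 K)} ∧ m.natAbs = r ^ 2 * e ∧
      (C = ⊤ ∧ e = 1 ∨ C = Ideal.span {ω} ∧ e = p * q ∨ C ^ 2 = Ideal.span {(p : 𝓞 K)} ∨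
        ∃ E : Ideal (𝓞 K), E ^ 2 = Ideal.span {(p : 𝓞 K)} ∧ Ideal.span {ω} = C * E) := by
  obtain ⟨r, e, C, hr, hBC, hC, hme, heD⟩ := aux_F hdeg hD hsf hD4 hω hm hB
  refine ⟨r, e, C, hr, hBC, hC, hme, ?_⟩
  have hω' : ω ^ 2 = (p : 𝓞 K) * q := by rw [hω]; push_cast; ring
  obtain ⟨e1, e2, h1, h2, rfl⟩ := (Nat.dvd_mul).1 heD
  rcases (Nat.dvd_prime hp).1 h1 with rfl | rfl <;> rcases (Nat.dvd_prime hq).1 h2 with rfl | rfl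
  · left
    refine ⟨?_, rfl⟩
    rw [← Ideal.one_eq_top]
    apply aux_ideal_sq
    rw [hC, one_pow, Ideal.one_eq_top]; simp
  · right; right; right
    have h3 : Ideal.span {ω} ^ 2 = C ^ 2 * Ideal.span {(p : 𝓞 K)} := by
      rw [hC, Ideal.span_singleton_pow, hω', Ideal.span_singleton_mul_span_singleton]
      push_cast; rw [one_mul, mul_comm]
    obtain ⟨E, hE⟩ := aux_ideal_dvd (Dvd.intro _ h3.symm)
    refine ⟨E, ?_, hE⟩
    have hC0 : C ^ 2 ≠ 0 := by
      rw [hC]; simpa using hq.ne_zero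
    apply mul_left_cancel₀ hC0
    rw [← h3, hE, mul_pow]
  · right; right; left
    rw [hC]; simp
  · right; left
    refine ⟨?_, rfl⟩
    apply aux_ideal_sq
    rw [hC, Ideal.span_singleton_pow, hω']; push_cast; rfl

theorem aux_G (hdeg : Module.finrank ℚ K = 2) {p q : ℕ} (hp : p.Prime) (hq : q.Prime)
    (hD : ¬ IsSquare ((p * q : ℕ) : ℤ)) (hsf : Squarefree ((p * q : ℕ) : ℤ))
    (hD4 : ((p * q : ℕ) : ℤ) % 4 = 1)
    {ω : 𝓞 K} (hω : ω ^ 2 = (((p * q : ℕ) : ℤ) : 𝓞 K)) (B : nonZeroDivisors (Ideal (𝓞 K))) {m : ℤ}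
    (hm : m ≠ 0) (hB : (B : Ideal (𝓞 K)) ^ 2 = Ideal.span {(m : 𝓞 K)}) :
    ClassGroup.mk0 B = 1 ∨ ∃ C : nonZeroDivisors (Ideal (𝓞 K)), ClassGroup.mk0 C = ClassGroup.mk0 B ∧
      (C : Ideal (𝓞 K)) ^ 2 = Ideal.span {(p : 𝓞 K)} := by
  obtain ⟨r, e, C, hr, hBC, hC, -, h⟩ := aux_G0 hdeg hp hq hD hsf hD4 hω hm hB
  have hω' : ω ^ 2 = (p : 𝓞 K) * q := by rw [hω]; push_cast; ring
  have hω0 : ω ≠ 0 := by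
    rintro rfl
    have : (p : 𝓞 K) * q ≠ 0 := by exact_mod_cast mul_ne_zero hp.ne_zero hq.ne_zero
    apply this; rw [← hω']; simp
  have hp0 : (p : 𝓞 K) ≠ 0 := by exact_mod_cast hp.ne_zero
  have hB0 : (B : Ideal (𝓞 K)) ≠ 0 := nonZeroDivisors.ne_zero B.2
  have hC0 : C ≠ 0 := by rintro rfl; exact hB0 (by rw [hBC]; simp)
  have hr0 : Ideal.span {(r : 𝓞 K)} ≠ 0 := by simpa using hr
  let R : nonZeroDivisors (Ideal (𝓞 K)) := ⟨_, mem_nonZeroDivisors_of_ne_zero hr0⟩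
  let C' : nonZeroDivisors (Ideal (𝓞 K)) := ⟨_, mem_nonZeroDivisors_of_ne_zero hC0⟩
  have hBR : B = R * C' := Subtype.ext hBC
  have hmk : ClassGroup.mk0 B = ClassGroup.mk0 C' := by
    rw [hBR, map_mul, aux_mk0_span (I := R) rfl, one_mul]
  rw [hmk]
  rcases h with ⟨h, -⟩ | ⟨h, -⟩ | h | ⟨E, hE, hωE⟩
  · left; exact aux_mk0_span (z := 1) (by simpa [C'] using h)
  · left; exact aux_mk0_span (z := ω) h
  · right; exact ⟨C', rfl, h⟩
  · right
    have hE0 : E ≠ 0 := by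
      rintro rfl; apply hω0; simpa using hωE
    let E' : nonZeroDivisors (Ideal (𝓞 K)) := ⟨_, mem_nonZeroDivisors_of_ne_zero hE0⟩
    refine ⟨E', ?_, hE⟩
    have h1 : ClassGroup.mk0 (C' * E') = 1 := aux_mk0_span (z := ω) hωE.symm
    have h2 : ClassGroup.mk0 (E' ^ 2) = 1 := aux_mk0_span (z := (p : 𝓞 K)) hE
    rw [map_mul] at h1; rw [map_pow, sq] at h2
    exact mul_right_cancel (h2.trans h1.symm)

theorem aux_A (hdeg : Module.finrank ℚ K = 2) {p q : ℕ} (hp : p.Prime) (hq : q.Prime)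
    (hD : ¬ IsSquare ((p * q : ℕ) : ℤ)) (hsf : Squarefree ((p * q : ℕ) : ℤ))
    (hD4 : ((p * q : ℕ) : ℤ) % 4 = 1)
    {ω : 𝓞 K} (hω : ω ^ 2 = (((p * q : ℕ) : ℤ) : 𝓞 K)) (𝔞 : nonZeroDivisors (Ideal (𝓞 K))) {z : 𝓞 K}
    (hz : 0 < Algebra.norm ℤ z) (hB : (𝔞 : Ideal (𝓞 K)) ^ 2 = Ideal.span {z}) :
    ClassGroup.mk0 𝔞 = 1 ∨ ∃ C : nonZeroDivisors (Ideal (𝓞 K)), ClassGroup.mk0 C = ClassGroup.mk0 𝔞 ∧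
      (C : Ideal (𝓞 K)) ^ 2 = Ideal.span {(p : 𝓞 K)} := by
  obtain ⟨A, B, h2z, hN⟩ := aux_quad_int hdeg hD hsf hω z
  set n := Ideal.absNorm (𝔞 : Ideal (𝓞 K)) with hn
  have h𝔞0 : (𝔞 : Ideal (𝓞 K)) ≠ 0 := nonZeroDivisors.ne_zero 𝔞.2
  have hn0 : n ≠ 0 := by rw [hn, Ne, Ideal.absNorm_eq_zero_iff]; exact h𝔞0
  have hNn : Algebra.norm ℤ z = (n : ℤ) ^ 2 := by
    have := congrArg Ideal.absNorm hB
    rw [map_pow, ← hn, Ideal.absNorm_span_singleton] at this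
    zify at this; rw [abs_of_pos hz] at this; exact this.symm
  have hz0 : z ≠ 0 := by rintro rfl; simp at hz
  obtain ⟨w, m, hw0, hwm⟩ : ∃ (w : 𝓞 K) (m : ℤ), w ≠ 0 ∧ w ^ 2 = z * m := by
    have h4 : (4 : 𝓞 K) * n ^ 2 = (A + B * ω) * (A - B * ω) := by
      have h5 : (4 : ℤ) * n ^ 2 = A ^ 2 - (p * q : ℕ) * B ^ 2 := by rw [← hNn, hN]
      have h6 : (4 : 𝓞 K) * n ^ 2 = A ^ 2 - (((p * q : ℕ) : ℤ) : 𝓞 K) * B ^ 2 := by exact_mod_cast congrArg (Int.cast : ℤ → 𝓞 K) h5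
      linear_combination h6 + (B : 𝓞 K) ^ 2 * hω
    have hzsq : z ^ 2 + (n : 𝓞 K) ^ 2 = z * A := by
      have : (4 : 𝓞 K) ≠ 0 := by norm_num
      apply mul_left_cancel₀ this
      linear_combination h4 + (2 * z - (A - B * ω)) * h2z
    by_cases hw : z + n = 0
    · have hzn : z = -n := by linear_combination hw
      refine ⟨n, -n, by exact_mod_cast hn0, ?_⟩
      rw [hzn]; push_cast; ring
    · refine ⟨z + n, A + 2 * n, hw, ?_⟩
      push_cast
      linear_combination hzsq
  have hm0 : m ≠ 0 := by
    rintro rfl; apply hw0; simpa using hwm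
  have h3 : Ideal.span {w} ^ 2 = (𝔞 : Ideal (𝓞 K)) ^ 2 * Ideal.span {(m : 𝓞 K)} := by
    rw [hB, Ideal.span_singleton_pow, hwm, Ideal.span_singleton_mul_span_singleton]
  obtain ⟨𝔟, h𝔟⟩ := aux_ideal_dvd (Dvd.intro _ h3.symm)
  have h𝔟0 : 𝔟 ≠ 0 := by rintro rfl; apply hw0; simpa using h𝔟
  have h𝔟2 : 𝔟 ^ 2 = Ideal.span {(m : 𝓞 K)} := by
    apply mul_left_cancel₀ (pow_ne_zero 2 h𝔞0)
    rw [← h3, h𝔟, mul_pow]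
  let 𝔟' : nonZeroDivisors (Ideal (𝓞 K)) := ⟨_, mem_nonZeroDivisors_of_ne_zero h𝔟0⟩
  have e1 : ClassGroup.mk0 (𝔞 * 𝔟') = 1 := aux_mk0_span (z := w) h𝔟.symm
  have e2 : ClassGroup.mk0 (𝔟' ^ 2) = 1 := aux_mk0_span (z := (m : 𝓞 K)) h𝔟2
  rw [map_mul] at e1; rw [map_pow, sq] at e2
  have e3 : ClassGroup.mk0 𝔞 = ClassGroup.mk0 𝔟' := mul_right_cancel (e1.trans e2.symm)
  rw [e3]
  exact aux_G hdeg hp hq hD hsf hD4 hω 𝔟' hm0 h𝔟2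

theorem aux_E (hdeg : Module.finrank ℚ K = 2) {p q : ℕ} [Fact q.Prime] (hq4 : q % 4 = 1) (hqp : ¬ q ∣ p)
    (hD : ¬ IsSquare ((p * q : ℕ) : ℤ)) (hsf : Squarefree ((p * q : ℕ) : ℤ))
    {ω : 𝓞 K} (hω : ω ^ 2 = (((p * q : ℕ) : ℤ) : 𝓞 K)) (I : nonZeroDivisors (Ideal (𝓞 K)))
    (g : ClassGroup (𝓞 K)) (hg : ClassGroup.mk0 I = g ^ 2)
    (hqI : ¬ q ∣ Ideal.absNorm (I : Ideal (𝓞 K))) :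
    IsSquare ((Ideal.absNorm (I : Ideal (𝓞 K)) : ℕ) : ZMod q) := by
  obtain ⟨J, hJ⟩ := ClassGroup.mk0_surjective g⁻¹
  have h1 : ClassGroup.mk0 (I * J ^ 2) = 1 := by
    rw [map_mul, map_pow, hg, hJ]; simp
  obtain ⟨z, hz⟩ := aux_mk0_exists h1
  obtain ⟨A, B, -, hN⟩ := aux_quad_int hdeg hD hsf hω z
  have h2 := congrArg Ideal.absNorm hz
  rw [Ideal.absNorm_span_singleton] at h2
  simp only [Submonoid.coe_mul, SubmonoidClass.coe_pow, map_mul, map_pow] at h2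
  have hJ0 : Ideal.absNorm (J : Ideal (𝓞 K)) ≠ 0 := by
    rw [Ne, Ideal.absNorm_eq_zero_iff]; exact nonZeroDivisors.ne_zero J.2
  have := aux_descent (p := p) hq4 hqp _ (Ideal.absNorm (I : Ideal (𝓞 K)) : ℤ) A B hJ0 (by exact_mod_cast hqI) (by
    have h3 : ((Ideal.absNorm (I : Ideal (𝓞 K)) : ℕ) : ℤ) * (Ideal.absNorm (J : Ideal (𝓞 K)) : ℕ) ^ 2 = |Algebra.norm ℤ z| := by
      rw [Int.abs_eq_natAbs]; exact_mod_cast h2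
    rw [h3]
    push_cast at hN
    rcases abs_choice (Algebra.norm ℤ z) with h | h <;> rw [h]
    · left; exact hN
    · right; linarith)
  simpa using this

end

section
variable {K : Type*} [Field K] [NumberField K]

theorem aux_inf (hdeg : Module.finrank ℚ K = 2) {D : ℤ} (hD0 : 0 < D) (hD : ¬ IsSquare D)
    {ω : 𝓞 K} (hω : ω ^ 2 = (D : 𝓞 K)) (ε : (𝓞 K)ˣ)
    (hε : ∀ u : (𝓞 K)ˣ, ∃ n : ℤ, u = ε ^ n ∨ u = -ε ^ n) (N : ℤ) (hN : N ≠ 0) : ε ^ N ≠ 1 := by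
  intro h
  obtain ⟨X, Y, hXY, hY⟩ := Pell.exists_of_not_isSquare hD0 hD
  obtain ⟨X', hX', Y', hY', hXY'⟩ : ∃ X' : ℤ, 0 < X' ∧ ∃ Y' : ℤ, 0 < Y' ∧ X' ^ 2 - D * Y' ^ 2 = 1 := by
    refine ⟨|X|, ?_, |Y|, abs_pos.2 hY, by simpa using hXY⟩
    apply abs_pos.2; rintro rfl
    nlinarith [sq_nonneg Y]
  have hc : (X' : 𝓞 K) ^ 2 - D * Y' ^ 2 = 1 := by exact_mod_cast congrArg (Int.cast : ℤ → 𝓞 K) hXY'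
  let ζ : (𝓞 K)ˣ := ⟨X' + Y' * ω, X' - Y' * ω, by linear_combination hc - (Y' : 𝓞 K) ^ 2 * hω,
    by linear_combination hc - (Y' : 𝓞 K) ^ 2 * hω⟩
  have hζ : (ζ : 𝓞 K) = X' + Y' * ω := rfl
  have hpow : ∀ n : ℕ, ∃ a b : ℤ, 0 < a ∧ 0 < b ∧ (ζ : 𝓞 K) ^ (n + 1) = a + b * ω := by
    intro n
    induction n with
    | zero => exact ⟨X', Y', hX', hY', by simp [hζ]⟩
    | succ n ih =>
      obtain ⟨a, b, ha, hb, hab⟩ := ih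
      refine ⟨a * X' + D * (b * Y'), a * Y' + b * X', by positivity, by positivity, ?_⟩
      rw [pow_succ, hab, hζ]; push_cast
      linear_combination (b : 𝓞 K) * Y' * hω
  obtain ⟨n, hn⟩ := hε ζ
  have h1 : ζ ^ (2 * N.natAbs) = 1 := by
    have h2 : ε ^ (N.natAbs) = 1 := by
      rw [← zpow_natCast]
      rcases Int.natAbs_eq N with h' | h'
      · rw [← h', h]
      · have : ((N.natAbs : ℕ) : ℤ) = -N := by omega
        rw [this, zpow_neg, h, inv_one]
    have h3 : ∀ n : ℤ, (ε ^ n) ^ (2 * N.natAbs) = 1 := by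
      intro n
      rw [← zpow_natCast, ← zpow_mul, mul_comm, zpow_mul, zpow_natCast, mul_comm 2, pow_mul, h2]; simp
    rcases hn with hn | hn
    · rw [hn, h3]
    · rw [hn, Even.neg_pow (even_two_mul _), h3]
  have hN' : N.natAbs ≠ 0 := by simpa using hN
  obtain ⟨a, b, ha, hb, hab⟩ := hpow (2 * N.natAbs - 1)
  have : 2 * N.natAbs - 1 + 1 = 2 * N.natAbs := by omega
  rw [this] at hab
  have h4 : (ζ : 𝓞 K) ^ (2 * N.natAbs) = 1 := by
    rw [← Units.val_pow_eq_pow_val, h1, Units.val_one]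
  have := aux_quad_indep hdeg hD hω a b 1 0 (by rw [← hab, h4]; simp)
  omega

theorem aux_nosq (ε : (𝓞 K)ˣ)
    (hε : ∀ u : (𝓞 K)ˣ, ∃ n : ℤ, u = ε ^ n ∨ u = -ε ^ n) (hinf : ∀ N : ℤ, N ≠ 0 → ε ^ N ≠ 1)
    (v : (𝓞 K)ˣ) (hv : v ^ 2 = ε ∨ v ^ 2 = -ε) : False := by
  obtain ⟨n, hn⟩ := hε v
  have h1 : v ^ 2 = ε ^ (2 * n) := by
    have h2 : (ε ^ n) ^ 2 = ε ^ (2 * n) := by rw [mul_comm, zpow_mul]; norm_cast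
    rcases hn with hn | hn
    · rw [hn, h2]
    · rw [hn, neg_sq, h2]
  have h3 : ε ^ (2 * (2 * n)) = ε ^ (2 : ℤ) := by
    have e : ε ^ (2 * (2 * n)) = (v ^ 2) ^ 2 := by
      rw [h1, mul_comm, zpow_mul]; norm_cast
    rw [e]
    rcases hv with hv | hv <;> rw [hv]
    · norm_cast
    · rw [neg_sq]; norm_cast
  refine hinf (2 * (2 * n) - 2) (by omega) ?_
  rw [zpow_sub, h3]; simp

theorem aux_H (hdeg : Module.finrank ℚ K = 2) {p q : ℕ} (hp : p.Prime) (hq : q.Prime)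
    (hD : ¬ IsSquare ((p * q : ℕ) : ℤ)) (hsf : Squarefree ((p * q : ℕ) : ℤ))
    (hD4 : ((p * q : ℕ) : ℤ) % 4 = 1)
    {ω : 𝓞 K} (hω : ω ^ 2 = (((p * q : ℕ) : ℤ) : 𝓞 K)) (ε : (𝓞 K)ˣ)
    (hε : ∀ u : (𝓞 K)ˣ, ∃ n : ℤ, u = ε ^ n ∨ u = -ε ^ n)
    (hn : Algebra.norm ℤ (ε : 𝓞 K) = 1) :
    ∃ v : 𝓞 K, Ideal.span {v} ^ 2 = Ideal.span {(p : 𝓞 K)} := by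
  have hpq0 : 0 < p * q := Nat.mul_pos hp.pos hq.pos
  have hinf := aux_inf hdeg (by exact_mod_cast hpq0) hD hω ε hε
  have hω' : ω ^ 2 = ((p * q : ℕ) : 𝓞 K) := by rw [hω]; push_cast; ring
  have hω0 : ω ≠ 0 := by
    rintro rfl
    have : ((p * q : ℕ) : 𝓞 K) ≠ 0 := by exact_mod_cast hpq0.ne'
    apply this; rw [← hω']; simp
  obtain ⟨A, B, h2z, hN⟩ := aux_quad_int hdeg hD hsf hω (ε : 𝓞 K)
  set w : 𝓞 K := 1 + ε with hw
  have hw0 : w ≠ 0 := by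
    intro h0
    refine hinf 2 two_ne_zero ?_
    have : ε = -1 := by
      ext1
      rw [Units.val_neg, Units.val_one]; linear_combination h0
    rw [this]; norm_cast; simp
  have hwm : w ^ 2 = ε * ((A + 2 : ℤ) : 𝓞 K) := by
    have h6 : (4 : 𝓞 K) = A ^ 2 - (((p * q : ℕ) : ℤ) : 𝓞 K) * B ^ 2 := by
      rw [hn] at hN
      exact_mod_cast congrArg (Int.cast : ℤ → 𝓞 K) hN
    have : (4 : 𝓞 K) ≠ 0 := by norm_num
    apply mul_left_cancel₀ this
    push_cast at h6 hω ⊢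
    rw [hw]
    linear_combination h6 + (B : 𝓞 K) ^ 2 * hω + (2 * ε - (A - B * ω)) * h2z
  have hm0 : A + 2 ≠ 0 := by
    intro h; rw [h] at hwm; apply hw0; simpa using hwm
  have hws : Ideal.span {w} ^ 2 = Ideal.span {((A + 2 : ℤ) : 𝓞 K)} := by
    rw [Ideal.span_singleton_pow, hwm, Ideal.span_singleton_mul_left_unit ε.isUnit]
  obtain ⟨r, e, C, hr, hBC, hC, hme, h⟩ := aux_G0 hdeg hp hq hD hsf hD4 hω hm0 hws
  have hr0 : (r : 𝓞 K) ≠ 0 := by exact_mod_cast hr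
  have hrI : Ideal.span {(r : 𝓞 K)} ≠ 0 := by simpa using hr
  have hme' : ((A + 2 : ℤ) : 𝓞 K) = r ^ 2 * e ∨ ((A + 2 : ℤ) : 𝓞 K) = -(r ^ 2 * e) := by
    rcases Int.natAbs_eq (A + 2) with h' | h' <;> rw [hme] at h'
    · left; rw [h']; push_cast; ring
    · right; rw [h']; push_cast; ring
  have hCc : ∃ c, w = r * c ∧ C = Ideal.span {c} := by
    have h1 : Ideal.span {(r : 𝓞 K)} ∣ Ideal.span {w} := Dvd.intro _ hBC.symm
    rw [Ideal.dvd_iff_le, Ideal.span_singleton_le_span_singleton] at h1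
    obtain ⟨c, hc⟩ := h1
    refine ⟨c, hc, ?_⟩
    apply mul_left_cancel₀ hrI
    rw [← hBC, hc, Ideal.span_singleton_mul_span_singleton]
  obtain ⟨c, hc, hCc⟩ := hCc
  have key : ∀ s : 𝓞 K, s ≠ 0 → s ^ 2 = e → C = Ideal.span {s} → False := by
    intro s hs hse hCs
    rw [hCc, Ideal.span_singleton_eq_span_singleton] at hCs
    obtain ⟨v, hv⟩ := hCs.symm
    refine aux_nosq ε hε hinf v ?_
    have h7 : ((r : 𝓞 K) * s) ^ 2 ≠ 0 := pow_ne_zero _ (mul_ne_zero hr0 hs)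
    have h8 : ((r : 𝓞 K) * s) ^ 2 * (v : 𝓞 K) ^ 2 = ε * ((A + 2 : ℤ) : 𝓞 K) := by
      rw [← hwm, hc, ← hv]; ring
    rcases hme' with h9 | h9
    · left; ext1; rw [Units.val_pow_eq_pow_val]; apply mul_left_cancel₀ h7
      rw [h8, h9, ← hse]; ring
    · right; ext1; rw [Units.val_pow_eq_pow_val, Units.val_neg]; apply mul_left_cancel₀ h7
      rw [h8, h9, ← hse]; ring
  rcases h with ⟨h, h'⟩ | ⟨h, h'⟩ | h | ⟨E, hE, hωE⟩
  · exact (key 1 one_ne_zero (by rw [h']; simp) (by rw [h]; simp)).elim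
  · exact (key ω hω0 (by rw [h', hω']) h).elim
  · exact ⟨c, by rw [← hCc, h]⟩
  · have h1 : C ∣ Ideal.span {ω} := Dvd.intro _ hωE.symm
    rw [hCc, Ideal.dvd_iff_le, Ideal.span_singleton_le_span_singleton] at h1
    obtain ⟨d, hd⟩ := h1
    refine ⟨d, ?_⟩
    rw [← hE]; congr 1
    have hC0 : C ≠ 0 := by rintro h0; rw [h0, zero_mul] at hωE; apply hω0; simpa using hωE
    apply mul_left_cancel₀ hC0
    rw [← hωE, hd, hCc, Ideal.span_singleton_mul_span_singleton]

theorem aux_J (hdeg : Module.finrank ℚ K = 2) {D : ℤ} (hD : ¬ IsSquare D)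
    {ω : 𝓞 K} (hω : ω ^ 2 = (D : 𝓞 K)) {x y b : ℤ} (hxy : x ^ 2 + y ^ 2 = D * b ^ 2)
    (hcop : IsCoprime y (2 * x)) (hy : y ≠ 0) :
    ∃ J : nonZeroDivisors (Ideal (𝓞 K)), (J : Ideal (𝓞 K)) ^ 2 = Ideal.span {(x : 𝓞 K) + b * ω} ∧
      Ideal.absNorm (J : Ideal (𝓞 K)) = y.natAbs ∧ Algebra.norm ℤ ((x : 𝓞 K) + b * ω) < 0 := by
  have hN : Algebra.norm ℤ ((x : 𝓞 K) + b * ω) = - y ^ 2 := by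
    rw [aux_quad_norm_of hdeg hD hω]; linear_combination hxy
  have hNneg : Algebra.norm ℤ ((x : 𝓞 K) + b * ω) < 0 := by
    rw [hN]; have := pow_pos (abs_pos.2 hy) 2; rw [sq_abs] at this; linarith
  have hxy' : (x : 𝓞 K) ^ 2 + y ^ 2 = D * b ^ 2 := by exact_mod_cast congrArg (Int.cast : ℤ → 𝓞 K) hxy
  obtain ⟨u, v, huv⟩ := hcop
  have huv' : (u : 𝓞 K) * y + v * (2 * x) = 1 := by exact_mod_cast congrArg (Int.cast : ℤ → 𝓞 K) huv
  set z : 𝓞 K := x + b * ω with hz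
  have hz2 : z * (2 * x) = z ^ 2 - y ^ 2 := by
    rw [hz]; linear_combination hxy' - (b : 𝓞 K) ^ 2 * hω
  have hyz : (y : 𝓞 K) ^ 2 = z * (z - 2 * x) := by linear_combination hz2
  set J : Ideal (𝓞 K) := Ideal.span {(y : 𝓞 K), z} with hJ
  have hJ2 : J ^ 2 = Ideal.span {z} := by
    apply le_antisymm
    · rw [sq, hJ, Ideal.span_pair_mul_span_pair, Ideal.span_le]
      intro t ht
      simp only [Set.mem_insert_iff, Set.mem_singleton_iff] at ht
      rw [SetLike.mem_coe, Ideal.mem_span_singleton]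
      rcases ht with rfl | rfl | rfl | rfl
      · exact ⟨z - 2 * x, by rw [← hyz]; ring⟩
      · exact Dvd.intro_left _ rfl
      · exact Dvd.intro _ rfl
      · exact Dvd.intro _ rfl
    · rw [Ideal.span_singleton_le_iff_mem]
      have hyJ : (y : 𝓞 K) ∈ J := Ideal.subset_span (by simp)
      have hzJ : z ∈ J := Ideal.subset_span (by simp)
      have e : z = u * (y * z) + v * (z * z - y * y) := by
        linear_combination (-z) * huv' + v * hz2
      rw [e, sq]
      exact Ideal.add_mem _ (Ideal.mul_mem_left _ _ (Ideal.mul_mem_mul hyJ hzJ))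
        (Ideal.mul_mem_left _ _ (Ideal.sub_mem _ (Ideal.mul_mem_mul hzJ hzJ) (Ideal.mul_mem_mul hyJ hyJ)))
  have hz0 : z ≠ 0 := by intro h; rw [h] at hNneg; simp at hNneg
  have hJ0 : J ≠ 0 := by intro h; rw [h] at hJ2; apply hz0; simpa using hJ2.symm
  refine ⟨⟨J, mem_nonZeroDivisors_of_ne_zero hJ0⟩, hJ2, ?_, hNneg⟩
  have := congrArg Ideal.absNorm hJ2
  rw [map_pow, Ideal.absNorm_span_singleton, hN, Int.natAbs_neg, Int.natAbs_pow] at this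
  exact Nat.pow_left_injective (n := 2) (by norm_num) this

theorem aux_pnorm (hdeg : Module.finrank ℚ K = 2) {D : ℤ} (hD : ¬ IsSquare D)
    {ω : 𝓞 K} (hω : ω ^ 2 = (D : 𝓞 K)) {p : ℕ} {C : Ideal (𝓞 K)} (hC : C ^ 2 = Ideal.span {(p : 𝓞 K)}) :
    Ideal.absNorm C = p := by
  have := congrArg Ideal.absNorm hC
  have h := aux_quad_norm_of hdeg hD hω p 0
  simp only [Int.cast_natCast, Int.cast_zero, zero_mul, add_zero] at h
  rw [map_pow, Ideal.absNorm_span_singleton, h] at this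
  simp [Int.natAbs_pow] at this
  exact this

end

theorem aux_prime {p q : ℕ} (hpq : p ≠ q) [Fact p.Prime] [Fact q.Prime]
    (hp4 : p % 4 = 1) (hq4 : q % 4 = 1) :
    ∃ l : ℕ, l.Prime ∧ l ≠ 2 ∧ l ≠ q ∧ ¬ IsSquare (l : ZMod q) ∧ IsSquare ((p * q : ℕ) : ZMod l) := by
  have hp : p.Prime := Fact.out
  have hq : q.Prime := Fact.out
  have hcop : Nat.Coprime p q := (Nat.coprime_primes hp hq).2 hpq
  obtain ⟨u, hu⟩ := FiniteField.exists_nonsquare (F := ZMod p) (by rw [ZMod.ringChar_zmod_n]; omega)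
  obtain ⟨v, hv⟩ := FiniteField.exists_nonsquare (F := ZMod q) (by rw [ZMod.ringChar_zmod_n]; omega)
  have : NeZero (p * q) := ⟨mul_ne_zero hp.ne_zero hq.ne_zero⟩
  let e := ZMod.chineseRemainder hcop
  have hu0 : u ≠ 0 := by rintro rfl; exact hu (by simp)
  have hv0 : v ≠ 0 := by rintro rfl; exact hv (by simp)
  have hunit : IsUnit (e.symm (u, v)) := by
    refine IsUnit.map e.symm ?_
    rw [Prod.isUnit_iff]; exact ⟨hu0.isUnit, hv0.isUnit⟩
  obtain ⟨l, hlgt, hl, hla⟩ := Nat.forall_exists_prime_gt_and_eq_mod hunit (p * q)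
  have h1 : e (l : ZMod (p * q)) = (u, v) := by rw [hla]; simp
  rw [map_natCast] at h1
  have hlu : (l : ZMod p) = u := by simpa using congrArg Prod.fst h1
  have hlv : (l : ZMod q) = v := by simpa using congrArg Prod.snd h1
  have hfl : Fact l.Prime := ⟨hl⟩
  have h5p : 5 ≤ p := by have := hp.two_le; omega
  have h5q : 5 ≤ q := by have := hq.two_le; omega
  have hl2 : l ≠ 2 := by nlinarith
  refine ⟨l, hl, hl2, by nlinarith, by rwa [hlv], ?_⟩
  have e1 : ¬ IsSquare (p : ZMod l) := by
    rw [← ZMod.exists_sq_eq_prime_iff_of_mod_four_eq_one hp4 hl2, hlu]; exact hu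
  have e2 : ¬ IsSquare (q : ZMod l) := by
    rw [← ZMod.exists_sq_eq_prime_iff_of_mod_four_eq_one hq4 hl2, hlv]; exact hv
  have e1' : legendreSym l p = -1 := by rw [legendreSym.eq_neg_one_iff]; simpa using e1
  have e2' : legendreSym l q = -1 := by rw [legendreSym.eq_neg_one_iff]; simpa using e2
  have e3 : legendreSym l ((p : ℤ) * q) = 1 := by rw [legendreSym.mul, e1', e2']; norm_num
  have e4 := (legendreSym.eq_one_iff' l (a := p * q) ?_).1 (by push_cast; exact e3)
  · exact_mod_cast e4
  · rintro h
    have : ((p : ℤ) * q : ZMod l) = 0 := by exact_mod_cast h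
    have h6 := (legendreSym.eq_zero_iff l ((p : ℤ) * q)).2 (by exact_mod_cast this)
    rw [e3] at h6; norm_num at h6

section
variable {K : Type*} [Field K] [NumberField K]

theorem aux_C2 (hdeg : Module.finrank ℚ K = 2) {p q : ℕ} (hp : p.Prime) (hq : q.Prime)
    (hD : ¬ IsSquare ((p * q : ℕ) : ℤ)) (hsf : Squarefree ((p * q : ℕ) : ℤ))
    (hD4 : ((p * q : ℕ) : ℤ) % 4 = 1)
    {ω : 𝓞 K} (hω : ω ^ 2 = (((p * q : ℕ) : ℤ) : 𝓞 K)) (J : nonZeroDivisors (Ideal (𝓞 K)))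
    {z : 𝓞 K} (hJ : (J : Ideal (𝓞 K)) ^ 2 = Ideal.span {z}) (hz : Algebra.norm ℤ z < 0)
    (c : ClassGroup (𝓞 K)) (hc : c ^ 2 = 1) :
    ∃ I : nonZeroDivisors (Ideal (𝓞 K)), ClassGroup.mk0 I = c ∧
      (I = 1 ∨ I = J ∨ (I : Ideal (𝓞 K)) ^ 2 = Ideal.span {(p : 𝓞 K)} ∨
       ∃ C : nonZeroDivisors (Ideal (𝓞 K)), I = C * J ∧ (C : Ideal (𝓞 K)) ^ 2 = Ideal.span {(p : 𝓞 K)}) := by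
  obtain ⟨𝔞, rfl⟩ := ClassGroup.mk0_surjective c
  rw [← map_pow] at hc
  obtain ⟨t, ht⟩ := aux_mk0_exists hc
  have ht' : (𝔞 : Ideal (𝓞 K)) ^ 2 = Ideal.span {t} := ht
  have hJ1 : ClassGroup.mk0 (J ^ 2) = 1 := aux_mk0_span (z := z) hJ
  rw [map_pow, sq] at hJ1
  have ht0 : Algebra.norm ℤ t ≠ 0 := by
    intro h0
    have := congrArg Ideal.absNorm ht'
    rw [map_pow, Ideal.absNorm_span_singleton, h0, Int.natAbs_zero] at this
    have h1 := pow_eq_zero_iff (two_ne_zero) |>.1 this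
    rw [Ideal.absNorm_eq_zero_iff] at h1
    exact nonZeroDivisors.ne_zero 𝔞.2 h1
  rcases lt_or_gt_of_ne ht0 with hneg | hpos
  · have h2 : ((𝔞 * J : nonZeroDivisors (Ideal (𝓞 K))) : Ideal (𝓞 K)) ^ 2 = Ideal.span {t * z} := by
      rw [Submonoid.coe_mul, mul_pow, ht', hJ, Ideal.span_singleton_mul_span_singleton]
    rcases aux_A hdeg hp hq hD hsf hD4 hω (𝔞 * J) (z := t * z) (by rw [map_mul]; exact mul_pos_of_neg_of_neg hneg hz) h2 with h | ⟨C, hC, hC2⟩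
    · refine ⟨J, ?_, Or.inr (Or.inl rfl)⟩
      rw [map_mul] at h
      exact mul_right_cancel (hJ1.trans h.symm)
    · refine ⟨C * J, ?_, Or.inr (Or.inr (Or.inr ⟨C, rfl, hC2⟩))⟩
      rw [map_mul, hC, map_mul, mul_assoc, hJ1, mul_one]
  · rcases aux_A hdeg hp hq hD hsf hD4 hω 𝔞 hpos ht' with h | ⟨C, hC, hC2⟩
    · exact ⟨1, by rw [h, map_one], Or.inl rfl⟩
    · exact ⟨C, hC, Or.inr (Or.inr (Or.inl hC2))⟩

theorem aux_main {p q : ℕ} (hp : p.Prime) (hq : q.Prime) (hpq : p ≠ q)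
    [Fact p.Prime] [Fact q.Prime] (hp4 : p % 4 = 1) (hq4 : q % 4 = 1)
    (hsqp : IsSquare ((p : ℕ) : ZMod q)) (hdeg : Module.finrank ℚ K = 2)
    (α : K) (hα : α ^ 2 = (p : K) * q) (ε : (𝓞 K)ˣ)
    (hε : ∀ u : (𝓞 K)ˣ, ∃ n : ℤ, u = ε ^ n ∨ u = -ε ^ n)
    {x y b : ℤ} (hxy : x ^ 2 + y ^ 2 = p * q * b ^ 2) (hcop : IsCoprime y (2 * x))
    (hqy : ¬ ((q : ℤ) ∣ y)) :
    (¬ IsSquare (y : ZMod q) →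
        NumberField.classNumber K % 4 = 2 ∧ Algebra.norm ℚ ((ε : 𝓞 K) : K) = 1) ∧
      (IsSquare (y : ZMod q) → NumberField.classNumber K % 4 = 0) := by
  have hqp : ¬ q ∣ p := fun h => hpq ((Nat.prime_dvd_prime_iff_eq hq hp).1 h).symm
  have hcopn : Nat.Coprime p q := (Nat.coprime_primes hp hq).2 hpq
  have hsfn : Squarefree (p * q) :=
    (Nat.squarefree_mul_iff).2 ⟨hcopn, hp.prime.squarefree, hq.prime.squarefree⟩
  have hsf : Squarefree ((p * q : ℕ) : ℤ) := Int.squarefree_natCast.2 hsfn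
  have hD : ¬ IsSquare ((p * q : ℕ) : ℤ) := by
    rw [Int.isSquare_natCast_iff]
    rintro ⟨r, hr⟩
    have h1 : IsUnit r := hsfn r (by rw [hr])
    rw [Nat.isUnit_iff] at h1
    subst h1
    have := hp.two_le; have := hq.two_le; nlinarith
  have hD4 : ((p * q : ℕ) : ℤ) % 4 = 1 := by
    have : (p * q) % 4 = 1 := by rw [Nat.mul_mod, hp4, hq4]
    omega
  obtain ⟨ω, hω⟩ : ∃ ω : 𝓞 K, ω ^ 2 = (((p * q : ℕ) : ℤ) : 𝓞 K) := by
    have : IsIntegral ℤ α := by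
      refine IsIntegral.of_pow (n := 2) (by norm_num) ?_
      rw [hα]
      have h := isIntegral_algebraMap (R := ℤ) (A := K) (x := ((p * q : ℕ) : ℤ))
      simpa using h
    obtain ⟨w, hw⟩ : ∃ w : 𝓞 K, algebraMap (𝓞 K) K w = α := ⟨⟨α, this⟩, rfl⟩
    refine ⟨w, FaithfulSMul.algebraMap_injective (𝓞 K) K ?_⟩
    rw [map_pow, hw, hα]; simp
  have hy0 : y ≠ 0 := by rintro rfl; exact hqy (dvd_zero _)
  obtain ⟨J, hJ2, hJn, hJneg⟩ := aux_J hdeg hD hω (x := x) (y := y) (b := b) (by push_cast; exact hxy) hcop hy0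
  have hJ1 : ClassGroup.mk0 J ^ 2 = 1 := by
    rw [← map_pow]; exact aux_mk0_span (I := J ^ 2) hJ2
  have hm1 : IsSquare (-1 : ZMod q) := by
    rw [ZMod.exists_sq_eq_neg_one_iff]; omega
  have hyabs : IsSquare ((y.natAbs : ℕ) : ZMod q) ↔ IsSquare (y : ZMod q) := by
    have hyn : ((y.natAbs : ℕ) : ZMod q) = ((y.natAbs : ℤ) : ZMod q) := by simp
    rw [hyn]
    rcases Int.natAbs_eq y with h | h
    · rw [← h]
    · have h' : (y.natAbs : ℤ) = -y := by omega
      rw [h']; push_cast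
      constructor
      · intro h; have := hm1.mul h; simpa using this
      · intro h; have := hm1.mul h; simpa using this
  have hqyn : ¬ q ∣ y.natAbs := by rwa [← Int.natCast_dvd]
  have hE := aux_E hdeg hq4 hqp hD hsf hω
  have hpn := fun (C : Ideal (𝓞 K)) (h : C ^ 2 = Ideal.span {(p : 𝓞 K)}) => aux_pnorm hdeg hD hω h
  have hp0 : ((p : ℕ) : ZMod q) ≠ 0 := by rwa [Ne, ZMod.natCast_eq_zero_iff]
  have hcancel : ∀ s t : ZMod q, s ≠ 0 → IsSquare s → IsSquare (s * t) → IsSquare t := by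
    rintro s t hs ⟨a, rfl⟩ ⟨b, hb⟩
    have ha : a ≠ 0 := by rintro rfl; simp at hs
    refine ⟨b / a, ?_⟩
    field_simp; linear_combination hb
  have hC2 := aux_C2 hdeg hp hq hD hsf hD4 hω J hJ2 hJneg
  have hcard : NumberField.classNumber K = Nat.card (ClassGroup (𝓞 K)) := by
    rw [Nat.card_eq_fintype_card]; rfl
  rw [hcard]
  constructor
  · intro hns
    have hJE : ∀ g, ClassGroup.mk0 J ≠ g ^ 2 := by
      intro g hg
      have := hE J g hg (by rwa [hJn])
      rw [hJn, hyabs] at this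
      exact hns this
    have h2 : 2 ∣ Nat.card (ClassGroup (𝓞 K)) := by
      have : orderOf (ClassGroup.mk0 J) = 2 :=
        orderOf_eq_prime hJ1 (fun h => hJE 1 (by rw [h, one_pow]))
      rw [← this]; exact orderOf_dvd_natCard _
    have hnorm : Algebra.norm ℤ (ε : 𝓞 K) = 1 := by
      have hu : IsUnit (Algebra.norm ℤ (ε : 𝓞 K)) := ε.isUnit.map _
      rcases Int.isUnit_iff.1 hu with h | h
      · exact h
      · exfalso
        have h3 : (J : Ideal (𝓞 K)) ^ 2 = Ideal.span {((x : 𝓞 K) + b * ω) * ε} := by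
          rw [hJ2, Ideal.span_singleton_mul_right_unit ε.isUnit]
        rcases aux_A hdeg hp hq hD hsf hD4 hω J (by rw [map_mul, h]; linarith) h3 with h4 | ⟨C, hC, hCp⟩
        · exact hJE 1 (by rw [h4, one_pow])
        · have hn' : Ideal.absNorm ((C * J : nonZeroDivisors (Ideal (𝓞 K))) : Ideal (𝓞 K)) = p * y.natAbs := by
            rw [Submonoid.coe_mul, map_mul, hpn _ hCp, hJn]
          have h5 := hE (C * J) 1 (by rw [map_mul, hC, ← sq, hJ1, one_pow]) (by
            rw [hn', hq.dvd_mul]; tauto)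
          rw [hn'] at h5; push_cast at h5
          exact hns (hyabs.1 (hcancel _ _ hp0 hsqp (by exact_mod_cast h5)))
    refine ⟨?_, ?_⟩
    · have h4 : ¬ 4 ∣ Nat.card (ClassGroup (𝓞 K)) := by
        intro h4
        obtain ⟨v, hv⟩ := aux_H hdeg hp hq hD hsf hD4 hω ε hε hnorm
        have hpr : ∀ C : nonZeroDivisors (Ideal (𝓞 K)), (C : Ideal (𝓞 K)) ^ 2 = Ideal.span {(p : 𝓞 K)} →
            ClassGroup.mk0 C = 1 := by
          intro C hC
          exact aux_mk0_span (z := v) (aux_ideal_sq (hC.trans hv.symm))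
        obtain ⟨g, hg⟩ := aux_group h4 (ClassGroup.mk0 J) (by
          intro c hc
          obtain ⟨I, rfl, h⟩ := hC2 c hc
          rcases h with rfl | rfl | h | ⟨C, rfl, h⟩
          · left; rw [map_one]
          · right; rfl
          · left; exact hpr _ h
          · right; rw [map_mul, hpr _ h, one_mul])
        exact hJE g hg.symm
      omega
    · rw [← Algebra.coe_norm_int, hnorm]; simp
  · intro hs
    by_contra hne
    have h4 : ¬ 4 ∣ Nat.card (ClassGroup (𝓞 K)) := by omega
    obtain ⟨l, hl, hl2, hlq, hlns, hlD⟩ := aux_prime hpq hp4 hq4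
    have hfl : Fact l.Prime := ⟨hl⟩
    -- a prime ideal above `l`
    have hlnu : Ideal.span {(l : 𝓞 K)} ≠ ⊤ := by
      rw [Ne, Ideal.span_singleton_eq_top]
      intro h
      have h1 := h.map (Algebra.norm ℤ)
      have h2 := aux_quad_norm_of hdeg hD hω l 0
      simp only [Int.cast_natCast, Int.cast_zero, zero_mul, add_zero] at h2
      rw [h2, Int.isUnit_iff] at h1
      have := hl.two_le
      rcases h1 with h1 | h1
      · have h1' : l ^ 2 - ((p * q : ℕ) : ℤ) * 0 ^ 2 = 1 := h1
        nlinarith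
      · nlinarith
    obtain ⟨M, hM, hlM⟩ := Ideal.exists_le_maximal _ hlnu
    have hlM' : (l : 𝓞 K) ∈ M := hlM (Ideal.mem_span_singleton_self _)
    obtain ⟨-, -, hMn⟩ := aux_residue_hom hl2 hD hsf hdeg hω M hM.isPrime hlM' (by exact_mod_cast hlD)
    have hM0 : M ≠ 0 := by
      rintro rfl
      have : (l : 𝓞 K) = 0 := by simpa using hlM'
      exact hl.ne_zero (by exact_mod_cast this)
    let L : nonZeroDivisors (Ideal (𝓞 K)) := ⟨M, mem_nonZeroDivisors_of_ne_zero hM0⟩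
    obtain ⟨t, ht⟩ : ∃ t : ℕ, (ClassGroup.mk0 L ^ (2 * t + 1)) ^ 2 = 1 := by
      have hpow : ClassGroup.mk0 L ^ Nat.card (ClassGroup (𝓞 K)) = 1 := pow_card_eq_one'
      obtain h | h | h : Nat.card (ClassGroup (𝓞 K)) % 4 = 1 ∨ Nat.card (ClassGroup (𝓞 K)) % 4 = 3 ∨
        Nat.card (ClassGroup (𝓞 K)) % 4 = 2 := by omega
      · refine ⟨Nat.card (ClassGroup (𝓞 K)) / 2, ?_⟩
        have : 2 * (Nat.card (ClassGroup (𝓞 K)) / 2) + 1 = Nat.card (ClassGroup (𝓞 K)) := by omega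
        rw [this, hpow, one_pow]
      · refine ⟨Nat.card (ClassGroup (𝓞 K)) / 2, ?_⟩
        have : 2 * (Nat.card (ClassGroup (𝓞 K)) / 2) + 1 = Nat.card (ClassGroup (𝓞 K)) := by omega
        rw [this, hpow, one_pow]
      · refine ⟨Nat.card (ClassGroup (𝓞 K)) / 4, ?_⟩
        rw [← pow_mul]
        have : (2 * (Nat.card (ClassGroup (𝓞 K)) / 4) + 1) * 2 = Nat.card (ClassGroup (𝓞 K)) := by omega
        rw [this, hpow]
    obtain ⟨I, hI, hI'⟩ := hC2 _ ht
    have hIn : ¬ q ∣ Ideal.absNorm (I : Ideal (𝓞 K)) ∧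
        IsSquare ((Ideal.absNorm (I : Ideal (𝓞 K)) : ℕ) : ZMod q) := by
      rcases hI' with rfl | rfl | h | ⟨C, rfl, h⟩
      · simpa using hq.one_lt.ne'
      · rw [hJn]; exact ⟨hqyn, hyabs.2 hs⟩
      · rw [hpn _ h]; exact ⟨hqp, hsqp⟩
      · rw [Submonoid.coe_mul, map_mul, hJn, hpn _ h]
        refine ⟨by rw [hq.dvd_mul]; tauto, ?_⟩
        push_cast
        have := hsqp.mul (hyabs.2 hs)
        exact_mod_cast this
    have hn' : Ideal.absNorm ((I * L : nonZeroDivisors (Ideal (𝓞 K))) : Ideal (𝓞 K)) =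
        Ideal.absNorm (I : Ideal (𝓞 K)) * l := by
      rw [Submonoid.coe_mul, map_mul, hMn]
    have hql : ¬ q ∣ l := fun h => hlq ((Nat.prime_dvd_prime_iff_eq hq hl).1 h).symm
    have h5 := hE (I * L) (ClassGroup.mk0 L ^ (t + 1)) (by
      rw [map_mul, hI, ← pow_succ, ← pow_mul]; congr 1; ring) (by
      rw [hn', hq.dvd_mul]; tauto)
    rw [hn', Nat.cast_mul] at h5
    exact hlns (hcancel _ _ (by rw [Ne, ZMod.natCast_eq_zero_iff]; exact hIn.1) hIn.2 h5)
end

/-- Scholz: let `p ≡ q ≡ 1 mod 4` be distinct primes with `(p/q) = 1`, `ε_p` the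
fundamental unit of `ℚ(√p)`, and `h`, `ε` the class number and fundamental unit of
`k = ℚ(√(pq))`. If `(ε_p/q) = -1` then `h ≡ 2 mod 4` and `Nε = +1`; if
`(ε_p/q) = +1` then `4 ∣ h`. -/
theorem scholz_case_1_mod_4_residue
    (p q : ℕ) (hp : p.Prime) (hq : q.Prime) (hpq : p ≠ q)
    [Fact p.Prime] [Fact q.Prime]
    (hp4 : p % 4 = 1) (hq4 : q % 4 = 1)
    (hleg : legendreSym q p = 1)     -- `(p/q) = +1`
    (Kp : Type*) [Field Kp] [NumberField Kp]
    (hdegp : Module.finrank ℚ Kp = 2)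
    (αp : Kp) (hαp : αp ^ 2 = (p : Kp))   -- `Kp = ℚ(√p)`
    (εp : (𝓞 Kp)ˣ)
    (hεp : ∀ u : (𝓞 Kp)ˣ, ∃ n : ℤ, u = εp ^ n ∨ u = -εp ^ n)  -- fundamental unit of `ℚ(√p)`
    (𝔮 : Ideal (𝓞 Kp)) (h𝔮 : 𝔮.IsPrime) (h𝔮q : (q : 𝓞 Kp) ∈ 𝔮)  -- `𝔮` lies above `q`
    (k : Type*) [Field k] [NumberField k]
    (hdeg : Module.finrank ℚ k = 2)
    (α : k) (hα : α ^ 2 = (p : k) * q)   -- `k = ℚ(√(pq))`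
    (ε : (𝓞 k)ˣ)
    (hε : ∀ u : (𝓞 k)ˣ, ∃ n : ℤ, u = ε ^ n ∨ u = -ε ^ n)  -- fundamental unit of `k`
    : (quadResSym Kp 𝔮 (εp : 𝓞 Kp) = -1 →
        NumberField.classNumber k % 4 = 2 ∧ Algebra.norm ℚ ((ε : 𝓞 k) : k) = 1) ∧
      (quadResSym Kp 𝔮 (εp : 𝓞 Kp) = 1 →
        NumberField.classNumber k % 4 = 0) := by
  have hsqp : IsSquare ((p : ℕ) : ZMod q) := by
    have h0 : (((p : ℕ) : ℤ) : ZMod q) ≠ 0 := by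
      intro h
      rw [(legendreSym.eq_zero_iff q (p : ℤ)).2 h] at hleg
      norm_num at hleg
    have := (legendreSym.eq_one_iff q h0).1 hleg
    simpa using this
  obtain ⟨x, y, b, h1, h2, h3, h4⟩ :=
    aux_Kp hp hp4 hq4 hsqp Kp hdegp αp hαp εp hεp 𝔮 h𝔮 h𝔮q
  obtain ⟨h5, h6⟩ := aux_main hp hq hpq hp4 hq4 hsqp hdeg α hα ε hε h1 h2 h3
  refine ⟨fun h => h5 ?_, fun h => h6 (h4.1 h)⟩
  intro hy
  rw [h4.2 hy] at h
  norm_num at h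
end
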